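/- Let s₀, s₁, s₂, b₀, b₁, b₂ be real numbers satisfying: b₀+b₁+b₂ > 1/2; b₀+b₁ ≥ 0; b₀+b₂ ≥ 0; b₁+b₂ ≥ 0; s₀+s₁+s₂ > 3/2 − (b₀+b₁+b₂); s₀+s₁+s₂ > 1 − min(b₀+b₁, b₀+b₂, b₁+b₂); s₀+s₁+s₂ > 1/2 − min(b₀, b₁, b₂); s₀+s₁+s₂ > 3/4; (s₀+b₀)+2s₁+2s₂ > 1; 2s₀+(s₁+b₁)+2s₂ > 1; 2s₀+2s₁+(s₂+b₂) > 1; s₁+s₂ ≥ max(0, −b₀); s₀+s₂ ≥ max(0, −b₁); s₀+s₁ ≥ max(0, −b₂). Then there exists a constant C > 0 such that for all Schwartz functions u, v on ℝ^{1+2}, ‖uv‖_{H^{−s₀,−b₀}} ≤ C ‖u‖_{H^{s₁,b₁}} ‖v‖_{H^{s₂,b₂}}. -/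

import Mathlib

open MeasureTheory Real
open scoped FourierTransform

noncomputable section

/-- Space-time ℝ^{1+2}: coordinate 0 is time `t`, coordinates 1,2 are space `x`. -/
abbrev SpaceTime := EuclideanSpace ℝ (Fin 3)

/-- The magnitude `|ξ|` of the spatial part of a frequency point `(τ, ξ) ∈ ℝ × ℝ²`. -/
def spFreq (ζ : SpaceTime) : ℝ := Real.sqrt ((ζ 1) ^ 2 + (ζ 2) ^ 2)

/-- The wave-Sobolev norm
`‖u‖_{H^{s,b}} = (∫ (1+|ξ|²)^s (1+||τ|-|ξ||)^{2b} |û(τ,ξ)|² dτ dξ)^{1/2}`. -/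
def waveNorm (s b : ℝ) (f : SpaceTime → ℂ) : ℝ :=
  (∫ ζ : SpaceTime, (1 + (spFreq ζ) ^ 2) ^ s * (1 + |(|ζ 0| - spFreq ζ)|) ^ (2 * b) *
    ‖𝓕 f ζ‖ ^ 2) ^ (1/2 : ℝ)

open scoped ENNReal

/-- Space-time frequencies `(τ, ξ)`, with the plane identified with `ℂ`. -/
abbrev Freq := ℝ × ℂ

instance : (volume : Measure Freq).IsAddHaarMeasure :=
  inferInstanceAs ((volume : Measure ℝ).prod (volume : Measure ℂ)).IsAddHaarMeasure

/-- The `L²` norm of a nonnegative function. -/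
def l2n {α : Type*} [MeasurableSpace α] (μ : Measure α) (F : α → ℝ≥0∞) : ℝ≥0∞ :=
  (∫⁻ x, F x ^ 2 ∂μ) ^ (1 / 2 : ℝ)

/-- Integral of a function of three frequencies over the plane `z + x + y = 0`. -/
def tri (f : Freq → Freq → Freq → ℝ≥0∞) : ℝ≥0∞ := ∫⁻ z, ∫⁻ x, f z x (-(z + x))

def Meas3 (f : Freq → Freq → Freq → ℝ≥0∞) : Prop :=
  Measurable fun p : Freq × Freq × Freq => f p.1 p.2.1 p.2.2

/-- The trilinear convolution form with kernel `k` is bounded by `K` on `L² × L² × L²`. -/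
def TriBound (k : Freq → Freq → Freq → ℝ≥0∞) (K : ℝ≥0∞) : Prop :=
  ∀ F₀ F₁ F₂ : Freq → ℝ≥0∞, Measurable F₀ → Measurable F₁ → Measurable F₂ →
    tri (fun z x y => k z x y * (F₀ z * F₁ x * F₂ y)) ≤
      K * (l2n volume F₀ * l2n volume F₁ * l2n volume F₂)

theorem l2n_sq {α : Type*} [MeasurableSpace α] (μ : Measure α) (F : α → ℝ≥0∞) :
    l2n μ F ^ 2 = ∫⁻ x, F x ^ 2 ∂μ := by
  unfold l2n
  rw [← ENNReal.rpow_natCast, ← ENNReal.rpow_mul]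
  norm_num

theorem sqrt_sq_ennreal (a : ℝ≥0∞) : (a ^ 2) ^ (1 / 2 : ℝ) = a := by
  rw [← ENNReal.rpow_natCast, ← ENNReal.rpow_mul]
  norm_num

theorem lintegral_mul_le_l2n {α : Type*} [MeasurableSpace α] (μ : Measure α) {f g : α → ℝ≥0∞}
    (hf : Measurable f) (hg : Measurable g) : ∫⁻ x, f x * g x ∂μ ≤ l2n μ f * l2n μ g := by
  have h := ENNReal.lintegral_mul_le_Lp_mul_Lq μ (p := 2) (q := 2)
    (Real.HolderConjugate.two_two) hf.aemeasurable hg.aemeasurable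
  simpa [l2n, ENNReal.rpow_ofNat] using h

theorem tsum_mul_le_l2 {ι : Type*} [Countable ι] (f g : ι → ℝ≥0∞) :
    ∑' i, f i * g i ≤ (∑' i, f i ^ 2) ^ (1 / 2 : ℝ) * (∑' i, g i ^ 2) ^ (1 / 2 : ℝ) := by
  let _ : MeasurableSpace ι := ⊤
  have h := lintegral_mul_le_l2n (Measure.count : Measure ι) (f := f) (g := g)
    measurable_from_top measurable_from_top
  simpa [l2n, lintegral_count] using h

theorem Meas3.comp {f : Freq → Freq → Freq → ℝ≥0∞} (hf : Meas3 f) {α : Type*}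
    [MeasurableSpace α] {a b c : α → Freq} (ha : Measurable a) (hb : Measurable b)
    (hc : Measurable c) : Measurable fun t => f (a t) (b t) (c t) :=
  Measurable.comp (g := fun p : Freq × Freq × Freq => f p.1 p.2.1 p.2.2) hf
    (ha.prodMk (hb.prodMk hc))

theorem Meas3.mul {f g : Freq → Freq → Freq → ℝ≥0∞} (hf : Meas3 f) (hg : Meas3 g) :
    Meas3 fun z x y => f z x y * g z x y :=
  Measurable.mul hf hg

theorem Meas3.add {f g : Freq → Freq → Freq → ℝ≥0∞} (hf : Meas3 f) (hg : Meas3 g) :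
    Meas3 fun z x y => f z x y + g z x y :=
  Measurable.add hf hg

theorem meas3_prod {F₀ F₁ F₂ : Freq → ℝ≥0∞} (h₀ : Measurable F₀) (h₁ : Measurable F₁)
    (h₂ : Measurable F₂) : Meas3 fun z x y => F₀ z * F₁ x * F₂ y := by
  unfold Meas3; fun_prop

theorem Meas3.inner {f : Freq → Freq → Freq → ℝ≥0∞} (hf : Meas3 f) :
    Measurable fun p : Freq × Freq => f p.1 p.2 (-(p.1 + p.2)) :=
  hf.comp measurable_fst measurable_snd (measurable_fst.add measurable_snd).neg

theorem tri_mono {f g : Freq → Freq → Freq → ℝ≥0∞}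
    (h : ∀ z x y, z + x + y = 0 → f z x y ≤ g z x y) : tri f ≤ tri g :=
  lintegral_mono fun z => lintegral_mono fun x => h _ _ _ (by abel)

theorem tri_swap12 (f : Freq → Freq → Freq → ℝ≥0∞) : tri (fun z x y => f z y x) = tri f := by
  unfold tri
  refine lintegral_congr fun z => ?_
  have := lintegral_sub_left_eq_self (μ := (volume : Measure Freq))
    (fun x => f z x (-(z + x))) (-z)
  rw [← this]
  refine lintegral_congr fun x => ?_
  congr 1 <;> abel

theorem tri_swap01 {f : Freq → Freq → Freq → ℝ≥0∞} (hf : Meas3 f) :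
    tri (fun z x y => f x z y) = tri f := by
  unfold tri
  rw [lintegral_lintegral_swap (hf.comp measurable_snd measurable_fst
    (measurable_fst.add measurable_snd).neg).aemeasurable]
  simp_rw [add_comm]

theorem TriBound.swap12 {k : Freq → Freq → Freq → ℝ≥0∞} {K : ℝ≥0∞} (h : TriBound k K) :
    TriBound (fun z x y => k z y x) K := by
  intro F₀ F₁ F₂ h₀ h₁ h₂
  have := h F₀ F₂ F₁ h₀ h₂ h₁
  rw [← tri_swap12] at this
  convert this using 1
  · congr 1; ext z x y; ring
  · ring

theorem TriBound.swap01 {k : Freq → Freq → Freq → ℝ≥0∞} {K : ℝ≥0∞} (hk : Meas3 k)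
    (h : TriBound k K) : TriBound (fun z x y => k x z y) K := by
  intro F₀ F₁ F₂ h₀ h₁ h₂
  have := h F₁ F₀ F₂ h₁ h₀ h₂
  rw [← tri_swap01 (hk.mul (meas3_prod h₁ h₀ h₂))] at this
  convert this using 1
  · congr 1; ext z x y; ring
  · ring

theorem TriBound.mono {k k' : Freq → Freq → Freq → ℝ≥0∞} {K K' : ℝ≥0∞} (h : TriBound k' K')
    (hk : ∀ z x y, z + x + y = 0 → k z x y ≤ k' z x y) (hK : K' ≤ K) : TriBound k K := by
  intro F₀ F₁ F₂ h₀ h₁ h₂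
  refine (tri_mono fun z x y hz => ?_).trans ((h F₀ F₁ F₂ h₀ h₁ h₂).trans ?_)
  · gcongr; exact hk z x y hz
  · gcongr

theorem TriBound.add {k k' : Freq → Freq → Freq → ℝ≥0∞} {K K' : ℝ≥0∞} (h : TriBound k K)
    (h' : TriBound k' K') (hk : Meas3 k) : TriBound (fun z x y => k z x y + k' z x y) (K + K') := by
  intro F₀ F₁ F₂ h₀ h₁ h₂
  rw [add_mul]
  refine le_trans (le_of_eq ?_) (add_le_add (h F₀ F₁ F₂ h₀ h₁ h₂) (h' F₀ F₁ F₂ h₀ h₁ h₂))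
  unfold tri
  have hm := (hk.mul (meas3_prod h₀ h₁ h₂)).inner
  rw [← lintegral_add_left hm.lintegral_prod_right']
  refine lintegral_congr fun z => ?_
  have hz := lintegral_add_left (μ := (volume : Measure Freq))
    (hm.comp (measurable_prodMk_left (x := z)))
    (fun x => k' z x (-(z + x)) * (F₀ z * F₁ x * F₂ (-(z + x))))
  simp only [Function.comp_def] at hz
  rw [← hz]
  simp_rw [add_mul]

theorem TriBound.const_mul {k : Freq → Freq → Freq → ℝ≥0∞} {K c : ℝ≥0∞} (hc : c ≠ ∞)
    (h : TriBound k K) : TriBound (fun z x y => c * k z x y) (c * K) := by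
  intro F₀ F₁ F₂ h₀ h₁ h₂
  calc _ = c * tri (fun z x y => k z x y * (F₀ z * F₁ x * F₂ y)) := by
        unfold tri
        rw [← lintegral_const_mul' _ _ hc]
        refine lintegral_congr fun z => ?_
        rw [← lintegral_const_mul' _ _ hc]
        simp_rw [mul_assoc]
    _ ≤ _ := by
        rw [mul_assoc]; gcongr; exact h F₀ F₁ F₂ h₀ h₁ h₂

theorem triBound_of_sq_le {k : Freq → Freq → Freq → ℝ≥0∞} {M : ℝ≥0∞} (hk : Meas3 k)
    (h : ∀ z, ∫⁻ x, k z x (-(z + x)) ^ 2 ≤ M) : TriBound k (M ^ (1 / 2 : ℝ)) := by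
  intro F₀ F₁ F₂ h₀ h₁ h₂
  have hG : Measurable fun p : Freq × Freq => (F₁ p.2 * F₂ (-(p.1 + p.2))) ^ 2 := by fun_prop
  have hGi : Measurable fun z : Freq => ∫⁻ x, (F₁ x * F₂ (-(z + x))) ^ 2 := hG.lintegral_prod_right'
  calc tri (fun z x y => k z x y * (F₀ z * F₁ x * F₂ y))
      ≤ ∫⁻ z, F₀ z * (M ^ (1 / 2 : ℝ) * l2n volume fun x => F₁ x * F₂ (-(z + x))) := by
        refine lintegral_mono fun z => ?_
        have hkz : Measurable fun x => k z x (-(z + x)) :=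
          hk.comp measurable_const measurable_id (measurable_const.add measurable_id).neg
        have hm : Measurable fun x => F₁ x * F₂ (-(z + x)) := by fun_prop
        calc ∫⁻ x, k z x (-(z + x)) * (F₀ z * F₁ x * F₂ (-(z + x)))
            = ∫⁻ x, F₀ z * (k z x (-(z + x)) * (F₁ x * F₂ (-(z + x)))) := by
              refine lintegral_congr fun x => ?_
              ring
          _ = F₀ z * ∫⁻ x, (k z x (-(z + x)) * (F₁ x * F₂ (-(z + x)))) :=
              lintegral_const_mul _ (hkz.mul hm)
          _ ≤ _ := by
              gcongr
              refine (lintegral_mul_le_l2n _ hkz hm).trans ?_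
              gcongr
              unfold l2n
              gcongr
              exact h z
    _ = M ^ (1 / 2 : ℝ) * ∫⁻ z, F₀ z * l2n volume fun x => F₁ x * F₂ (-(z + x)) := by
        have : Measurable fun z : Freq => l2n volume fun x => F₁ x * F₂ (-(z + x)) :=
          hGi.pow_const _
        have hl := lintegral_const_mul (μ := volume) (M ^ (1 / 2 : ℝ)) (h₀.mul this)
        simp only [Pi.mul_apply] at hl
        rw [← hl]
        refine lintegral_congr fun z => ?_
        ring
    _ ≤ M ^ (1 / 2 : ℝ) * (l2n volume F₀ *
          l2n volume (fun z => l2n volume fun x => F₁ x * F₂ (-(z + x)))) := by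
        gcongr
        exact lintegral_mul_le_l2n _ h₀ (hGi.pow_const _)
    _ = _ := by
        rw [mul_assoc (l2n volume F₀)]
        congr 2
        have : ∫⁻ z, (l2n volume fun x => F₁ x * F₂ (-(z + x))) ^ 2 =
            (l2n volume F₁ * l2n volume F₂) ^ 2 := by
          simp_rw [l2n_sq]
          rw [lintegral_lintegral_swap hG.aemeasurable, mul_pow, l2n_sq, l2n_sq,
            ← lintegral_mul_const _ (h₁.pow_const 2)]
          refine lintegral_congr fun x => ?_
          simp_rw [mul_pow]
          rw [lintegral_const_mul _ (by fun_prop)]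
          congr 1
          have := lintegral_sub_left_eq_self (μ := (volume : Measure Freq))
            (fun z => F₂ z ^ 2) (-x)
          rw [← this]
          refine lintegral_congr fun z => ?_
          congr 2; abel
        rw [l2n, this, sqrt_sq_ennreal]

open Classical in
/-- The restriction of `F` to the fibre of `κ` over `a`. -/
def fibre {α ι : Type*} (κ : α → ι) (F : α → ℝ≥0∞) (a : ι) (x : α) : ℝ≥0∞ :=
  if κ x = a then F x else 0

theorem measurable_fibre {α ι : Type*} [MeasurableSpace α] [MeasurableSpace ι]
    [MeasurableSingletonClass ι] {κ : α → ι} (hκ : Measurable κ) {F : α → ℝ≥0∞}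
    (hF : Measurable F) (a : ι) : Measurable (fibre κ F a) :=
  Measurable.ite (hκ (measurableSet_singleton a)) hF measurable_const

theorem tsum_l2n_fibre_sq {α ι : Type*} [MeasurableSpace α] [MeasurableSpace ι]
    [MeasurableSingletonClass ι] [Countable ι] (μ : Measure α) {κ : α → ι} (hκ : Measurable κ)
    {F : α → ℝ≥0∞} (hF : Measurable F) :
    ∑' a, l2n μ (fibre κ F a) ^ 2 = l2n μ F ^ 2 := by
  simp_rw [l2n_sq]
  rw [← lintegral_tsum fun a => ((measurable_fibre hκ hF a).pow_const 2).aemeasurable]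
  refine lintegral_congr fun x => ?_
  rw [tsum_eq_single (κ x) fun a ha => by simp [fibre, Ne.symm ha]]
  simp [fibre]

theorem tri_tsum {ι : Type*} [Countable ι] {f : ι → Freq → Freq → Freq → ℝ≥0∞}
    (hf : ∀ i, Meas3 (f i)) : tri (fun z x y => ∑' i, f i z x y) = ∑' i, tri (f i) := by
  unfold tri
  rw [← lintegral_tsum fun i => (hf i).inner.lintegral_prod_right'.aemeasurable]
  refine lintegral_congr fun z => ?_
  have hz := lintegral_tsum (μ := (volume : Measure Freq))
    (f := fun i x => f i z x (-(z + x)))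
    fun i => ((hf i).inner.comp (measurable_prodMk_left (x := z))).aemeasurable
  exact hz

open Classical in
/-- A trilinear form is bounded if its blocks are, with block bounds satisfying two
one-sided summability conditions. -/
theorem triBound_of_blocks {ι₀ ι₁ ι₂ : Type*} [Countable ι₀] [Countable ι₁] [Countable ι₂]
    [MeasurableSpace ι₀] [MeasurableSpace ι₁] [MeasurableSpace ι₂]
    [MeasurableSingletonClass ι₀] [MeasurableSingletonClass ι₁] [MeasurableSingletonClass ι₂]
    {κ₀ : Freq → ι₀} {κ₁ : Freq → ι₁} {κ₂ : Freq → ι₂}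
    (hκ₀ : Measurable κ₀) (hκ₁ : Measurable κ₁) (hκ₂ : Measurable κ₂)
    {k : Freq → Freq → Freq → ℝ≥0∞} (hk : Meas3 k) (K : ι₀ → ι₁ → ι₂ → ℝ≥0∞) (M : ℝ≥0∞)
    (H : ∀ a b c, TriBound
      (fun z x y => if κ₀ z = a ∧ κ₁ x = b ∧ κ₂ y = c then k z x y else 0) (K a b c))
    (H₁ : ∀ b, ∑' p : ι₀ × ι₂, K p.1 b p.2 ≤ M) (H₂ : ∀ a c, ∑' b, K a b c ≤ M) :
    TriBound k M := by
  intro F₀ F₁ F₂ h₀ h₁ h₂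
  set A := fun a => l2n volume (fibre κ₀ F₀ a) with hA
  set B := fun b => l2n volume (fibre κ₁ F₁ b) with hB
  set C := fun c => l2n volume (fibre κ₂ F₂ c) with hC
  have hmeas : ∀ q : (ι₀ × ι₂) × ι₁, Meas3 fun z x y =>
      k z x y * (fibre κ₀ F₀ q.1.1 z * fibre κ₁ F₁ q.2 x * fibre κ₂ F₂ q.1.2 y) := fun q =>
    hk.mul (meas3_prod (measurable_fibre hκ₀ h₀ _) (measurable_fibre hκ₁ h₁ _)
      (measurable_fibre hκ₂ h₂ _))
  have hdec : (fun z x y => k z x y * (F₀ z * F₁ x * F₂ y)) = fun z x y =>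
      ∑' q : (ι₀ × ι₂) × ι₁,
        k z x y * (fibre κ₀ F₀ q.1.1 z * fibre κ₁ F₁ q.2 x * fibre κ₂ F₂ q.1.2 y) := by
    funext z x y
    rw [tsum_eq_single ((κ₀ z, κ₂ y), κ₁ x)]
    · simp [fibre]
    · rintro ⟨⟨a, c⟩, b⟩ hne
      by_cases ha : κ₀ z = a
      · by_cases hb : κ₁ x = b
        · by_cases hc : κ₂ y = c
          · exact absurd (by simp [ha, hb, hc]) hne
          · simp [fibre, hc]
        · simp [fibre, hb]
      · simp [fibre, ha]
  rw [hdec, tri_tsum hmeas]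
  calc ∑' q : (ι₀ × ι₂) × ι₁, tri (fun z x y =>
        k z x y * (fibre κ₀ F₀ q.1.1 z * fibre κ₁ F₁ q.2 x * fibre κ₂ F₂ q.1.2 y))
      ≤ ∑' q : (ι₀ × ι₂) × ι₁, (K q.1.1 q.2 q.1.2 ^ (1 / 2 : ℝ) * B q.2) *
          (K q.1.1 q.2 q.1.2 ^ (1 / 2 : ℝ) * (A q.1.1 * C q.1.2)) := by
        refine ENNReal.tsum_le_tsum fun q => ?_
        have hb := H q.1.1 q.2 q.1.2 _ _ _ (measurable_fibre hκ₀ h₀ q.1.1)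
          (measurable_fibre hκ₁ h₁ q.2) (measurable_fibre hκ₂ h₂ q.1.2)
        refine (tri_mono fun z x y _ => ?_).trans (hb.trans (le_of_eq ?_))
        · by_cases h : κ₀ z = q.1.1 ∧ κ₁ x = q.2 ∧ κ₂ y = q.1.2
          · simp [h]
          · rw [not_and_or, not_and_or] at h
            rcases h with h | h | h <;> simp [fibre, h]
        · have hKK : ∀ t : ℝ≥0∞, t ^ (1 / 2 : ℝ) * t ^ (1 / 2 : ℝ) = t := fun t => by
            rw [← sq, ← ENNReal.rpow_natCast, ← ENNReal.rpow_mul]; norm_num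
          conv_lhs => rw [← hKK (K q.1.1 q.2 q.1.2)]
          ring
    _ ≤ (∑' q : (ι₀ × ι₂) × ι₁, (K q.1.1 q.2 q.1.2 ^ (1 / 2 : ℝ) * B q.2) ^ 2) ^ (1 / 2 : ℝ) *
        (∑' q : (ι₀ × ι₂) × ι₁,
          (K q.1.1 q.2 q.1.2 ^ (1 / 2 : ℝ) * (A q.1.1 * C q.1.2)) ^ 2) ^ (1 / 2 : ℝ) :=
        tsum_mul_le_l2 _ _
    _ ≤ (M * l2n volume F₁ ^ 2) ^ (1 / 2 : ℝ) *
        (M * (l2n volume F₀ ^ 2 * l2n volume F₂ ^ 2)) ^ (1 / 2 : ℝ) := by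
        have hK2 : ∀ t : ℝ≥0∞, (t ^ (1 / 2 : ℝ)) ^ 2 = t := fun t => by
          rw [← ENNReal.rpow_natCast, ← ENNReal.rpow_mul]; norm_num
        simp_rw [mul_pow, hK2]
        gcongr
        · rw [ENNReal.tsum_prod (f := fun (p : ι₀ × ι₂) (b : ι₁) => K p.1 b p.2 * B b ^ 2), ENNReal.tsum_comm,
            ← tsum_l2n_fibre_sq volume hκ₁ h₁, ← ENNReal.tsum_mul_left]
          refine ENNReal.tsum_le_tsum fun b => ?_
          rw [ENNReal.tsum_mul_right]
          gcongr
          exact H₁ b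
        · rw [ENNReal.tsum_prod (f := fun (p : ι₀ × ι₂) (b : ι₁) => K p.1 b p.2 * (A p.1 ^ 2 * C p.2 ^ 2))]
          simp_rw [ENNReal.tsum_mul_right]
          calc _ ≤ ∑' p : ι₀ × ι₂, M * (A p.1 ^ 2 * C p.2 ^ 2) := by
                refine ENNReal.tsum_le_tsum fun p => ?_
                gcongr
                exact H₂ _ _
            _ = _ := by
                rw [ENNReal.tsum_mul_left, ENNReal.tsum_prod (f := fun a c => A a ^ 2 * C c ^ 2),
                  ← tsum_l2n_fibre_sq volume hκ₀ h₀, ← tsum_l2n_fibre_sq volume hκ₂ h₂,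
                  ← ENNReal.tsum_mul_right]
                simp_rw [← ENNReal.tsum_mul_left]
                rfl
    _ = M * (l2n volume F₀ * l2n volume F₁ * l2n volume F₂) := by
        rw [← ENNReal.mul_rpow_of_nonneg _ _ (by norm_num),
          show M * l2n volume F₁ ^ 2 * (M * (l2n volume F₀ ^ 2 * l2n volume F₂ ^ 2)) =
            (M * (l2n volume F₀ * l2n volume F₁ * l2n volume F₂)) ^ 2 by ring, sqrt_sq_ennreal]

/-- The distance of a frequency to the light cone. -/
def coneDist (x : Freq) : ℝ := |(|x.1| - ‖x.2‖)|

theorem volume_le_of_slices {V : Set Freq} {S : Set ℂ} (hS : MeasurableSet S) {c : ℂ → ℝ}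
    (hc : Measurable c) {a L : ℝ} (hV : ∀ x ∈ V, x.2 ∈ S ∧ |(|x.1 + a| - c x.2)| ≤ L) :
    volume V ≤ ENNReal.ofReal (4 * L) * volume S := by
  by_cases hL : 0 ≤ L
  swap
  · have : V = ∅ := by
      ext x
      simp only [Set.mem_empty_iff_false, iff_false]
      exact fun hx => hL ((abs_nonneg _).trans (hV x hx).2)
    simp [this]
  set W : Set Freq := {x | x.2 ∈ S ∧ |(|x.1 + a| - c x.2)| ≤ L} with hW
  have hWm : MeasurableSet W := by
    have hm : Measurable fun x : Freq => |(|x.1 + a| - c x.2)| := by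
      simp only [← Real.norm_eq_abs]
      fun_prop
    exact (measurable_snd hS).inter (measurableSet_le hm measurable_const)
  refine (measure_mono (t := W) hV).trans ?_
  change ((volume : Measure ℝ).prod (volume : Measure ℂ)) W ≤ _
  rw [Measure.prod_apply_symm hWm, ← setLIntegral_const, ← lintegral_indicator hS]
  refine lintegral_mono fun ξ => ?_
  by_cases hξ : ξ ∈ S
  · rw [Set.indicator_of_mem hξ]
    calc volume ((fun τ : ℝ => (τ, ξ)) ⁻¹' W)
        ≤ volume (Set.Icc (c ξ - L - a) (c ξ + L - a) ∪
            Set.Icc (-c ξ - L - a) (-c ξ + L - a)) := by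
          refine measure_mono fun τ hτ => ?_
          have h := abs_le.1 hτ.2
          simp only at h
          rcases abs_cases (τ + a) with h' | h'
          · left; constructor <;> linarith
          · right; constructor <;> linarith
      _ ≤ ENNReal.ofReal (2 * L) + ENNReal.ofReal (2 * L) := by
          refine (measure_union_le _ _).trans ?_
          rw [Real.volume_Icc, Real.volume_Icc]
          gcongr <;> linarith
      _ = _ := by
          rw [← ENNReal.ofReal_add (by positivity) (by positivity)]; congr 1; ring
  · rw [Set.indicator_of_notMem hξ, nonpos_iff_eq_zero]
    have : (fun τ : ℝ => (τ, ξ)) ⁻¹' W = ∅ := by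
      ext τ
      simp [hW, hξ]
    rw [this, measure_empty]

/-- The spatial frequencies `ξ` for which some `τ` puts both `(τ, ξ)` and `(t + τ, ω + ξ)` near the
light cone. -/
def interactionSet (t : ℝ) (ω : ℂ) (Λ : ℝ) : Set ℂ :=
  {ξ | |(‖ξ‖ + ‖ξ + ω‖ - |t|)| ≤ Λ ∨ |(‖ξ‖ - ‖ξ + ω‖ - t)| ≤ Λ ∨ |(‖ξ‖ - ‖ξ + ω‖ + t)| ≤ Λ}

theorem measurableSet_interactionSet (t : ℝ) (ω : ℂ) (Λ : ℝ) :
    MeasurableSet (interactionSet t ω Λ) := by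
  have h₁ : Measurable fun ξ : ℂ => |(‖ξ‖ + ‖ξ + ω‖ - |t|)| := by
    simp only [← Real.norm_eq_abs]; fun_prop
  have h₂ : Measurable fun ξ : ℂ => |(‖ξ‖ - ‖ξ + ω‖ - t)| := by
    simp only [← Real.norm_eq_abs]; fun_prop
  have h₃ : Measurable fun ξ : ℂ => |(‖ξ‖ - ‖ξ + ω‖ + t)| := by
    simp only [← Real.norm_eq_abs]; fun_prop
  exact (measurableSet_le h₁ measurable_const).union
    ((measurableSet_le h₂ measurable_const).union (measurableSet_le h₃ measurable_const))

theorem mem_interactionSet {x z : Freq} {L L' : ℝ} (h : coneDist x ≤ L)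
    (h' : coneDist (-(z + x)) ≤ L') : x.2 ∈ interactionSet z.1 z.2 (L + L') := by
  simp only [coneDist, Prod.fst_neg, Prod.snd_neg, Prod.fst_add, Prod.snd_add, norm_neg,
    abs_neg, add_comm z.2] at h h'
  simp only [interactionSet, Set.mem_ofPred_eq]
  rw [abs_le] at h h'
  simp only [abs_le]
  rcases abs_cases x.1 with h1 | h1 <;> rcases abs_cases (z.1 + x.1) with h2 | h2
  · right; right; constructor <;> linarith
  · left; rcases abs_cases z.1 with h3 | h3 <;> constructor <;>
      linarith [norm_nonneg x.2, norm_nonneg (x.2 + z.2)]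
  · left; rcases abs_cases z.1 with h3 | h3 <;> constructor <;>
      linarith [norm_nonneg x.2, norm_nonneg (x.2 + z.2)]
  · right; left; constructor <;> linarith

theorem volume_le_area {V : Set Freq} {S : Set ℂ} (hS : MeasurableSet S) {z : Freq} {L L' : ℝ}
    (hV : ∀ x ∈ V, x.2 ∈ S ∧ coneDist x ≤ L ∧ coneDist (-(z + x)) ≤ L') :
    volume V ≤ ENNReal.ofReal (4 * min L L') *
      volume (S ∩ interactionSet z.1 z.2 (L + L')) := by
  have hm := hS.inter (measurableSet_interactionSet z.1 z.2 (L + L'))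
  have hmem : ∀ x ∈ V, x.2 ∈ S ∩ interactionSet z.1 z.2 (L + L') := fun x hx =>
    ⟨(hV x hx).1, mem_interactionSet (hV x hx).2.1 (hV x hx).2.2⟩
  rcases min_cases L L' with h | h <;> rw [h.1]
  · refine volume_le_of_slices hm (c := fun ξ => ‖ξ‖) (a := 0) (by fun_prop) fun x hx =>
      ⟨hmem x hx, ?_⟩
    have := (hV x hx).2.1
    simpa [coneDist] using this
  · refine volume_le_of_slices hm (c := fun ξ => ‖z.2 + ξ‖) (a := z.1) (by fun_prop) fun x hx =>
      ⟨hmem x hx, ?_⟩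
    have := (hV x hx).2.2
    rw [coneDist, Prod.fst_neg, Prod.snd_neg, norm_neg, abs_neg] at this
    simpa [add_comm z.1] using this

theorem lintegral_inv_sqrt_Ioc (R : ℝ) (hR : 0 ≤ R) :
    ∫⁻ x in Set.Ioc 0 R, ENNReal.ofReal (1 / √x) = ENNReal.ofReal (2 * √R) := by
  have hi := (intervalIntegral.intervalIntegrable_rpow' (a := 0) (b := R) (r := -(1 / 2))
    (by norm_num)).1
  have hI : ∫ x in Set.Ioc 0 R, x ^ (-(1 / 2) : ℝ) = 2 * √R := by
    rw [← intervalIntegral.integral_of_le hR, integral_rpow (Or.inl (by norm_num)),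
      Real.sqrt_eq_rpow]
    norm_num
    ring
  rw [← hI, ofReal_integral_eq_lintegral_ofReal hi]
  · refine setLIntegral_congr_fun measurableSet_Ioc fun x hx => ?_
    rw [Real.rpow_neg hx.1.le, Real.sqrt_eq_rpow, one_div]
  · refine (ae_restrict_iff' measurableSet_Ioc).2 (Filter.Eventually.of_forall fun x hx => ?_)
    exact Real.rpow_nonneg hx.1.le _

theorem lintegral_inv_sqrt_le (c : ℝ) {R : ℝ} (hR : 0 ≤ R) :
    ∫⁻ x in Set.Icc (c - R) (c + R), ENNReal.ofReal (1 / √|x - c|) ≤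
      ENNReal.ofReal (4 * √R) := by
  have h0 : ∫⁻ x, (Set.Ioc 0 R).indicator (fun x => ENNReal.ofReal (1 / √x)) x =
      ENNReal.ofReal (2 * √R) := by
    rw [lintegral_indicator measurableSet_Ioc, lintegral_inv_sqrt_Ioc R hR]
  have h1 := lintegral_sub_left_eq_self (μ := (volume : Measure ℝ))
    (fun x => (Set.Ioc 0 R).indicator (fun x => ENNReal.ofReal (1 / √x)) x) c
  have h2 := lintegral_sub_right_eq_self (μ := (volume : Measure ℝ))
    (fun x => (Set.Ioc 0 R).indicator (fun x => ENNReal.ofReal (1 / √x)) x) c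
  have hmeas : Measurable fun x : ℝ =>
      (Set.Ioc 0 R).indicator (fun x => ENNReal.ofReal (1 / √x)) (x - c) := by
    have : Measurable ((Set.Ioc 0 R).indicator (fun x => ENNReal.ofReal (1 / √x))) :=
      Measurable.indicator (by fun_prop) measurableSet_Ioc
    exact this.comp (measurable_id.sub_const c)
  rw [show 4 * √R = 2 * √R + 2 * √R by ring, ENNReal.ofReal_add (by positivity) (by positivity),
    ← h0]
  conv_rhs => rw [← h1]
  conv_rhs => enter [2]; rw [h1, ← h2]
  rw [← lintegral_add_right _ hmeas, ← lintegral_indicator measurableSet_Icc]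
  refine lintegral_mono fun x => ?_
  by_cases hx : x ∈ Set.Icc (c - R) (c + R)
  · rw [Set.indicator_of_mem hx]
    rcases lt_trichotomy x c with h | h | h
    · refine le_add_right (le_of_eq ?_)
      rw [Set.indicator_of_mem (show c - x ∈ Set.Ioc 0 R from
        ⟨by linarith, by linarith [hx.1]⟩), abs_of_neg (by linarith), neg_sub]
    · simp [h]
    · refine le_add_left (le_of_eq ?_)
      rw [Set.indicator_of_mem (show x - c ∈ Set.Ioc 0 R from
        ⟨by linarith, by linarith [hx.2]⟩), abs_of_pos (by linarith)]
  · rw [Set.indicator_of_notMem hx]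
    exact zero_le

/-- The integral of `|x - c|^{-1/2}` over an interval of radius `Λ` around `a`. -/
theorem lintegral_inv_sqrt_near (a c : ℝ) {Λ : ℝ} (hΛ : 0 < Λ) :
    ∫⁻ x in Set.Icc (a - Λ) (a + Λ), ENNReal.ofReal (1 / √|x - c|) ≤
      ENNReal.ofReal (12 * Λ / √(Λ + |a - c|)) := by
  have hc : ∀ H : ℝ, 0 < H → ∀ J : Set ℝ, MeasurableSet J → J ⊆ Set.Icc (a - Λ) (a + Λ) →
      (∀ x ∈ J, H ≤ |x - c|) →
      ∫⁻ x in J, ENNReal.ofReal (1 / √|x - c|) ≤ ENNReal.ofReal (2 * Λ / √H) := by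
    intro H hH J hJm hJ hx
    calc _ ≤ ∫⁻ x in J, ENNReal.ofReal (1 / √H) := by
          refine setLIntegral_mono' hJm fun x hxJ => ?_
          gcongr
          exact hx x hxJ
      _ ≤ ENNReal.ofReal (1 / √H) * ENNReal.ofReal (2 * Λ) := by
          rw [setLIntegral_const]
          gcongr
          refine (measure_mono hJ).trans ?_
          rw [Real.volume_Icc]
          gcongr
          linarith
      _ = _ := by
          rw [← ENNReal.ofReal_mul (by positivity)]
          congr 1
          ring
  rcases le_total |a - c| (3 * Λ) with h | h
  · have h6 : 6 * √Λ ≤ 12 * Λ / √(Λ + |a - c|) := by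
      rw [le_div_iff₀ (by positivity)]
      calc 6 * √Λ * √(Λ + |a - c|) ≤ 6 * √Λ * √(2 ^ 2 * Λ) := by
            gcongr; linarith
        _ = 12 * (√Λ * √Λ) := by
            rw [Real.sqrt_mul (by norm_num), Real.sqrt_sq (by norm_num)]; ring
        _ = 12 * Λ := by rw [Real.mul_self_sqrt hΛ.le]
    refine le_trans ?_ (ENNReal.ofReal_le_ofReal h6)
    rw [show 6 * √Λ = 4 * √Λ + 2 * Λ / √Λ by rw [mul_div_assoc, Real.div_sqrt]; ring,
      ENNReal.ofReal_add (by positivity) (by positivity)]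
    calc _ ≤ ∫⁻ x in Set.Icc (c - Λ) (c + Λ) ∪
          (Set.Icc (a - Λ) (a + Λ) \ Set.Icc (c - Λ) (c + Λ)),
          ENNReal.ofReal (1 / √|x - c|) :=
          lintegral_mono_set (by rw [Set.union_sdiff_self]; exact Set.subset_union_right)
      _ ≤ _ := (lintegral_union_le _ _ _).trans (add_le_add (lintegral_inv_sqrt_le c hΛ.le)
          (hc Λ hΛ _ (measurableSet_Icc.diff measurableSet_Icc) Set.sdiff_subset fun x hx => by
            by_contra hlt
            push Not at hlt
            have := abs_lt.1 hlt
            exact hx.2 ⟨by linarith, by linarith⟩))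
  · have hH : 0 < |a - c| - Λ := by linarith
    refine (hc _ hH _ measurableSet_Icc subset_rfl fun x hx => ?_).trans
      (ENNReal.ofReal_le_ofReal ?_)
    · have h1 : |a - c| ≤ |a - x| + |x - c| := abs_sub_le a x c
      have h2 : |a - x| ≤ Λ := abs_le.2 ⟨by linarith [hx.2], by linarith [hx.1]⟩
      linarith
    · rw [div_le_div_iff₀ (by positivity) (by positivity)]
      have : √(Λ + |a - c|) ≤ 2 * √(|a - c| - Λ) := by
        rw [Real.sqrt_le_left (by positivity), mul_pow, Real.sq_sqrt hH.le]
        linarith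
      nlinarith [Real.sqrt_nonneg (|a - c| - Λ)]

/-- A crude version of `lintegral_inv_sqrt_near`, uniform in the singularity. -/
theorem lintegral_inv_sqrt_near' (a c : ℝ) {Λ : ℝ} (hΛ : 0 < Λ) :
    ∫⁻ x in Set.Icc (a - Λ) (a + Λ), ENNReal.ofReal (1 / √|x - c|) ≤
      ENNReal.ofReal (12 * √Λ) := by
  refine (lintegral_inv_sqrt_near a c hΛ).trans (ENNReal.ofReal_le_ofReal ?_)
  rw [div_le_iff₀ (by positivity)]
  have : √Λ * √Λ = Λ := Real.mul_self_sqrt hΛ.le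
  have h2 : √Λ ≤ √(Λ + |a - c|) := Real.sqrt_le_sqrt (by linarith [abs_nonneg (a - c)])
  nlinarith [Real.sqrt_nonneg Λ]

open Classical in
/-- The density of planar Lebesgue measure in the bipolar coordinates `u = ‖ξ‖ + ‖ξ + ω‖`,
`v = ‖ξ‖ - ‖ξ + ω‖`, where `d = ‖ω‖`, up to a constant. -/
def bipolarWeight (d u v : ℝ) : ℝ≥0∞ :=
  if d < u ∧ -d < v ∧ v < d then
    ENNReal.ofReal ((u ^ 2 - v ^ 2) / √((u ^ 2 - d ^ 2) * (d ^ 2 - v ^ 2)))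
  else 0

theorem measurable_bipolarWeight (d : ℝ) :
    Measurable fun p : ℝ × ℝ => bipolarWeight d p.1 p.2 := by
  unfold bipolarWeight
  refine Measurable.ite ?_ (by fun_prop) measurable_const
  exact (measurableSet_lt measurable_const measurable_fst).inter
    ((measurableSet_lt measurable_const measurable_snd).inter
      (measurableSet_lt measurable_snd measurable_const))

/-- The third side of a triangle with sides `r`, `d` and angle `θ`. -/
def thirdSide (d r θ : ℝ) : ℝ := √(r ^ 2 + d ^ 2 - 2 * r * d * cos θ)

theorem norm_polar_sub (d r θ : ℝ) :
    ‖(r : ℂ) * (↑(cos θ) + ↑(sin θ) * Complex.I) - (d : ℂ)‖ = thirdSide d r θ := by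
  rw [thirdSide, ← Real.sqrt_sq (norm_nonneg _), Complex.sq_norm, Complex.normSq_apply]
  congr 1
  simp only [Complex.sub_re, Complex.sub_im,
    Complex.mul_re, Complex.mul_im, Complex.add_re, Complex.add_im, Complex.ofReal_re,
    Complex.ofReal_im, Complex.I_re, Complex.I_im]
  linear_combination (r ^ 2) * (Real.sin_sq_add_cos_sq θ)

theorem lintegral_angle_le {d r : ℝ} (hd : 0 < d) (hr : 0 < r) (g : ℝ → ℝ → ℝ≥0∞) :
    ∫⁻ θ in Set.Ioo 0 π, ENNReal.ofReal (2 * r) *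
        g (r + thirdSide d r θ) (r - thirdSide d r θ) ≤
      ∫⁻ σ, g (r + σ) (r - σ) * bipolarWeight d (r + σ) (r - σ) := by
  have hcos : ∀ θ ∈ Set.Ioo 0 π, 0 < sin θ ∧ cos θ < 1 ∧ -1 < cos θ := fun θ hθ => by
    have hs := Real.sin_pos_of_pos_of_lt_pi hθ.1 hθ.2
    have := Real.sin_sq_add_cos_sq θ
    exact ⟨hs, by nlinarith, by nlinarith⟩
  have hin : ∀ θ ∈ Set.Ioo 0 π, 0 < r ^ 2 + d ^ 2 - 2 * r * d * cos θ := fun θ hθ => by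
    nlinarith [mul_pos hr hd, (hcos θ hθ).2.1, sq_nonneg (r - d)]
  have hder : ∀ θ ∈ Set.Ioo 0 π, HasDerivWithinAt (thirdSide d r)
      (r * d * sin θ / thirdSide d r θ) (Set.Ioo 0 π) θ := fun θ hθ => by
    have h1 : HasDerivAt (fun θ => r ^ 2 + d ^ 2 - 2 * r * d * cos θ)
        (2 * r * d * sin θ) θ := by
      have := ((Real.hasDerivAt_cos θ).const_mul (2 * r * d)).const_sub (r ^ 2 + d ^ 2)
      exact this.congr_deriv (by ring)
    have := (h1.sqrt (hin θ hθ).ne').hasDerivWithinAt (s := Set.Ioo 0 π)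
    refine this.congr_deriv ?_
    unfold thirdSide
    rw [mul_assoc 2 r d, mul_assoc 2 (r * d), mul_div_mul_left _ _ two_ne_zero]
  have hinj : Set.InjOn (thirdSide d r) (Set.Ioo 0 π) := fun θ hθ θ' hθ' h => by
    refine Real.injOn_cos ⟨hθ.1.le, hθ.2.le⟩ ⟨hθ'.1.le, hθ'.2.le⟩ ?_
    unfold thirdSide at h
    rw [Real.sqrt_inj (hin θ hθ).le (hin θ' hθ').le] at h
    have : 2 * r * d * cos θ = 2 * r * d * cos θ' := by linarith
    exact mul_left_cancel₀ (by positivity) this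
  have key := lintegral_image_eq_lintegral_abs_deriv_mul measurableSet_Ioo hder hinj
    (fun σ => g (r + σ) (r - σ) * bipolarWeight d (r + σ) (r - σ))
  refine le_trans (le_of_eq ?_) (key.symm.le.trans (setLIntegral_le_lintegral _ _))
  refine setLIntegral_congr_fun measurableSet_Ioo fun θ hθ => ?_
  obtain ⟨hs, hc1, hc2⟩ := hcos θ hθ
  have hσ : 0 < thirdSide d r θ := Real.sqrt_pos.2 (hin θ hθ)
  have hσ2 : thirdSide d r θ ^ 2 = r ^ 2 + d ^ 2 - 2 * r * d * cos θ := Real.sq_sqrt (hin θ hθ).le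
  set σ := thirdSide d r θ
  have hrd := mul_pos hr hd
  have hb : d < r + σ ∧ -d < r - σ ∧ r - σ < d := by
    refine ⟨?_, ?_, ?_⟩
    · by_contra! h
      nlinarith
    · have : σ < r + d := lt_of_pow_lt_pow_left₀ 2 (by positivity) (by nlinarith)
      linarith
    · by_contra! h
      nlinarith
  have hprod : ((r + σ) ^ 2 - d ^ 2) * (d ^ 2 - (r - σ) ^ 2) = (2 * (r * d * sin θ)) ^ 2 := by
    have hsc := Real.sin_sq_add_cos_sq θ
    have e1 : sin θ ^ 2 = 1 - cos θ ^ 2 := by linarith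
    have e2 : ((r + σ) ^ 2 - d ^ 2) * (d ^ 2 - (r - σ) ^ 2) =
        4 * r ^ 2 * σ ^ 2 - (σ ^ 2 + r ^ 2 - d ^ 2) ^ 2 := by ring
    rw [e2, hσ2, mul_pow, mul_pow, e1]
    ring
  simp only [bipolarWeight, hb, and_self, if_true]
  rw [hprod, Real.sqrt_sq (by positivity), mul_comm (g _ _), ← mul_assoc,
    ← ENNReal.ofReal_mul (abs_nonneg _), abs_of_pos (by positivity)]
  congr 2
  field_simp
  ring

theorem lintegral_bipolar_le {ω : ℂ} (hω : ω ≠ 0) {g : ℝ → ℝ → ℝ≥0∞}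
    (hg : Measurable fun p : ℝ × ℝ => g p.1 p.2) :
    ∫⁻ ξ : ℂ, g (‖ξ‖ + ‖ξ + ω‖) (‖ξ‖ - ‖ξ + ω‖) ≤
      ∫⁻ u, ∫⁻ v, g u v * bipolarWeight ‖ω‖ u v := by
  set d := ‖ω‖ with hd
  have hd0 : 0 < d := norm_pos_iff.2 hω
  set H : ℝ → ℝ → ℝ≥0∞ := fun u v => g u v * bipolarWeight d u v with hH
  have hHm : Measurable fun p : ℝ × ℝ => H p.1 p.2 := hg.mul (measurable_bipolarWeight d)
  have hgc : ∀ {α : Type} [MeasurableSpace α] {a b : α → ℝ}, Measurable a → Measurable b →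
      Measurable fun t => g (a t) (b t) := fun ha hb =>
    Measurable.comp (g := fun p : ℝ × ℝ => g p.1 p.2) hg (ha.prodMk hb)
  have hHc : ∀ {α : Type} [MeasurableSpace α] {a b : α → ℝ}, Measurable a → Measurable b →
      Measurable fun t => H (a t) (b t) := fun ha hb =>
    Measurable.comp (g := fun p : ℝ × ℝ => H p.1 p.2) hHm (ha.prodMk hb)
  obtain ⟨c, hc⟩ : ∃ c : Circle, (c : ℂ) * (-(d : ℂ)) = ω := by
    have hdc : (d : ℂ) ≠ 0 := by exact_mod_cast hd0.ne'
    refine ⟨⟨-ω / d, ?_⟩, ?_⟩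
    · rw [← SetLike.mem_coe, Submonoid.coe_unitSphere, mem_sphere_zero_iff_norm, norm_div, norm_neg, Complex.norm_real, ← hd, norm_eq_abs,
        abs_of_pos hd0, div_self hd0.ne']
    · simp only
      field_simp
  have hrot : ∫⁻ ξ : ℂ, g (‖ξ‖ + ‖ξ + ω‖) (‖ξ‖ - ‖ξ + ω‖) =
      ∫⁻ η : ℂ, g (‖η‖ + ‖η - d‖) (‖η‖ - ‖η - d‖) := by
    rw [← (rotation c).measurePreserving.lintegral_comp_emb
      (rotation c).toHomeomorph.measurableEmbedding]
    refine lintegral_congr fun η => ?_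
    have : ‖rotation c η + ω‖ = ‖η - d‖ := by
      rw [rotation_apply, ← hc, ← mul_add, norm_mul, Circle.norm_coe, one_mul, sub_eq_add_neg]
    rw [this, LinearIsometryEquiv.norm_map]
  rw [hrot, ← Complex.lintegral_comp_polarCoord_symm]
  have hts : Measurable fun p : ℝ × ℝ => thirdSide d p.1 p.2 := by
    unfold thirdSide
    fun_prop
  have hpol : ∫⁻ p in polarCoord.target, ENNReal.ofReal p.1 •
      g (‖Complex.polarCoord.symm p‖ + ‖Complex.polarCoord.symm p - d‖)
        (‖Complex.polarCoord.symm p‖ - ‖Complex.polarCoord.symm p - d‖) =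
      ∫⁻ p in Set.Ioi (0 : ℝ) ×ˢ Set.Ioo (-π) π, ENNReal.ofReal p.1 *
        g (p.1 + thirdSide d p.1 p.2) (p.1 - thirdSide d p.1 p.2) := by
    refine setLIntegral_congr_fun (measurableSet_Ioi.prod measurableSet_Ioo) fun p hp => ?_
    have h0 : 0 < p.1 := hp.1
    simp only [smul_eq_mul]
    rw [Complex.norm_polarCoord_symm, Complex.polarCoord_symm_apply, norm_polar_sub,
      abs_of_pos h0]
  rw [hpol]
  have hm1 : Measurable fun p : ℝ × ℝ => ENNReal.ofReal p.1 *
      g (p.1 + thirdSide d p.1 p.2) (p.1 - thirdSide d p.1 p.2) :=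
    (by fun_prop : Measurable fun p : ℝ × ℝ => ENNReal.ofReal p.1).mul
      (hgc (measurable_fst.add hts) (measurable_fst.sub hts))
  change ∫⁻ p in _, _ ∂((volume : Measure ℝ).prod (volume : Measure ℝ)) ≤ _
  rw [setLIntegral_prod _ hm1.aemeasurable]
  calc _ ≤ ∫⁻ r in Set.Ioi (0 : ℝ), ∫⁻ σ, H (r + σ) (r - σ) := by
        refine setLIntegral_mono' measurableSet_Ioi fun r hr => ?_
        refine le_trans ?_ (lintegral_angle_le hd0 hr g)
        simp only
        set f : ℝ → ℝ≥0∞ := fun θ => ENNReal.ofReal r *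
          g (r + thirdSide d r θ) (r - thirdSide d r θ) with hf
        have hr0 : 0 < r := hr
        have hfm : Measurable f := hm1.comp measurable_prodMk_left
        have hfe : ∀ θ, f (-θ) = f θ := fun θ => by simp [hf, thirdSide]
        have h2 : ∫⁻ θ in Set.Ioo 0 π, ENNReal.ofReal (2 * r) *
            g (r + thirdSide d r θ) (r - thirdSide d r θ) =
            (∫⁻ θ in Set.Ioo 0 π, f θ) + ∫⁻ θ in Set.Ioo 0 π, f θ := by
          rw [← lintegral_add_left hfm]
          refine lintegral_congr fun θ => ?_
          rw [two_mul, ENNReal.ofReal_add hr0.le hr0.le, add_mul]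
        rw [h2]
        have h3 : ∫⁻ θ in Set.Ioo (-π) 0, f θ = ∫⁻ θ in Set.Ioo 0 π, f θ := by
          rw [← lintegral_indicator measurableSet_Ioo, ← lintegral_indicator measurableSet_Ioo,
            ← lintegral_neg_eq_self]
          refine lintegral_congr fun θ => ?_
          by_cases hθ : θ ∈ Set.Ioo 0 π
          · rw [Set.indicator_of_mem hθ, Set.indicator_of_mem, hfe]
            exact ⟨by linarith [hθ.2], by linarith [hθ.1]⟩
          · rw [Set.indicator_of_notMem hθ, Set.indicator_of_notMem]
            exact fun h => hθ ⟨by linarith [h.2], by linarith [h.1]⟩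
        calc ∫⁻ θ in Set.Ioo (-π) π, f θ
            ≤ ∫⁻ θ in Set.Ioo (-π) 0 ∪ Set.Ico 0 π, f θ := by
              refine lintegral_mono_set fun θ hθ => ?_
              rcases lt_or_ge θ 0 with h | h
              · exact Or.inl ⟨hθ.1, h⟩
              · exact Or.inr ⟨h, hθ.2⟩
          _ ≤ (∫⁻ θ in Set.Ioo (-π) 0, f θ) + ∫⁻ θ in Set.Ico 0 π, f θ := lintegral_union_le _ _ _
          _ = _ := by rw [h3, setLIntegral_congr Ioo_ae_eq_Ico.symm]
    _ ≤ ∫⁻ r : ℝ, ∫⁻ σ, H (r + σ) (r - σ) := setLIntegral_le_lintegral _ _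
    _ = ∫⁻ r : ℝ, ∫⁻ u, H u (2 * r - u) := by
        refine lintegral_congr fun r => ?_
        rw [← lintegral_sub_right_eq_self (μ := (volume : Measure ℝ)) _ r]
        refine lintegral_congr fun u => ?_
        congr 1 <;> ring
    _ = ∫⁻ u : ℝ, ∫⁻ r : ℝ, H u (2 * r - u) := by
        refine lintegral_lintegral_swap (Measurable.aemeasurable ?_)
        exact hHc measurable_snd ((measurable_fst.const_mul 2).sub measurable_snd)
    _ ≤ ∫⁻ u, ∫⁻ v, H u v := by
        refine lintegral_mono fun u => ?_
        have := lintegral_image_eq_lintegral_abs_deriv_mul (s := Set.univ)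
          (f := fun r : ℝ => 2 * r - u) (f' := fun _ => 2) MeasurableSet.univ
          (fun x _ =>
            (((hasDerivAt_id x).const_mul 2).sub_const u).hasDerivWithinAt.congr_deriv (by norm_num))
          (fun x _ y _ h => by simpa using h) (H u)
        refine le_trans ?_ (setLIntegral_le_lintegral _ _ : ∫⁻ v in
          (fun r : ℝ => 2 * r - u) '' Set.univ, H u v ≤ _)
        rw [this, setLIntegral_univ]
        refine lintegral_mono fun r => ?_
        exact le_mul_of_one_le_left zero_le (by norm_num)

/-- The sum of the two inverse square root singularities at `d` and `-d`. -/
def invSum (d v : ℝ) : ℝ≥0∞ := ENNReal.ofReal (1 / √|v - d|) + ENNReal.ofReal (1 / √|v - -d|)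

theorem measurable_inv_sqrt (d : ℝ) : Measurable fun v : ℝ => ENNReal.ofReal (1 / √|v - d|) := by
  simp only [← Real.norm_eq_abs]
  fun_prop

theorem measurable_invSum (d : ℝ) : Measurable (invSum d) :=
  (measurable_inv_sqrt d).add (measurable_inv_sqrt (-d))

theorem lintegral_invSum_near (a d : ℝ) {Λ E : ℝ} (hΛ : 0 < Λ) (hE : E = |(|a| - d)|) (hd : 0 < d) :
    ∫⁻ x in Set.Icc (a - Λ) (a + Λ), invSum d x ≤ ENNReal.ofReal (24 * Λ / √(Λ + E)) := by
  unfold invSum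
  rw [lintegral_add_left (measurable_inv_sqrt d)]
  have h : ∀ c : ℝ, |c| = d → ENNReal.ofReal (12 * Λ / √(Λ + |a - c|)) ≤
      ENNReal.ofReal (12 * Λ / √(Λ + E)) := fun c hc => by
    have h0 : 0 ≤ E := hE ▸ abs_nonneg _
    have : E ≤ |a - c| := by rw [hE, ← hc]; exact abs_abs_sub_abs_le_abs_sub a c
    gcongr
  rw [show 24 * Λ / √(Λ + E) = 12 * Λ / √(Λ + E) + 12 * Λ / √(Λ + E) by ring,
    ENNReal.ofReal_add (by positivity) (by positivity)]
  exact add_le_add ((lintegral_inv_sqrt_near a d hΛ).trans (h d (abs_of_pos hd)))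
    ((lintegral_inv_sqrt_near a (-d) hΛ).trans (h (-d) (by rw [abs_neg, abs_of_pos hd])))

theorem lintegral_invSum_near' (a d : ℝ) {Λ : ℝ} (hΛ : 0 < Λ) :
    ∫⁻ x in Set.Icc (a - Λ) (a + Λ), invSum d x ≤ ENNReal.ofReal (24 * √Λ) := by
  unfold invSum
  rw [lintegral_add_left (measurable_inv_sqrt d), show 24 * √Λ = 12 * √Λ + 12 * √Λ by ring,
    ENNReal.ofReal_add (by positivity) (by positivity)]
  exact add_le_add (lintegral_inv_sqrt_near' a d hΛ) (lintegral_inv_sqrt_near' a (-d) hΛ)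

theorem one_div_sqrt_sq_sub_sq_le {d v : ℝ} (hd : 0 < d) (h1 : -d < v) (h2 : v < d) :
    1 / √(d ^ 2 - v ^ 2) ≤ 1 / √d * (1 / √|v - d| + 1 / √|v - -d|) := by
  have e1 : |v - d| = d - v := by rw [abs_of_neg (by linarith)]; ring
  have e2 : |v - -d| = d + v := by rw [abs_of_pos (by linarith)]; ring
  have h3 : 0 < d - v := by linarith
  have h4 : 0 < d + v := by linarith
  rw [e1, e2, show d ^ 2 - v ^ 2 = (d - v) * (d + v) by ring, Real.sqrt_mul h3.le]
  rcases le_total 0 v with h | h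
  · have : √d ≤ √(d + v) := Real.sqrt_le_sqrt (by linarith)
    calc 1 / (√(d - v) * √(d + v)) ≤ 1 / (√(d - v) * √d) := by gcongr
      _ = 1 / √d * (1 / √(d - v)) := by field_simp
      _ ≤ _ := by gcongr; exact le_add_of_nonneg_right (by positivity)
  · have : √d ≤ √(d - v) := Real.sqrt_le_sqrt (by linarith)
    calc 1 / (√(d - v) * √(d + v)) ≤ 1 / (√d * √(d + v)) := by gcongr
      _ = 1 / √d * (1 / √(d + v)) := by field_simp
      _ ≤ _ := by gcongr; exact le_add_of_nonneg_left (by positivity)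

theorem ofReal_mul_invSum {c d v : ℝ} (hc : 0 ≤ c) :
    ENNReal.ofReal c * invSum d v = ENNReal.ofReal (c * (1 / √|v - d| + 1 / √|v - -d|)) := by
  rw [ENNReal.ofReal_mul hc, ENNReal.ofReal_add (by positivity) (by positivity), invSum]

theorem bipolarWeight_le {d u v X : ℝ} (hd : 0 < d) (hu : d < u) (h1 : -d < v) (h2 : v < d)
    (hX : u ^ 2 - v ^ 2 ≤ X * d) :
    bipolarWeight d u v ≤
      ENNReal.ofReal X * (ENNReal.ofReal (1 / √|u - d|) * invSum d v) := by
  have hX0 : 0 ≤ X := by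
    by_contra! h
    nlinarith [mul_pos (neg_pos.2 h) hd]
  simp only [bipolarWeight, hu, h1, h2, and_self, if_true]
  rw [ofReal_mul_invSum (by positivity), ← ENNReal.ofReal_mul hX0]
  refine ENNReal.ofReal_le_ofReal ?_
  have hud : 0 < u - d := by linarith
  rw [abs_of_pos hud]
  have h3 : 1 / √(u ^ 2 - d ^ 2) ≤ 1 / √d * (1 / √(u - d)) := by
    rw [show u ^ 2 - d ^ 2 = (u - d) * (u + d) by ring, Real.sqrt_mul hud.le]
    have : √d ≤ √(u + d) := Real.sqrt_le_sqrt (by linarith)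
    calc 1 / (√(u - d) * √(u + d)) ≤ 1 / (√(u - d) * √d) := by gcongr
      _ = _ := by field_simp
  have h4 := one_div_sqrt_sq_sub_sq_le hd h1 h2
  have h5 : 0 ≤ u ^ 2 - d ^ 2 := by nlinarith
  set T := 1 / √|v - d| + 1 / √|v - -d| with hT
  have hT0 : 0 ≤ T := by positivity
  calc (u ^ 2 - v ^ 2) / √((u ^ 2 - d ^ 2) * (d ^ 2 - v ^ 2))
      = (u ^ 2 - v ^ 2) * ((1 / √(u ^ 2 - d ^ 2)) * (1 / √(d ^ 2 - v ^ 2))) := by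
        rw [Real.sqrt_mul h5]; ring
    _ ≤ (X * d) * ((1 / √d * (1 / √(u - d))) * (1 / √d * T)) := by gcongr
    _ = X * (d * (1 / √d * (1 / √d))) * (1 / √(u - d) * T) := by ring
    _ = X * (1 / √(u - d) * T) := by
        have : d * (1 / √d * (1 / √d)) = 1 := by
          rw [div_mul_div_comm, Real.mul_self_sqrt hd.le]
          field_simp
        rw [this, mul_one]

theorem bipolarWeight_le' {d u v N : ℝ} (hd : 0 < d) (hu : d < u) (h1 : -d < v) (h2 : v < d)
    (hN : u ≤ N) :
    bipolarWeight d u v ≤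
      ENNReal.ofReal (N / √d) *
        ((1 + ENNReal.ofReal √d * ENNReal.ofReal (1 / √|u - d|)) * invSum d v) := by
  have hu0 : 0 < u := hd.trans hu
  have hN0 : 0 < N := hu0.trans_le hN
  simp only [bipolarWeight, hu, h1, h2, and_self, if_true]
  have hud : 0 < u - d := by linarith
  rw [abs_of_pos hud, ← ENNReal.ofReal_mul (by positivity), ← ENNReal.ofReal_one,
    ← ENNReal.ofReal_add (by norm_num) (by positivity), ofReal_mul_invSum (by positivity),
    ← ENNReal.ofReal_mul (by positivity)]
  refine ENNReal.ofReal_le_ofReal ?_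
  have h3 : 1 / √(u ^ 2 - d ^ 2) ≤ 1 / √u * (1 / √(u - d)) := by
    rw [show u ^ 2 - d ^ 2 = (u - d) * (u + d) by ring, Real.sqrt_mul hud.le]
    have : √u ≤ √(u + d) := Real.sqrt_le_sqrt (by linarith)
    calc 1 / (√(u - d) * √(u + d)) ≤ 1 / (√(u - d) * √u) := by gcongr
      _ = _ := by field_simp
  have h4 := one_div_sqrt_sq_sub_sq_le hd h1 h2
  have h5 : 0 ≤ u ^ 2 - d ^ 2 := by nlinarith
  have h6 : √u ≤ √(u - d) + √d := by
    rw [Real.sqrt_le_left (by positivity)]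
    nlinarith [Real.sq_sqrt hd.le, Real.sq_sqrt hud.le,
      mul_nonneg (Real.sqrt_nonneg (u - d)) (Real.sqrt_nonneg d)]
  set T := 1 / √|v - d| + 1 / √|v - -d| with hT
  have hT0 : 0 ≤ T := by positivity
  calc (u ^ 2 - v ^ 2) / √((u ^ 2 - d ^ 2) * (d ^ 2 - v ^ 2))
      = (u ^ 2 - v ^ 2) * ((1 / √(u ^ 2 - d ^ 2)) * (1 / √(d ^ 2 - v ^ 2))) := by
        rw [Real.sqrt_mul h5]; ring
    _ ≤ u ^ 2 * ((1 / √u * (1 / √(u - d))) * (1 / √d * T)) := by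
        gcongr; nlinarith [sq_nonneg v]
    _ = u * (√u / √(u - d)) * (1 / √d * T) := by
        have : u ^ 2 * (1 / √u) = u * √u := by
          rw [sq, mul_assoc, mul_one_div, Real.div_sqrt]
        rw [← mul_assoc (u ^ 2), ← mul_assoc (u ^ 2), this]; ring
    _ ≤ N * ((√(u - d) + √d) / √(u - d)) * (1 / √d * T) := by gcongr
    _ = _ := by
        have : 0 < √(u - d) := Real.sqrt_pos.2 hud
        field_simp

theorem area_le {ω : ℂ} (hω : ω ≠ 0) {S : Set ℂ} {U V : Set ℝ} (hU : MeasurableSet U)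
    (hV : MeasurableSet V) (hS : ∀ ξ ∈ S, ‖ξ‖ + ‖ξ + ω‖ ∈ U ∧ ‖ξ‖ - ‖ξ + ω‖ ∈ V)
    {c : ℝ≥0∞} {a b : ℝ → ℝ≥0∞} (ha : Measurable a) (hb : Measurable b)
    (h : ∀ u ∈ U, ∀ v ∈ V, ‖ω‖ < u → -‖ω‖ < v → v < ‖ω‖ →
      bipolarWeight ‖ω‖ u v ≤ c * (a u * b v)) :
    volume S ≤ c * ((∫⁻ u in U, a u) * ∫⁻ v in V, b v) := by
  set g : ℝ → ℝ → ℝ≥0∞ := fun u v => U.indicator 1 u * V.indicator 1 v with hg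
  have hgm : Measurable fun p : ℝ × ℝ => g p.1 p.2 :=
    ((measurable_one.indicator hU).comp measurable_fst).mul
      ((measurable_one.indicator hV).comp measurable_snd)
  have hT : MeasurableSet {ξ : ℂ | ‖ξ‖ + ‖ξ + ω‖ ∈ U ∧ ‖ξ‖ - ‖ξ + ω‖ ∈ V} :=
    ((by fun_prop : Measurable fun ξ : ℂ => ‖ξ‖ + ‖ξ + ω‖) hU).inter
      ((by fun_prop : Measurable fun ξ : ℂ => ‖ξ‖ - ‖ξ + ω‖) hV)
  calc volume S ≤ volume {ξ : ℂ | ‖ξ‖ + ‖ξ + ω‖ ∈ U ∧ ‖ξ‖ - ‖ξ + ω‖ ∈ V} := measure_mono hS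
    _ = ∫⁻ ξ : ℂ, {ξ : ℂ | ‖ξ‖ + ‖ξ + ω‖ ∈ U ∧ ‖ξ‖ - ‖ξ + ω‖ ∈ V}.indicator 1 ξ :=
        (lintegral_indicator_one hT).symm
    _ = ∫⁻ ξ : ℂ, g (‖ξ‖ + ‖ξ + ω‖) (‖ξ‖ - ‖ξ + ω‖) := by
        refine lintegral_congr fun ξ => ?_
        by_cases h1 : ‖ξ‖ + ‖ξ + ω‖ ∈ U <;> by_cases h2 : ‖ξ‖ - ‖ξ + ω‖ ∈ V <;>
          simp [hg, h1, h2, Set.indicator]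
    _ ≤ ∫⁻ u, ∫⁻ v, g u v * bipolarWeight ‖ω‖ u v := lintegral_bipolar_le hω hgm
    _ ≤ ∫⁻ u, ∫⁻ v, c * (U.indicator a u * V.indicator b v) := by
        refine lintegral_mono fun u => lintegral_mono fun v => ?_
        by_cases h1 : u ∈ U <;> by_cases h2 : v ∈ V <;> simp only [hg, h1, h2, Set.indicator,
          if_true, if_false, Pi.one_apply, mul_one, one_mul, mul_zero, zero_mul, le_refl]
        by_cases h3 : ‖ω‖ < u ∧ -‖ω‖ < v ∧ v < ‖ω‖
        · exact h u h1 v h2 h3.1 h3.2.1 h3.2.2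
        · simp [bipolarWeight, h3]
    _ = _ := by
        have hbi := hb.indicator hV
        have hai := ha.indicator hU
        simp_rw [← lintegral_indicator hU, ← lintegral_indicator hV]
        rw [← lintegral_mul_const _ hai, ← lintegral_const_mul _ (hai.mul_const _)]
        refine lintegral_congr fun u => ?_
        rw [lintegral_const_mul _ (hbi.const_mul _), lintegral_const_mul _ hbi]

theorem interactionSet_pieces (t : ℝ) (ω : ℂ) (Λ : ℝ) (S : Set ℂ) {B₁ B₂ : ℝ≥0∞}
    (h₁ : volume (S ∩ {ξ | |(‖ξ‖ + ‖ξ + ω‖ - |t|)| ≤ Λ}) ≤ B₁)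
    (h₂ : ∀ s, |s| = |t| → volume (S ∩ {ξ | |(‖ξ‖ - ‖ξ + ω‖ - s)| ≤ Λ}) ≤ B₂) :
    volume (S ∩ interactionSet t ω Λ) ≤ B₁ + (B₂ + B₂) := by
  refine (measure_mono (t := (S ∩ {ξ | |(‖ξ‖ + ‖ξ + ω‖ - |t|)| ≤ Λ}) ∪
    ((S ∩ {ξ | |(‖ξ‖ - ‖ξ + ω‖ - t)| ≤ Λ}) ∪
      (S ∩ {ξ | |(‖ξ‖ - ‖ξ + ω‖ - -t)| ≤ Λ}))) ?_).trans ?_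
  · rintro ξ ⟨hS, h | h | h⟩
    · exact Or.inl ⟨hS, h⟩
    · exact Or.inr (Or.inl ⟨hS, h⟩)
    · exact Or.inr (Or.inr ⟨hS, by simpa using h⟩)
  · exact (measure_union_le _ _).trans (add_le_add h₁ ((measure_union_le _ _).trans
      (add_le_add (h₂ t rfl) (h₂ (-t) (abs_neg t)))))

theorem mem_Icc_of_abs_sub_le {x a Λ : ℝ} (h : |x - a| ≤ Λ) : x ∈ Set.Icc (a - Λ) (a + Λ) := by
  have := abs_le.1 h
  exact ⟨by linarith, by linarith⟩

theorem ofReal_mul_mul_le {A B : ℝ≥0∞} {a b c : ℝ} (hc : 0 ≤ c) (ha : 0 ≤ a)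
    (hA : A ≤ ENNReal.ofReal a) (hB : B ≤ ENNReal.ofReal b) :
    ENNReal.ofReal c * (A * B) ≤ ENNReal.ofReal (c * (a * b)) := by
  rw [ENNReal.ofReal_mul hc, ENNReal.ofReal_mul ha]
  gcongr

theorem area_ball_le {t : ℝ} {ω : ℂ} {Λ R : ℝ} (hΛ : 0 < Λ) (hR : 0 < R) (hRd : R ≤ 4 * ‖ω‖) :
    volume ({ξ : ℂ | ‖ξ‖ ≤ R} ∩ interactionSet t ω Λ) ≤
      ENNReal.ofReal (34560 * (R * √R * Λ / √(Λ + |(|t| - ‖ω‖)|))) := by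
  set d := ‖ω‖ with hd
  have hd0 : 0 < d := by linarith
  have hω : ω ≠ 0 := norm_pos_iff.1 hd0
  set E := |(|t| - d)| with hE
  have hE0 : 0 ≤ E := abs_nonneg _
  have hgeo : ∀ ξ : ℂ, ‖ξ‖ ≤ R → ‖ξ‖ + ‖ξ + ω‖ ∈ Set.Icc (d + R - R) (d + R + R) ∧
      ‖ξ‖ - ‖ξ + ω‖ ∈ Set.Icc (-d + R - R) (-d + R + R) := fun ξ hξ => by
    have h1 : ‖ξ + ω‖ ≤ ‖ξ‖ + d := norm_add_le _ _
    have h2 : d ≤ ‖ξ + ω‖ + ‖ξ‖ := by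
      have := norm_sub_le (ξ + ω) ξ
      simpa using this
    refine ⟨⟨?_, ?_⟩, ⟨?_, ?_⟩⟩ <;> linarith
  have hX : ∀ u ∈ Set.Icc (d + R - R) (d + R + R), ∀ v ∈ Set.Icc (-d + R - R) (-d + R + R),
      u ^ 2 - v ^ 2 ≤ 40 * R * d := fun u hu v hv => by
    have h1 : u - v ≤ 10 * d := by linarith [hu.2, hv.1]
    have h2 : u + v ≤ 4 * R := by linarith [hu.2, hv.2]
    have h3 : 0 ≤ u + v := by linarith [hu.1, hv.1]
    nlinarith
  have hT : 34560 * (R * √R * Λ / √(Λ + E)) =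
      40 * R * ((12 * Λ / √(Λ + E)) * (24 * √R)) +
      (40 * R * ((12 * √R) * (24 * Λ / √(Λ + E))) +
      40 * R * ((12 * √R) * (24 * Λ / √(Λ + E)))) := by ring
  rw [hT, ENNReal.ofReal_add (by positivity) (by positivity),
    ENNReal.ofReal_add (by positivity) (by positivity)]
  refine interactionSet_pieces t ω Λ _ ?_ fun s hs => ?_
  · refine (area_le hω (measurableSet_Icc.inter measurableSet_Icc)
      measurableSet_Icc (U := Set.Icc (d + R - R) (d + R + R) ∩ Set.Icc (|t| - Λ) (|t| + Λ))
      (V := Set.Icc (-d + R - R) (-d + R + R))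
      (fun ξ hξ => ⟨⟨(hgeo ξ hξ.1).1, mem_Icc_of_abs_sub_le hξ.2⟩, (hgeo ξ hξ.1).2⟩)
      (c := ENNReal.ofReal (40 * R)) (measurable_inv_sqrt d) (measurable_invSum d)
      fun u hu v hv h1 h2 h3 => bipolarWeight_le hd0 h1 h2 h3 (hX u hu.1 v hv)).trans ?_
    refine ofReal_mul_mul_le (by positivity) (by positivity) ?_ ?_
    · exact (lintegral_mono_set Set.inter_subset_right).trans (lintegral_inv_sqrt_near |t| d hΛ)
    · exact lintegral_invSum_near' _ d hR
  · refine (area_le hω measurableSet_Icc (measurableSet_Icc.inter measurableSet_Icc)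
      (U := Set.Icc (d + R - R) (d + R + R))
      (V := Set.Icc (-d + R - R) (-d + R + R) ∩ Set.Icc (s - Λ) (s + Λ))
      (fun ξ hξ => ⟨(hgeo ξ hξ.1).1, (hgeo ξ hξ.1).2, mem_Icc_of_abs_sub_le hξ.2⟩)
      (c := ENNReal.ofReal (40 * R)) (measurable_inv_sqrt d) (measurable_invSum d)
      fun u hu v hv h1 h2 h3 => bipolarWeight_le hd0 h1 h2 h3 (hX u hu v hv.1)).trans ?_
    refine ofReal_mul_mul_le (by positivity) (by positivity) ?_ ?_
    · exact lintegral_inv_sqrt_near' _ d hR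
    · exact (lintegral_mono_set Set.inter_subset_right).trans
        (lintegral_invSum_near s d hΛ (by rw [hE, hs]) hd0)

theorem area_annulus_le {t : ℝ} {ω : ℂ} {Λ r ρ N B : ℝ} {S : Set ℂ} (hΛ : 0 < Λ) (hr : 0 < r)
    (hd1 : ‖ω‖ ≤ r) (hd2 : r ≤ 4 * ‖ω‖) (hrN : r ≤ N) (hB : 1 ≤ B) (ht : |t| + Λ ≤ B * r)
    (hS : ∀ ξ ∈ S, |‖ξ‖ - ρ| ≤ r ∧ ‖ξ‖ + ‖ξ + ω‖ ≤ N) :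
    volume (S ∩ interactionSet t ω Λ) ≤
      ENNReal.ofReal (4032 * B ^ 2 * (N * √r * Λ / √(Λ + |(|t| - ‖ω‖)|))) := by
  set d := ‖ω‖ with hd
  have hd0 : 0 < d := by linarith
  have hω : ω ≠ 0 := norm_pos_iff.1 hd0
  set E := |(|t| - d)| with hE
  have hE0 : 0 ≤ E := abs_nonneg _
  have hN0 : 0 < N := hr.trans_le hrN
  have hgeo : ∀ ξ ∈ S, ‖ξ‖ + ‖ξ + ω‖ ∈ Set.Icc (2 * ρ - 3 * r) (2 * ρ + 3 * r) ∧
      ‖ξ‖ - ‖ξ + ω‖ ∈ Set.Icc (0 - d) (0 + d) := fun ξ hξ => by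
    have h1 : ‖ξ + ω‖ ≤ ‖ξ‖ + d := norm_add_le _ _
    have h2 : ‖ξ‖ ≤ ‖ξ + ω‖ + d := by
      have := norm_sub_le (ξ + ω) ω
      simpa using this
    have h3 := abs_le.1 (hS ξ hξ).1
    refine ⟨⟨?_, ?_⟩, ⟨?_, ?_⟩⟩ <;> linarith
  have hsd : √d ≤ √r := Real.sqrt_le_sqrt hd1
  have hsr : √r ≤ 2 * √d := by
    rw [Real.sqrt_le_left (by positivity), mul_pow, Real.sq_sqrt hd0.le]; linarith
  have hT : 1152 * B ^ 2 * (N * √r * Λ / √(Λ + E)) + (1440 * (N * √r * Λ / √(Λ + E)) +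
      1440 * (N * √r * Λ / √(Λ + E))) ≤ 4032 * B ^ 2 * (N * √r * Λ / √(Λ + E)) := by
    have : 0 ≤ N * √r * Λ / √(Λ + E) := by positivity
    nlinarith [mul_nonneg (by nlinarith : 0 ≤ B ^ 2 - 1) this]
  refine le_trans ?_ (ENNReal.ofReal_le_ofReal hT)
  rw [ENNReal.ofReal_add (by positivity) (by positivity),
    ENNReal.ofReal_add (by positivity) (by positivity)]
  refine interactionSet_pieces t ω Λ _ ?_ fun s hs => ?_
  · refine (area_le hω measurableSet_Icc
      measurableSet_Icc (U := Set.Icc (|t| - Λ) (|t| + Λ))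
      (V := Set.Icc (0 - d) (0 + d))
      (fun ξ hξ => ⟨mem_Icc_of_abs_sub_le hξ.2, (hgeo ξ hξ.1).2⟩)
      (c := ENNReal.ofReal (4 * B ^ 2 * r)) (measurable_inv_sqrt d) (measurable_invSum d)
      fun u hu v hv h1 h2 h3 => bipolarWeight_le hd0 h1 h2 h3 ?_).trans ?_
    · have hu1 : u ≤ B * r := hu.2.trans ht
      have : u ^ 2 ≤ (B * r) ^ 2 := by
        have : 0 ≤ u := by linarith
        gcongr
      nlinarith [mul_le_mul_of_nonneg_left hd2 (by positivity : 0 ≤ B ^ 2 * r), sq_nonneg v]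
    · have hc : 4 * B ^ 2 * r * ((12 * Λ / √(Λ + E)) * (24 * √d)) ≤
          1152 * B ^ 2 * (N * √r * Λ / √(Λ + E)) := by
        calc _ ≤ 4 * B ^ 2 * N * ((12 * Λ / √(Λ + E)) * (24 * √r)) := by gcongr
          _ = _ := by ring
      refine le_trans ?_ (ENNReal.ofReal_le_ofReal hc)
      refine ofReal_mul_mul_le (by positivity) (by positivity) ?_ ?_
      · exact lintegral_inv_sqrt_near |t| d hΛ
      · exact lintegral_invSum_near' _ d hd0
  · refine (area_le hω (measurableSet_Icc.inter measurableSet_Iic) measurableSet_Icc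
      (U := Set.Icc (2 * ρ - 3 * r) (2 * ρ + 3 * r) ∩ Set.Iic N)
      (V := Set.Icc (s - Λ) (s + Λ))
      (fun ξ hξ => ⟨⟨(hgeo ξ hξ.1).1, (hS ξ hξ.1).2⟩, mem_Icc_of_abs_sub_le hξ.2⟩)
      (c := ENNReal.ofReal (N / √d))
      (measurable_const.add ((measurable_inv_sqrt d).const_mul _)) (measurable_invSum d)
      fun u hu v hv h1 h2 h3 => bipolarWeight_le' hd0 h1 h2 h3 hu.2).trans ?_
    have hc : N / √d * ((30 * r) * (24 * Λ / √(Λ + E))) ≤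
          1440 * (N * √r * Λ / √(Λ + E)) := by
      have h1 : r / √d ≤ 2 * √r := by
        rw [div_le_iff₀ (by positivity)]
        have := Real.mul_self_sqrt hr.le
        nlinarith [Real.sqrt_nonneg r]
      calc _ = 720 * N * (r / √d) * (Λ / √(Λ + E)) := by ring
        _ ≤ 720 * N * (2 * √r) * (Λ / √(Λ + E)) := by gcongr
        _ = _ := by ring
    refine le_trans ?_ (ENNReal.ofReal_le_ofReal hc)
    refine ofReal_mul_mul_le (by positivity) (by positivity) ?_ ?_
    · refine (lintegral_mono_set Set.inter_subset_left).trans ?_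
      simp only [Pi.add_apply]
      rw [lintegral_add_left measurable_const, lintegral_const_mul _ (measurable_inv_sqrt d),
        setLIntegral_one, Real.volume_Icc]
      calc _ ≤ ENNReal.ofReal (6 * r) + ENNReal.ofReal √r * ENNReal.ofReal (24 * √r) := by
            gcongr
            · linarith
            · refine (lintegral_inv_sqrt_near' (2 * ρ) d (by positivity)).trans
                (ENNReal.ofReal_le_ofReal ?_)
              have : √(3 * r) ≤ 2 * √r := by
                rw [Real.sqrt_le_left (by positivity), mul_pow, Real.sq_sqrt hr.le]; linarith
              linarith
        _ = ENNReal.ofReal (30 * r) := by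
            rw [← ENNReal.ofReal_mul (by positivity), ← ENNReal.ofReal_add (by positivity)
              (by positivity)]
            congr 1
            linear_combination 24 * Real.mul_self_sqrt hr.le
    · exact lintegral_invSum_near s d hΛ (by rw [hE, hs]) hd0

theorem norm_sub_norm_ge_of_im_eq {ξ η : ℂ} (him : ξ.im = η.im) (hη : |η.im| ≤ η.re)
    (hle : η.re ≤ ξ.re) : (ξ.re - η.re) / 2 ≤ ‖ξ‖ - ‖η‖ := by
  have h1 : ‖ξ‖ ≤ 2 * ξ.re := by
    have := Complex.norm_le_abs_re_add_abs_im ξ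
    rw [him, abs_of_nonneg ((abs_nonneg _).trans (hη.trans hle))] at this
    linarith
  have h2 : ‖η‖ ≤ 2 * η.re := by
    have := Complex.norm_le_abs_re_add_abs_im η
    rw [abs_of_nonneg ((abs_nonneg _).trans hη)] at this
    linarith
  have e : (‖ξ‖ - ‖η‖) * (‖ξ‖ + ‖η‖) = (ξ.re - η.re) * (ξ.re + η.re) := by
    have h3 := Complex.sq_norm ξ
    have h4 := Complex.sq_norm η
    rw [Complex.normSq_apply] at h3 h4
    rw [him] at h3
    linear_combination h3 - h4
  have h0 : 0 ≤ η.re := (abs_nonneg _).trans hη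
  rcases eq_or_lt_of_le hle with h | h
  · have : ξ = η := Complex.ext h.symm him
    simp [this]
  · have hpos : 0 < ‖ξ‖ + ‖η‖ := by
      have := Complex.abs_re_le_norm ξ
      have := le_abs_self ξ.re
      linarith [norm_nonneg η]
    by_contra! hlt
    nlinarith [mul_pos (sub_pos.2 h) hpos, norm_nonneg ξ, norm_nonneg η]

theorem norm_le_norm_of_im_eq {ξ η : ℂ} (him : ξ.im = η.im) (hη : 0 ≤ η.re)
    (hle : η.re ≤ ξ.re) : ‖η‖ ≤ ‖ξ‖ := by
  refine (pow_le_pow_iff_left₀ (norm_nonneg _) (norm_nonneg _) two_ne_zero).1 ?_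
  rw [Complex.sq_norm, Complex.sq_norm, Complex.normSq_apply, Complex.normSq_apply, him]
  nlinarith

/-- In a sector around the positive real axis, away from the foci, an elliptic annulus of width `Λ`
meets a horizontal strip of height `r` in area at most `8 * Λ * r`. -/
theorem area_sector_le {ω : ℂ} {Λ r p a : ℝ} {S : Set ℂ} (hΛ : 0 ≤ Λ)
    (hS : ∀ ξ ∈ S, |ξ.im| ≤ ξ.re ∧ ‖ω‖ ≤ ξ.re ∧ ξ.im ∈ Set.Icc p (p + r) ∧
      |(‖ξ‖ + ‖ξ + ω‖ - a)| ≤ Λ) :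
    volume S ≤ ENNReal.ofReal (8 * Λ * r) := by
  set T : Set ℂ := {ξ | |ξ.im| ≤ ξ.re ∧ ‖ω‖ ≤ ξ.re ∧ ξ.im ∈ Set.Icc p (p + r) ∧
      |(‖ξ‖ + ‖ξ + ω‖ - a)| ≤ Λ} with hT
  have hTc : IsClosed T := by
    refine IsClosed.inter (isClosed_le Complex.continuous_im.abs Complex.continuous_re) ?_
    refine IsClosed.inter (isClosed_le continuous_const Complex.continuous_re) ?_
    exact IsClosed.inter (isClosed_Icc.preimage Complex.continuous_im)
      (isClosed_le (f := fun ξ : ℂ => |(‖ξ‖ + ‖ξ + ω‖ - a)|) (g := fun _ => Λ)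
        (by fun_prop) continuous_const)
  have hTm : MeasurableSet T := hTc.measurableSet
  refine (measure_mono (t := T) hS).trans ?_
  rw [← Complex.volume_preserving_equiv_real_prod.symm.measure_preimage hTm.nullMeasurableSet]
  have hTm' := Complex.volume_preserving_equiv_real_prod.symm.measurable hTm
  change ((volume : Measure ℝ).prod (volume : Measure ℝ)) _ ≤ _
  rw [Measure.prod_apply_symm hTm']
  calc _ ≤ ∫⁻ y, (Set.Icc p (p + r)).indicator (fun _ => ENNReal.ofReal (8 * Λ)) y := by
        refine lintegral_mono fun y => ?_
        rcases Set.eq_empty_or_nonempty ((fun x : ℝ => (x, y)) ⁻¹'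
          (⇑Complex.measurableEquivRealProd.symm ⁻¹' T)) with h | ⟨x₀, hx₀⟩
        · rw [h, measure_empty]; exact zero_le
        · have hy : y ∈ Set.Icc p (p + r) := hx₀.2.2.1
          rw [Set.indicator_of_mem hy]
          refine (measure_mono (t := Set.Icc (x₀ - 4 * Λ) (x₀ + 4 * Λ)) fun x hx => ?_).trans ?_
          · have key : ∀ x x', (⟨x, y⟩ : ℂ) ∈ T → (⟨x', y⟩ : ℂ) ∈ T → x ≤ x' →
                x' - x ≤ 4 * Λ := fun x x' hx hx' hle => by
              have h1 := norm_sub_norm_ge_of_im_eq (ξ := ⟨x', y⟩) (η := ⟨x, y⟩) rfl hx.1 hle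
              have h2 := norm_le_norm_of_im_eq (ξ := ⟨x', y⟩ + ω) (η := ⟨x, y⟩ + ω) (by simp)
                (by
                  have h3 := hx.2.1
                  have h4 := neg_le_of_abs_le (Complex.abs_re_le_norm ω)
                  simp only [Complex.add_re] at h3 ⊢
                  linarith) (by simpa using hle)
              have h5 := abs_le.1 hx.2.2.2
              have h6 := abs_le.1 hx'.2.2.2
              simp only at h1
              linarith [h5.1, h6.2]
            rcases le_total x x₀ with h | h
            · have := key x x₀ hx hx₀ h
              constructor <;> linarith
            · have := key x₀ x hx₀ hx h
              constructor <;> linarith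
          · rw [Real.volume_Icc]
            gcongr
            linarith
    _ = _ := by
        rw [lintegral_indicator measurableSet_Icc, setLIntegral_const, Real.volume_Icc,
          ← ENNReal.ofReal_mul (by positivity)]
        congr 1; ring

theorem area_cell_le {ω p : ℂ} {Λ r a : ℝ} {S : Set ℂ} (hΛ : 0 ≤ Λ) (hr : 0 ≤ r)
    (hS : ∀ ξ ∈ S, 2 * ‖ω‖ ≤ ‖ξ‖ ∧ ‖ξ - p‖ ≤ r ∧ |(‖ξ‖ + ‖ξ + ω‖ - a)| ≤ Λ) :
    volume S ≤ ENNReal.ofReal (64 * Λ * r) := by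
  have hrot : ∀ c : Circle, volume (S ∩ {ξ | |((c : ℂ) * ξ).im| ≤ ((c : ℂ) * ξ).re}) ≤
      ENNReal.ofReal (8 * Λ * (2 * r)) := by
    intro c
    set e := rotation c with he
    have hT : S ∩ {ξ | |((c : ℂ) * ξ).im| ≤ ((c : ℂ) * ξ).re} =
        e ⁻¹' (e.symm ⁻¹' (S ∩ {ξ | |((c : ℂ) * ξ).im| ≤ ((c : ℂ) * ξ).re})) := by
      ext ξ; simp
    rw [hT, e.measurePreserving.measure_preimage_emb e.toHomeomorph.measurableEmbedding]
    refine area_sector_le (ω := e ω) (p := (e p).im - r) (a := a) hΛ ?_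
    rintro η ⟨hηS, hη⟩
    obtain ⟨h1, h2, h3⟩ := hS _ hηS
    have hce : (c : ℂ) * e.symm η = η := by rw [← rotation_apply, ← he]; simp
    rw [Set.mem_ofPred_eq, hce] at hη
    have hn : ‖e.symm η‖ = ‖η‖ := e.symm.norm_map η
    rw [hn] at h1
    have h4 : ‖η - e p‖ ≤ r := by
      rw [← e.symm.norm_map, map_sub, e.symm_apply_apply]; exact h2
    have h5 : ‖e.symm η + ω‖ = ‖η + e ω‖ := by
      rw [← e.norm_map, map_add, e.apply_symm_apply]
    rw [hn, h5] at h3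
    refine ⟨hη, ?_, ?_, h3⟩
    · rw [e.norm_map]
      have := Complex.norm_le_abs_re_add_abs_im η
      rw [abs_of_nonneg ((abs_nonneg _).trans hη)] at this
      linarith
    · have := abs_le.1 ((Complex.abs_im_le_norm _).trans h4)
      rw [Complex.sub_im] at this
      constructor <;> linarith
  obtain ⟨c, hc⟩ : ∃ c : Circle, (c : ℂ) = Complex.I :=
    ⟨⟨Complex.I, by simp [Submonoid.unitSphere]⟩, rfl⟩
  have hcov : S ⊆ ((S ∩ {ξ | |(((1 : Circle) : ℂ) * ξ).im| ≤ (((1 : Circle) : ℂ) * ξ).re}) ∪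
      (S ∩ {ξ | |(((-1 : Circle) : ℂ) * ξ).im| ≤ (((-1 : Circle) : ℂ) * ξ).re})) ∪
      ((S ∩ {ξ | |((c : ℂ) * ξ).im| ≤ ((c : ℂ) * ξ).re}) ∪
      (S ∩ {ξ | |(((-c : Circle) : ℂ) * ξ).im| ≤ (((-c : Circle) : ℂ) * ξ).re})) := by
    intro ξ hξ
    simp only [Set.mem_union, Set.mem_inter_iff, hξ, true_and, Set.mem_ofPred_eq, Circle.coe_one,
      one_mul, Circle.coe_neg, neg_mul, Complex.neg_im, Complex.neg_re, abs_neg, hc,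
      Complex.I_mul_im, Complex.I_mul_re, neg_neg]
    rcases le_total |ξ.im| |ξ.re| with h | h
    · rcases abs_cases ξ.re with h' | h' <;> rw [h'.1] at h <;> tauto
    · rcases abs_cases ξ.im with h' | h' <;> rw [h'.1] at h <;> tauto
  refine (measure_mono hcov).trans ((measure_union_le _ _).trans ?_)
  refine (add_le_add (measure_union_le _ _) (measure_union_le _ _)).trans ?_
  refine (add_le_add (add_le_add (hrot 1) (hrot (-1))) (add_le_add (hrot c) (hrot (-c)))).trans ?_
  rw [← ENNReal.ofReal_add (by positivity) (by positivity),
    ← ENNReal.ofReal_add (by positivity) (by positivity)]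
  exact ENNReal.ofReal_le_ofReal (by linarith)

/-- The exponent of the dyadic block of `1 + a`. -/
def dya (a : ℝ) : ℕ := Nat.log 2 ⌊1 + a⌋₊

theorem dya_le {a : ℝ} (ha : 0 ≤ a) : (2 : ℝ) ^ dya a ≤ 1 + a := by
  have h1 : ⌊1 + a⌋₊ ≠ 0 := by
    rw [← Nat.pos_iff_ne_zero, Nat.floor_pos]; linarith
  have := Nat.pow_log_le_self 2 h1
  calc (2 : ℝ) ^ dya a ≤ ⌊1 + a⌋₊ := by exact_mod_cast this
    _ ≤ 1 + a := Nat.floor_le (by linarith)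

theorem lt_dya (a : ℝ) : 1 + a < 2 * 2 ^ dya a := by
  have := Nat.lt_pow_succ_log_self (b := 2) one_lt_two ⌊1 + a⌋₊
  calc 1 + a < ⌊1 + a⌋₊ + 1 := Nat.lt_floor_add_one _
    _ ≤ 2 ^ (dya a + 1) := by exact_mod_cast this
    _ = 2 * 2 ^ dya a := by ring

theorem measurable_dya : Measurable dya :=
  (measurable_of_countable (Nat.log 2)).comp (Nat.measurable_floor.comp (by fun_prop))

/-- Dyadic size of the spatial frequency. -/
def fr (ζ : Freq) : ℕ := dya ‖ζ.2‖

/-- Dyadic size of the modulation. -/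
def mo (ζ : Freq) : ℕ := dya (coneDist ζ)

theorem measurable_fr : Measurable fr := measurable_dya.comp (by fun_prop)

theorem measurable_coneDist : Measurable coneDist := by
  unfold coneDist; simp only [← Real.norm_eq_abs]; fun_prop

theorem measurable_mo : Measurable mo := measurable_dya.comp measurable_coneDist

theorem coneDist_nonneg (x : Freq) : 0 ≤ coneDist x := abs_nonneg _

theorem fr_le (x : Freq) : (2 : ℝ) ^ fr x ≤ 1 + ‖x.2‖ := dya_le (norm_nonneg _)
theorem lt_fr (x : Freq) : 1 + ‖x.2‖ < 2 * 2 ^ fr x := lt_dya _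
theorem mo_le (x : Freq) : (2 : ℝ) ^ mo x ≤ 1 + coneDist x := dya_le (coneDist_nonneg x)
theorem lt_mo (x : Freq) : 1 + coneDist x < 2 * 2 ^ mo x := lt_dya _

open Classical in
/-- Indicator kernel of a relation between three frequencies. -/
def ind (P : Freq → Freq → Freq → Prop) (z x y : Freq) : ℝ≥0∞ := if P z x y then 1 else 0

def MeasRel (P : Freq → Freq → Freq → Prop) : Prop :=
  MeasurableSet {p : Freq × Freq × Freq | P p.1 p.2.1 p.2.2}

theorem MeasRel.meas3 {P : Freq → Freq → Freq → Prop} (hP : MeasRel P) : Meas3 (ind P) := by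
  classical
  exact Measurable.ite hP measurable_const measurable_const

theorem MeasRel.and {P Q : Freq → Freq → Freq → Prop} (hP : MeasRel P) (hQ : MeasRel Q) :
    MeasRel fun z x y => P z x y ∧ Q z x y := MeasurableSet.inter hP hQ

theorem measRel₀ {p : Freq → Prop} (h : MeasurableSet {x | p x}) : MeasRel fun z _ _ => p z :=
  measurable_fst h

theorem measRel₁ {p : Freq → Prop} (h : MeasurableSet {x | p x}) : MeasRel fun _ x _ => p x :=
  measurable_snd (measurable_fst h)

theorem measRel₂ {p : Freq → Prop} (h : MeasurableSet {x | p x}) : MeasRel fun _ _ y => p y :=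
  measurable_snd (measurable_snd h)

theorem MeasRel.swap01 {P : Freq → Freq → Freq → Prop} (hP : MeasRel P) :
    MeasRel fun z x y => P x z y := by
  have : Measurable fun p : Freq × Freq × Freq => (p.2.1, p.1, p.2.2) := by fun_prop
  exact this hP

theorem sqrt_ofReal_le {D e : ℝ} (hD : 1 ≤ D) :
    ENNReal.ofReal (D * 2 ^ e) ^ (1 / 2 : ℝ) ≤ ENNReal.ofReal (D * 2 ^ (e / 2)) := by
  rw [ENNReal.ofReal_rpow_of_nonneg (by positivity) (by norm_num), Real.mul_rpow (by positivity)
    (by positivity), ← Real.rpow_mul (by norm_num)]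
  refine ENNReal.ofReal_le_ofReal ?_
  have : D ^ (1 / 2 : ℝ) ≤ D := by
    conv_rhs => rw [← Real.rpow_one D]
    exact Real.rpow_le_rpow_of_exponent_le hD (by norm_num)
  rw [mul_one_div]
  gcongr

/-- Fixing the zeroth frequency. -/
theorem triBound_ind {P : Freq → Freq → Freq → Prop} (hP : MeasRel P) {D e : ℝ} (hD : 1 ≤ D)
    (h : ∀ z, volume {x | P z x (-(z + x))} ≤ ENNReal.ofReal (D * 2 ^ e)) :
    TriBound (ind P) (ENNReal.ofReal (D * 2 ^ (e / 2))) := by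
  classical
  refine (triBound_of_sq_le hP.meas3 fun z => ?_).mono (fun _ _ _ _ => le_rfl)
    (sqrt_ofReal_le hD)
  refine le_trans (le_of_eq ?_) ((lintegral_indicator_one_le _).trans (h z))
  refine lintegral_congr fun x => ?_
  by_cases hx : P z x (-(z + x))
  · rw [Set.indicator_of_mem (show x ∈ {x | P z x (-(z + x))} from hx), ind, if_pos hx,
      one_pow, Pi.one_apply]
  · rw [Set.indicator_of_notMem (show x ∉ {x | P z x (-(z + x))} from hx), ind, if_neg hx,
      zero_pow two_ne_zero]

/-- Fixing the first frequency. -/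
theorem triBound_ind' {P : Freq → Freq → Freq → Prop} (hP : MeasRel P) {D e : ℝ} (hD : 1 ≤ D)
    (h : ∀ x, volume {z | P z x (-(x + z))} ≤ ENNReal.ofReal (D * 2 ^ e)) :
    TriBound (ind P) (ENNReal.ofReal (D * 2 ^ (e / 2))) :=
  (triBound_ind hP.swap01 hD h).swap01 hP.swap01.meas3

theorem measurableSet_fr_eq (n : ℕ) : MeasurableSet {x | fr x = n} :=
  measurable_fr (measurableSet_singleton n)

theorem measurableSet_mo_eq (n : ℕ) : MeasurableSet {x | mo x = n} :=
  measurable_mo (measurableSet_singleton n)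

theorem two_rpow_half (n : ℕ) : (2 : ℝ) ^ ((n : ℝ) / 2) = √(2 ^ n) := by
  rw [Real.sqrt_eq_rpow, ← Real.rpow_natCast, ← Real.rpow_mul (by norm_num)]; ring_nf

theorem volume_freq_ball_le (n : ℕ) :
    volume (Metric.closedBall (0 : ℂ) (2 * 2 ^ n)) ≤ ENNReal.ofReal (16 * (2 ^ n) ^ 2) := by
  rw [Complex.volume_closedBall, ← ENNReal.ofReal_coe_nnreal, NNReal.coe_real_pi,
    ← ENNReal.ofReal_pow (by positivity), ← ENNReal.ofReal_mul (by positivity)]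
  refine ENNReal.ofReal_le_ofReal ?_
  nlinarith [Real.pi_lt_four, sq_nonneg ((2 : ℝ) ^ n)]

theorem triBound_trivial₀ (m l : ℕ) :
    TriBound (ind fun z _ _ => fr z = m ∧ mo z = l)
      (ENNReal.ofReal (128 * 2 ^ ((2 * m + l : ℝ) / 2))) := by
  refine triBound_ind' ((measRel₀ (measurableSet_fr_eq m)).and (measRel₀ (measurableSet_mo_eq l)))
    (by norm_num) fun x => ?_
  refine (volume_le_of_slices (S := Metric.closedBall 0 (2 * 2 ^ m)) (c := fun ξ => ‖ξ‖) (a := 0)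
    (L := 2 * 2 ^ l) measurableSet_closedBall (by fun_prop) ?_).trans ?_
  · rintro z ⟨rfl, rfl⟩
    refine ⟨?_, ?_⟩
    · rw [mem_closedBall_zero_iff]; linarith [lt_fr z]
    · rw [add_zero]; linarith [lt_mo z, show coneDist z = |(|z.1| - ‖z.2‖)| from rfl]
  · refine (mul_le_mul_right (volume_freq_ball_le m) _).trans ?_
    rw [← ENNReal.ofReal_mul (by positivity)]
    refine ENNReal.ofReal_le_ofReal (le_of_eq ?_)
    rw [Real.rpow_add (by norm_num), mul_comm (2 : ℝ) (m : ℝ), Real.rpow_mul (by norm_num)]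
    simp only [Real.rpow_natCast, Real.rpow_ofNat]
    ring

theorem triBound_trivial₂ (m l : ℕ) :
    TriBound (ind fun z _ y => fr z = m ∧ mo y = l)
      (ENNReal.ofReal (128 * 2 ^ ((2 * m + l : ℝ) / 2))) := by
  refine triBound_ind' ((measRel₀ (measurableSet_fr_eq m)).and (measRel₂ (measurableSet_mo_eq l)))
    (by norm_num) fun x => ?_
  refine (volume_le_of_slices (S := Metric.closedBall 0 (2 * 2 ^ m)) (c := fun ξ => ‖x.2 + ξ‖)
    (a := x.1) (L := 2 * 2 ^ l) measurableSet_closedBall (by fun_prop) ?_).trans ?_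
  · rintro z ⟨rfl, rfl⟩
    refine ⟨?_, ?_⟩
    · rw [mem_closedBall_zero_iff]; linarith [lt_fr z]
    · have h := lt_mo (-(x + z))
      simp only [coneDist, Prod.fst_neg, Prod.snd_neg, Prod.fst_add, Prod.snd_add, norm_neg,
        abs_neg] at h
      rw [add_comm z.1]
      linarith
  · refine (mul_le_mul_right (volume_freq_ball_le m) _).trans ?_
    rw [← ENNReal.ofReal_mul (by positivity)]
    refine ENNReal.ofReal_le_ofReal (le_of_eq ?_)
    rw [Real.rpow_add (by norm_num), mul_comm (2 : ℝ) (m : ℝ), Real.rpow_mul (by norm_num)]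
    simp only [Real.rpow_natCast, Real.rpow_ofNat]
    ring

/-- Three frequencies in prescribed dyadic blocks. -/
def Blk (n₀ l₀ n₁ l₁ n₂ l₂ : ℕ) (z x y : Freq) : Prop :=
  ((fr z = n₀ ∧ mo z = l₀) ∧ (fr x = n₁ ∧ mo x = l₁)) ∧ (fr y = n₂ ∧ mo y = l₂)

theorem measRel_blk (n₀ l₀ n₁ l₁ n₂ l₂ : ℕ) : MeasRel (Blk n₀ l₀ n₁ l₁ n₂ l₂) :=
  (((measRel₀ (measurableSet_fr_eq _)).and (measRel₀ (measurableSet_mo_eq _))).and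
    ((measRel₁ (measurableSet_fr_eq _)).and (measRel₁ (measurableSet_mo_eq _)))).and
    ((measRel₂ (measurableSet_fr_eq _)).and (measRel₂ (measurableSet_mo_eq _)))

theorem min_mul_add_le {a b : ℝ} (ha : 0 ≤ a) (hb : 0 ≤ b) : min a b * (a + b) ≤ 2 * (a * b) := by
  rcases le_total a b with h | h
  · rw [min_eq_left h]; nlinarith
  · rw [min_eq_right h]; nlinarith

theorem triBound_ball {n₀ l₀ n₁ l₁ n₂ l₂ q : ℕ} (hn : 1 ≤ n₁) (h01 : n₀ ≤ n₁)
    (hq : q ≤ l₀ ∨ q ≤ l₁ ∨ q ≤ l₂) :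
    TriBound (ind (Blk n₀ l₀ n₁ l₁ n₂ l₂))
      (ENNReal.ofReal (4423680 * 2 ^ ((3 / 2 * n₀ + l₀ + l₂ - q / 2 : ℝ) / 2))) := by
  refine triBound_ind' (measRel_blk _ _ _ _ _ _) (by norm_num) fun x => ?_
  by_cases hx : fr x = n₁ ∧ mo x = l₁
  swap
  · have : {z | Blk n₀ l₀ n₁ l₁ n₂ l₂ z x (-(x + z))} = ∅ := by
      ext z; simp only [Blk, Set.mem_ofPred_eq, Set.mem_empty_iff_false, iff_false]; tauto
    rw [this, measure_empty]; exact zero_le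
  obtain ⟨rfl, rfl⟩ := hx
  have hd : (2 : ℝ) * 2 ^ n₀ ≤ 4 * ‖x.2‖ := by
    have h1 := fr_le x
    have h2 : (2 : ℝ) ^ n₀ ≤ 2 ^ fr x := pow_le_pow_right₀ (by norm_num) h01
    have h3 : (2 : ℝ) ^ 1 ≤ 2 ^ fr x := pow_le_pow_right₀ (by norm_num) hn
    linarith
  refine (volume_le_area (S := {ξ | ‖ξ‖ ≤ 2 * 2 ^ n₀}) (z := x) (L := 2 * 2 ^ l₀)
    (L' := 2 * 2 ^ l₂) (isClosed_le continuous_norm continuous_const).measurableSet ?_).trans ?_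
  · rintro z ⟨⟨⟨h1, h2⟩, -⟩, -, h3⟩
    refine ⟨?_, ?_, ?_⟩
    · rw [Set.mem_ofPred_eq, ← h1]; linarith [lt_fr z]
    · rw [← h2]; linarith [lt_mo z]
    · rw [← h3]; linarith [lt_mo (-(x + z))]
  · refine (mul_le_mul_right (area_ball_le (by positivity) (by positivity) hd) _).trans ?_
    rw [← ENNReal.ofReal_mul (by positivity)]
    refine ENNReal.ofReal_le_ofReal ?_
    have hQ : (2 : ℝ) ^ q ≤ 2 * 2 ^ l₀ + 2 * 2 ^ l₂ + |(|x.1| - ‖x.2‖)| := by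
      have h1 := mo_le x
      have h2 : (1 : ℝ) ≤ 2 ^ l₀ := one_le_pow₀ (by norm_num)
      have h3 : (1 : ℝ) ≤ 2 ^ l₂ := one_le_pow₀ (by norm_num)
      have h4 := coneDist_nonneg x
      have h5 : coneDist x = |(|x.1| - ‖x.2‖)| := rfl
      rw [← h5]
      rcases hq with h | h | h <;>
        linarith [pow_le_pow_right₀ (a := (2 : ℝ)) (by norm_num) h]
    have h2 : min (2 * 2 ^ l₀) (2 * 2 ^ l₂ : ℝ) * (2 * 2 ^ l₀ + 2 * 2 ^ l₂) ≤
      2 * ((2 * 2 ^ l₀) * (2 * 2 ^ l₂)) := min_mul_add_le (by positivity) (by positivity)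
    have h3 : √(2 * (2 : ℝ) ^ n₀) ≤ 2 * √(2 ^ n₀) := by
      rw [Real.sqrt_mul (by norm_num)]
      have : √2 ≤ (2 : ℝ) := by rw [Real.sqrt_le_left (by norm_num)]; norm_num
      gcongr
    have e : (2 : ℝ) ^ (3 / 2 * n₀ + l₀ + l₂ - q / 2 : ℝ) =
        2 ^ n₀ * √(2 ^ n₀) * (2 ^ l₀ * 2 ^ l₂) / √(2 ^ q) := by
      rw [← two_rpow_half, ← two_rpow_half, Real.rpow_sub (by norm_num),
        ← Real.rpow_natCast, ← Real.rpow_natCast, ← Real.rpow_natCast,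
        ← Real.rpow_add (by norm_num), ← Real.rpow_add (by norm_num),
        ← Real.rpow_add (by norm_num)]
      ring_nf
    rw [e]
    calc _ = 4 * 34560 * ((2 * 2 ^ n₀) * √(2 * (2 : ℝ) ^ n₀) *
          (min (2 * 2 ^ l₀) (2 * 2 ^ l₂ : ℝ) * (2 * 2 ^ l₀ + 2 * 2 ^ l₂)) /
          √(2 * 2 ^ l₀ + 2 * 2 ^ l₂ + |(|x.1| - ‖x.2‖)|)) := by ring
      _ ≤ 4 * 34560 * ((2 * 2 ^ n₀) * (2 * √(2 ^ n₀)) * (2 * ((2 * 2 ^ l₀) * (2 * 2 ^ l₂))) /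
          √(2 ^ q)) := by gcongr
      _ = _ := by ring

theorem triBound_zero {k : Freq → Freq → Freq → ℝ≥0∞} (h : ∀ z x y, z + x + y = 0 → k z x y = 0)
    (K : ℝ≥0∞) : TriBound k K := by
  intro F₀ F₁ F₂ _ _ _
  refine le_trans (tri_mono (g := fun _ _ _ => 0) fun z x y hz => ?_) ?_
  · rw [h z x y hz, zero_mul]
  · simp [tri]

/-- Index of the square cell of side `s` containing the spatial frequency. -/
def cell (s : ℝ) (x : Freq) : ℤ × ℤ := (⌊x.2.re / s⌋, ⌊x.2.im / s⌋)

theorem measurable_cell (s : ℝ) : Measurable (cell s) := by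
  unfold cell
  have h1 : Measurable fun x : Freq => x.2.re / s :=
    (Complex.measurable_re.comp measurable_snd).div_const s
  have h2 : Measurable fun x : Freq => x.2.im / s :=
    (Complex.measurable_im.comp measurable_snd).div_const s
  exact (Int.measurable_floor.comp h1).prodMk (Int.measurable_floor.comp h2)

theorem tsum_ite_add_mem {G : Type*} [AddCommGroup G] [DecidableEq G] (s : Finset G) (b : G)
    (K : ℝ≥0∞) :
    ∑' c, (if b + c ∈ s then K else 0) = s.card * K := by
  rw [← (Equiv.addLeft (-b)).tsum_eq]
  simp only [Equiv.coe_addLeft, add_neg_cancel_left]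
  rw [tsum_eq_sum (s := s) fun c hc => if_neg hc, Finset.sum_congr rfl fun c hc => if_pos hc]
  simp

theorem floor_add_mem {a b s : ℝ} (hs : 0 < s) (h : |a + b| ≤ 2 * s) :
    -3 ≤ ⌊a / s⌋ + ⌊b / s⌋ ∧ ⌊a / s⌋ + ⌊b / s⌋ ≤ 2 := by
  have h1 : |a / s + b / s| ≤ 2 := by
    rw [← add_div, abs_div, abs_of_pos hs, div_le_iff₀ hs]; exact h
  rw [abs_le] at h1
  have ha := Int.floor_le (a / s)
  have hb := Int.floor_le (b / s)
  have ha' := Int.lt_floor_add_one (a / s)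
  have hb' := Int.lt_floor_add_one (b / s)
  constructor
  · have : (-4 : ℝ) < ⌊a / s⌋ + ⌊b / s⌋ := by linarith
    have : (-4 : ℤ) < ⌊a / s⌋ + ⌊b / s⌋ := by exact_mod_cast this
    omega
  · have : (⌊a / s⌋ + ⌊b / s⌋ : ℝ) ≤ 2 := by linarith
    exact_mod_cast this

/-- Almost orthogonality of square cells when the zeroth frequency is small. -/
theorem triBound_of_cells {P : Freq → Freq → Freq → Prop} (hP : MeasRel P) {s : ℝ} (hs : 0 < s)
    (hPz : ∀ z x y, P z x y → ‖z.2‖ ≤ 2 * s) {K : ℝ≥0∞}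
    (H : ∀ p : ℂ, TriBound (ind fun z x y => P z x y ∧ ‖x.2 - p‖ ≤ 2 * s) K) :
    TriBound (ind P) (36 * K) := by
  classical
  set A : Finset (ℤ × ℤ) := Finset.Icc (-3) 2 ×ˢ Finset.Icc (-3) 2 with hA
  have hcard : (A.card : ℝ≥0∞) = 36 := by
    have : A.card = 36 := rfl
    rw [this]; rfl
  refine triBound_of_blocks (κ₀ := fun _ => ()) (κ₁ := cell s) (κ₂ := cell s) measurable_const
    (measurable_cell s) (measurable_cell s) hP.meas3
    (fun _ b c => if b + c ∈ A then K else 0) (36 * K) ?_ ?_ ?_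
  · intro a b c
    by_cases hbc : b + c ∈ A
    · rw [if_pos hbc]
      refine (H ⟨b.1 * s, b.2 * s⟩).mono (fun z x y _ => ?_) le_rfl
      split_ifs with h
      swap
      · exact zero_le
      unfold ind
      by_cases hp : P z x y
      swap
      · simp [hp]
      rw [if_pos hp, if_pos]
      refine ⟨hp, ?_⟩
      have h1 : cell s x = b := h.2.1
      refine (Complex.norm_le_abs_re_add_abs_im _).trans ?_
      simp only [Complex.sub_re, Complex.sub_im]
      have key : ∀ u : ℝ, |u - ⌊u / s⌋ * s| ≤ s := fun u => by
        have h2 := Int.floor_le (u / s)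
        have h3 := Int.lt_floor_add_one (u / s)
        rw [le_div_iff₀ hs] at h2
        rw [div_lt_iff₀ hs] at h3
        rw [abs_le]; constructor <;> linarith
      have h4 := key x.2.re
      have h5 := key x.2.im
      rw [← h1]
      simp only [cell]
      linarith
    · rw [if_neg hbc]
      refine triBound_zero (fun z x y hz => ?_) 0
      split_ifs with h
      swap
      · rfl
      unfold ind
      rw [if_neg]
      intro hp
      apply hbc
      have h1 : ‖x.2 + y.2‖ ≤ 2 * s := by
        have : x.2 + y.2 = -z.2 := by
          have := congrArg Prod.snd hz
          simp only [Prod.snd_add, Prod.snd_zero] at this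
          linear_combination this
        rw [this, norm_neg]; exact hPz z x y hp
      have h2 := (Complex.abs_re_le_norm _).trans h1
      have h3 := (Complex.abs_im_le_norm _).trans h1
      rw [Complex.add_re] at h2
      rw [Complex.add_im] at h3
      rw [← h.2.1, ← h.2.2, hA, Finset.mem_product, Finset.mem_Icc, Finset.mem_Icc]
      exact ⟨floor_add_mem hs h2, floor_add_mem hs h3⟩
  · intro b
    rw [ENNReal.tsum_prod (f := fun (_ : Unit) (c : ℤ × ℤ) => if b + c ∈ A then K else 0)]
    rw [tsum_fintype, Fintype.sum_unique, tsum_ite_add_mem, hcard]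
  · intro a c
    simp only [add_comm _ c]
    rw [tsum_ite_add_mem, hcard]

theorem measurableSet_norm_sub_le (p : ℂ) (s : ℝ) : MeasurableSet {x : Freq | ‖x.2 - p‖ ≤ s} :=
  (isClosed_le (f := fun x : Freq => ‖x.2 - p‖) (g := fun _ => s) (by fun_prop)
    continuous_const).measurableSet

theorem const_mul_ofReal {a b c : ℝ} {n : ℕ} (h : n * c ≤ a) (hb : 0 ≤ b) :
    (n : ℝ≥0∞) * ENNReal.ofReal (c * b) ≤ ENNReal.ofReal (a * b) := by
  rw [← ENNReal.ofReal_natCast n, ← ENNReal.ofReal_mul (by positivity)]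
  refine ENNReal.ofReal_le_ofReal ?_
  rw [← mul_assoc]
  gcongr

theorem measRel_blk_cell (n₀ l₀ n₁ l₁ n₂ l₂ : ℕ) (p : ℂ) (s : ℝ) :
    MeasRel fun z x y => Blk n₀ l₀ n₁ l₁ n₂ l₂ z x y ∧ ‖x.2 - p‖ ≤ s :=
  (measRel_blk _ _ _ _ _ _).and (measRel₁ (measurableSet_norm_sub_le p s))

theorem triBound_annulus {n₀ l₀ n₁ l₁ n₂ l₂ : ℕ} {B : ℝ} (hB : 1 ≤ B) (hn : 1 ≤ n₀)
    (h01 : n₀ ≤ n₁) (h21 : n₂ ≤ n₁ + 1)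
    (hl : (2 : ℝ) * 2 ^ n₀ + 2 * 2 ^ l₀ + 2 * 2 ^ l₁ + 2 * 2 ^ l₂ ≤ B * (2 * 2 ^ n₀)) :
    TriBound (ind (Blk n₀ l₀ n₁ l₁ n₂ l₂))
      (ENNReal.ofReal (55738368 * B ^ 2 * 2 ^ ((1 / 2 * n₀ + n₁ + l₁ + l₂ - l₀ / 2 : ℝ) / 2))) := by
  refine (triBound_of_cells (measRel_blk n₀ l₀ n₁ l₁ n₂ l₂) (s := 2 ^ n₀) (by positivity) ?_
    (K := ENNReal.ofReal (1548288 * B ^ 2 * 2 ^ ((1 / 2 * n₀ + n₁ + l₁ + l₂ - l₀ / 2 : ℝ) / 2)))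
    fun p => ?_).mono (fun _ _ _ _ => le_rfl)
    (const_mul_ofReal (n := 36) (by norm_num; linarith) (by positivity))
  · rintro z x y ⟨⟨⟨h1, -⟩, -⟩, -⟩
    rw [← h1]; linarith [lt_fr z]
  refine triBound_ind (measRel_blk_cell _ _ _ _ _ _ _ _) (by nlinarith) fun z => ?_
  by_cases hz : fr z = n₀ ∧ mo z = l₀
  swap
  · have : {x | Blk n₀ l₀ n₁ l₁ n₂ l₂ z x (-(z + x)) ∧ ‖x.2 - p‖ ≤ 2 * 2 ^ n₀} = ∅ := by
      ext z; simp only [Blk, Set.mem_ofPred_eq, Set.mem_empty_iff_false, iff_false]; tauto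
    rw [this, measure_empty]; exact zero_le
  obtain ⟨rfl, rfl⟩ := hz
  set S : Set ℂ := {ξ | ‖ξ - p‖ ≤ 2 * 2 ^ fr z ∧ ‖ξ‖ + ‖ξ + z.2‖ ≤ 6 * 2 ^ n₁} with hS
  have hSm : MeasurableSet S := by
    refine IsClosed.measurableSet (IsClosed.inter (isClosed_le (f := fun ξ : ℂ => ‖ξ - p‖)
      (g := fun _ => 2 * 2 ^ fr z) ?_ continuous_const)
      (isClosed_le (f := fun ξ : ℂ => ‖ξ‖ + ‖ξ + z.2‖) (g := fun _ => 6 * 2 ^ n₁) ?_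
        continuous_const)) <;> fun_prop
  have hlt := lt_fr z
  have hfr := fr_le z
  have h2n : (2 : ℝ) ^ 1 ≤ 2 ^ fr z := pow_le_pow_right₀ (by norm_num) hn
  have h01' : (2 : ℝ) ^ fr z ≤ 2 ^ n₁ := pow_le_pow_right₀ (by norm_num) h01
  have hcd : coneDist z = |(|z.1| - ‖z.2‖)| := rfl
  have hmo := mo_le z
  have hlmo := lt_mo z
  refine (volume_le_area (S := S) (z := z) (L := 2 * 2 ^ l₁) (L' := 2 * 2 ^ l₂) hSm ?_).trans ?_
  · rintro x ⟨⟨⟨-, h1, h2⟩, h3, h4⟩, h5⟩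
    refine ⟨⟨h5, ?_⟩, ?_, ?_⟩
    · have e1 := lt_fr x
      have e2 := lt_fr (-(z + x))
      rw [h3, Prod.snd_neg, norm_neg, Prod.snd_add, add_comm] at e2
      rw [h1] at e1
      have e3 : (2 : ℝ) ^ n₂ ≤ 2 ^ (n₁ + 1) := pow_le_pow_right₀ (by norm_num) h21
      rw [pow_succ] at e3
      rw [add_comm x.2]
      linarith
    · rw [← h2]; linarith [lt_mo x]
    · rw [← h4]; linarith [lt_mo (-(z + x))]
  · have harea := area_annulus_le (t := z.1) (ω := z.2) (Λ := 2 * 2 ^ l₁ + 2 * 2 ^ l₂)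
      (r := 2 * 2 ^ fr z) (ρ := ‖p‖) (N := 6 * 2 ^ n₁) (B := B) (S := S) (by positivity)
      (by positivity) (by linarith) (by linarith) (by linarith) hB
      (by
        have := le_abs_self (|z.1| - ‖z.2‖)
        linarith)
      (fun ξ hξ => ⟨(abs_norm_sub_norm_le ξ p).trans hξ.1, hξ.2⟩)
    refine (mul_le_mul_right harea _).trans ?_
    rw [← ENNReal.ofReal_mul (by positivity)]
    refine ENNReal.ofReal_le_ofReal ?_
    have hQ : (2 : ℝ) ^ mo z ≤ 2 * 2 ^ l₁ + 2 * 2 ^ l₂ + |(|z.1| - ‖z.2‖)| := by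
      have h2 : (1 : ℝ) ≤ 2 ^ l₁ := one_le_pow₀ (by norm_num)
      have h3 : (1 : ℝ) ≤ 2 ^ l₂ := one_le_pow₀ (by norm_num)
      linarith
    have h2 : min (2 * 2 ^ l₁) (2 * 2 ^ l₂ : ℝ) * (2 * 2 ^ l₁ + 2 * 2 ^ l₂) ≤
      2 * ((2 * 2 ^ l₁) * (2 * 2 ^ l₂)) := min_mul_add_le (by positivity) (by positivity)
    have h3 : √(2 * (2 : ℝ) ^ fr z) ≤ 2 * √(2 ^ fr z) := by
      rw [Real.sqrt_mul (by norm_num)]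
      have : √2 ≤ (2 : ℝ) := by rw [Real.sqrt_le_left (by norm_num)]; norm_num
      gcongr
    have e : (2 : ℝ) ^ (1 / 2 * fr z + n₁ + l₁ + l₂ - mo z / 2 : ℝ) =
        √(2 ^ fr z) * 2 ^ n₁ * (2 ^ l₁ * 2 ^ l₂) / √(2 ^ mo z) := by
      rw [← two_rpow_half, ← two_rpow_half, Real.rpow_sub (by norm_num),
        ← Real.rpow_natCast, ← Real.rpow_natCast, ← Real.rpow_natCast,
        ← Real.rpow_add (by norm_num), ← Real.rpow_add (by norm_num),
        ← Real.rpow_add (by norm_num)]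
      ring_nf
    rw [e]
    calc _ = 4 * 4032 * B ^ 2 * ((6 * 2 ^ n₁) * √(2 * (2 : ℝ) ^ fr z) *
          (min (2 * 2 ^ l₁) (2 * 2 ^ l₂ : ℝ) * (2 * 2 ^ l₁ + 2 * 2 ^ l₂)) /
          √(2 * 2 ^ l₁ + 2 * 2 ^ l₂ + |(|z.1| - ‖z.2‖)|)) := by ring
      _ ≤ 4 * 4032 * B ^ 2 * ((6 * 2 ^ n₁) * (2 * √(2 ^ fr z)) *
          (2 * ((2 * 2 ^ l₁) * (2 * 2 ^ l₂))) / √(2 ^ mo z)) := by gcongr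
      _ = _ := by ring

theorem triBound_elliptic {n₀ l₀ n₁ l₁ n₂ l₂ : ℕ} (hn : n₀ + 4 ≤ n₁) (hl : n₀ + 6 ≤ l₀)
    (h1 : l₁ ≤ n₀ + 3) (h2 : l₂ ≤ l₁) :
    TriBound (ind (Blk n₀ l₀ n₁ l₁ n₂ l₂))
      (ENNReal.ofReal (147456 * 2 ^ ((n₀ + l₁ + l₂ : ℝ) / 2))) := by
  refine (triBound_of_cells (measRel_blk n₀ l₀ n₁ l₁ n₂ l₂) (s := 2 ^ n₀) (by positivity) ?_
    (K := ENNReal.ofReal (4096 * 2 ^ ((n₀ + l₁ + l₂ : ℝ) / 2)))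
    fun p => ?_).mono (fun _ _ _ _ => le_rfl)
    (const_mul_ofReal (n := 36) (by norm_num) (by positivity))
  · rintro z x y ⟨⟨⟨h1, -⟩, -⟩, -⟩
    rw [← h1]; linarith [lt_fr z]
  refine triBound_ind (measRel_blk_cell _ _ _ _ _ _ _ _) (by norm_num) fun z => ?_
  by_cases hz : fr z = n₀ ∧ mo z = l₀
  swap
  · have : {x | Blk n₀ l₀ n₁ l₁ n₂ l₂ z x (-(z + x)) ∧ ‖x.2 - p‖ ≤ 2 * 2 ^ n₀} = ∅ := by
      ext z; simp only [Blk, Set.mem_ofPred_eq, Set.mem_empty_iff_false, iff_false]; tauto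
    rw [this, measure_empty]; exact zero_le
  obtain ⟨rfl, rfl⟩ := hz
  set S : Set ℂ := {ξ | ‖ξ - p‖ ≤ 2 * 2 ^ fr z ∧ 2 * ‖z.2‖ ≤ ‖ξ‖} with hS
  have hSm : MeasurableSet S := by
    refine IsClosed.measurableSet (IsClosed.inter (isClosed_le (f := fun ξ : ℂ => ‖ξ - p‖)
      (g := fun _ => 2 * 2 ^ fr z) ?_ continuous_const)
      (isClosed_le continuous_const continuous_norm))
    fun_prop
  have hlt := lt_fr z
  have hN : (2 : ℝ) ^ (fr z + 4) ≤ 2 ^ n₁ := pow_le_pow_right₀ (by norm_num) hn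
  have hL : (2 : ℝ) ^ (fr z + 6) ≤ 2 ^ mo z := pow_le_pow_right₀ (by norm_num) hl
  have hL1 : (2 : ℝ) ^ l₁ ≤ 2 ^ (fr z + 3) := pow_le_pow_right₀ (by norm_num) h1
  have hL2 : (2 : ℝ) ^ l₂ ≤ 2 ^ l₁ := pow_le_pow_right₀ (by norm_num) h2
  rw [pow_add] at hN hL hL1
  have hone : (1 : ℝ) ≤ 2 ^ fr z := one_le_pow₀ (by norm_num)
  have hcd : coneDist z = |(|z.1| - ‖z.2‖)| := rfl
  have hmo := mo_le z
  refine (volume_le_area (S := S) (z := z) (L := 2 * 2 ^ l₁) (L' := 2 * 2 ^ l₂) hSm ?_).trans ?_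
  · rintro x ⟨⟨⟨-, h1, h2⟩, -, h4⟩, h5⟩
    refine ⟨⟨h5, ?_⟩, ?_, ?_⟩
    · have e1 := fr_le x
      rw [h1] at e1
      linarith
    · rw [← h2]; linarith [lt_mo x]
    · rw [← h4]; linarith [lt_mo (-(z + x))]
  · have harea : volume (S ∩ interactionSet z.1 z.2 (2 * 2 ^ l₁ + 2 * 2 ^ l₂)) ≤
        ENNReal.ofReal (64 * (2 * 2 ^ l₁ + 2 * 2 ^ l₂) * (2 * 2 ^ fr z)) := by
      refine area_cell_le (ω := z.2) (p := p) (a := |z.1|) (by positivity) (by positivity) ?_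
      rintro ξ ⟨⟨h3, h4⟩, h5⟩
      refine ⟨h4, h3, ?_⟩
      rw [hcd] at hmo
      have e1 : |‖ξ‖ - ‖ξ + z.2‖| ≤ ‖z.2‖ := by
        refine (abs_norm_sub_norm_le _ _).trans ?_
        rw [sub_add_cancel_left, norm_neg]
      have e2 := abs_le.1 e1
      rcases h5 with h | h | h
      · exact h
      all_goals
        exfalso
        rw [abs_le] at h
        have e3 : |z.1| ≤ ‖z.2‖ + (2 * 2 ^ l₁ + 2 * 2 ^ l₂) := by
          rw [abs_le]; constructor <;> linarith
        have e4 : |(|z.1| - ‖z.2‖)| ≤ max ‖z.2‖ (2 * 2 ^ l₁ + 2 * 2 ^ l₂) := by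
          rw [abs_le]
          have := le_max_left ‖z.2‖ (2 * 2 ^ l₁ + 2 * 2 ^ l₂)
          have := le_max_right ‖z.2‖ (2 * 2 ^ l₁ + 2 * 2 ^ l₂)
          constructor <;> linarith [abs_nonneg z.1]
        rcases le_max_iff.1 e4 with h | h <;> linarith
    refine (mul_le_mul_right harea _).trans ?_
    rw [← ENNReal.ofReal_mul (by positivity)]
    refine ENNReal.ofReal_le_ofReal ?_
    have h2 : min (2 * 2 ^ l₁) (2 * 2 ^ l₂ : ℝ) * (2 * 2 ^ l₁ + 2 * 2 ^ l₂) ≤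
      2 * ((2 * 2 ^ l₁) * (2 * 2 ^ l₂)) := min_mul_add_le (by positivity) (by positivity)
    have e : (2 : ℝ) ^ (fr z + l₁ + l₂ : ℝ) = 2 ^ fr z * 2 ^ l₁ * 2 ^ l₂ := by
      rw [← Real.rpow_natCast, ← Real.rpow_natCast, ← Real.rpow_natCast,
        ← Real.rpow_add (by norm_num), ← Real.rpow_add (by norm_num)]
    rw [e]
    calc _ = 4 * 64 * (2 * 2 ^ fr z) *
          (min (2 * 2 ^ l₁) (2 * 2 ^ l₂ : ℝ) * (2 * 2 ^ l₁ + 2 * 2 ^ l₂)) := by ring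
      _ ≤ 4 * 64 * (2 * 2 ^ fr z) * (2 * ((2 * 2 ^ l₁) * (2 * 2 ^ l₂))) := by gcongr
      _ = _ := by ring

/-- Admissible exponents, with quantified strictness `δ`. -/
structure Adm (δ s₀ s₁ s₂ b₀ b₁ b₂ : ℝ) : Prop where
  pos : 0 < δ
  b01 : 0 ≤ b₀ + b₁
  b02 : 0 ≤ b₀ + b₂
  b12 : 0 ≤ b₁ + b₂
  s01 : 0 ≤ s₀ + s₁
  s02 : 0 ≤ s₀ + s₂
  s12 : 0 ≤ s₁ + s₂
  t0 : 0 ≤ s₁ + s₂ + b₀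
  t1 : 0 ≤ s₀ + s₂ + b₁
  t2 : 0 ≤ s₀ + s₁ + b₂
  ssum : δ ≤ 2 * (s₀ + s₁ + s₂) - 3 / 2
  bsum : δ ≤ 2 * (b₀ + b₁ + b₂) - 1
  all : δ ≤ 2 * (s₀ + s₁ + s₂) + 2 * (b₀ + b₁ + b₂) - 3
  p01 : δ ≤ 2 * (s₀ + s₁ + s₂) + 2 * (b₀ + b₁) - 2
  p02 : δ ≤ 2 * (s₀ + s₁ + s₂) + 2 * (b₀ + b₂) - 2
  p12 : δ ≤ 2 * (s₀ + s₁ + s₂) + 2 * (b₁ + b₂) - 2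
  q0 : δ ≤ 2 * (s₀ + s₁ + s₂) + 2 * b₀ - 1
  q1 : δ ≤ 2 * (s₀ + s₁ + s₂) + 2 * b₁ - 1
  q2 : δ ≤ 2 * (s₀ + s₁ + s₂) + 2 * b₂ - 1
  r0 : δ ≤ 2 * s₀ + 4 * s₁ + 4 * s₂ + 2 * b₀ - 2
  r1 : δ ≤ 4 * s₀ + 2 * s₁ + 4 * s₂ + 2 * b₁ - 2
  r2 : δ ≤ 4 * s₀ + 4 * s₁ + 2 * s₂ + 2 * b₂ - 2
  g0 : 0 ≤ b₀ ∨ δ ≤ -2 * b₀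
  g1 : 0 ≤ b₁ ∨ δ ≤ -2 * b₁
  g2 : 0 ≤ b₂ ∨ δ ≤ -2 * b₂

theorem Adm.swap12 {δ s₀ s₁ s₂ b₀ b₁ b₂ : ℝ} (h : Adm δ s₀ s₁ s₂ b₀ b₁ b₂) :
    Adm δ s₀ s₂ s₁ b₀ b₂ b₁ := by
  obtain ⟨h1, h2, h3, h4, h5, h6, h7, h8, h9, h10, h11, h12, h13, h14, h15, h16, h17, h18, h19,
    h20, h21, h22, h23, h24, h25⟩ := h
  constructor <;> first | assumption | linarith

theorem Adm.swap01 {δ s₀ s₁ s₂ b₀ b₁ b₂ : ℝ} (h : Adm δ s₀ s₁ s₂ b₀ b₁ b₂) :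
    Adm δ s₁ s₀ s₂ b₁ b₀ b₂ := by
  obtain ⟨h1, h2, h3, h4, h5, h6, h7, h8, h9, h10, h11, h12, h13, h14, h15, h16, h17, h18, h19,
    h20, h21, h22, h23, h24, h25⟩ := h
  constructor <;> first | assumption | linarith

theorem mul_ge_of_le {δ c x κ : ℝ} (hc : δ ≤ c) (hx : -κ ≤ x) : δ * x - κ * (c - δ) ≤ c * x := by
  nlinarith

theorem mul_ge_neg_abs {c x κ : ℝ} (hx : |x| ≤ κ) : -(κ * |c|) ≤ c * x := by
  have h := neg_abs_le (c * x)
  rw [abs_mul] at h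
  nlinarith [abs_nonneg c]

/-- A constant dominating all error terms in the exponent inequalities below. -/
def errConst (δ s₀ s₁ s₂ b₀ b₁ b₂ : ℝ) : ℝ :=
  1000 * (1 + δ + |s₀| + |s₁| + |s₂| + |b₀| + |b₁| + |b₂|)

/-- Twice the exponent of the product of the weights. -/
def expo (s₀ s₁ s₂ b₀ b₁ b₂ n₀ l₀ n₁ l₁ n₂ l₂ : ℝ) : ℝ :=
  2 * (s₀ * n₀ + s₁ * n₁ + s₂ * n₂ + b₀ * l₀ + b₁ * l₁ + b₂ * l₂)

section LP

variable {δ s₀ s₁ s₂ b₀ b₁ b₂ m n n' l₀ l₁ l₂ σ : ℝ}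

theorem lp_ball_left (h : Adm δ s₀ s₁ s₂ b₀ b₁ b₂) (hn : |n' - n| ≤ 1) (hm : m ≤ n) (hl2 : 0 ≤ l₂)
    (hl0 : 0 ≤ l₀) (h1 : l₁ ≤ m + 3) (h01 : l₀ ≤ l₁) (h21 : l₂ ≤ l₁) (hσ : σ ≤ 3 * m + 11) :
    δ / 8 * σ - errConst δ s₀ s₁ s₂ b₀ b₁ b₂ ≤
      expo s₀ s₁ s₂ b₀ b₁ b₂ m l₀ n l₁ n' l₂ - (3 / 2 * m + l₀ + l₂ - l₁ / 2) := by
  obtain ⟨h1, h2, h3, h4, h5, h6, h7, h8, h9, h10, h11, h12, h13, h14, h15, h16, h17, h18, h19,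
    h20, h21, h22, h23, h24, h25⟩ := h
  have e1 := mul_ge_neg_abs (c := s₂) hn
  have e2 := mul_ge_of_le (x := n - m) (κ := 0) h7 (by linarith)
  have e3 := mul_ge_of_le (x := m - l₁) (κ := 3) h11 (by linarith)
  have e4 := mul_ge_of_le (x := 3 * m + 11 - σ) (κ := 0) h1.le (by linarith)
  have e5 := mul_ge_of_le (x := m + 3) (κ := 0) h1.le (by linarith)
  unfold expo errConst
  rcases le_total l₀ l₂ with h | h
  · have f1 := mul_ge_of_le (x := l₁ - l₂) (κ := 0) h18 (by linarith)
    have f2 := mul_ge_of_le (x := l₂ - l₀) (κ := 0) h16 (by linarith)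
    have f3 := mul_ge_of_le (x := l₀) (κ := 0) h13 (by linarith)
    linarith [le_abs_self s₀, le_abs_self s₁, le_abs_self s₂, abs_nonneg b₀, abs_nonneg b₁,
      abs_nonneg b₂, abs_nonneg s₀, abs_nonneg s₁, abs_nonneg s₂]
  · have f1 := mul_ge_of_le (x := l₁ - l₀) (κ := 0) h18 (by linarith)
    have f2 := mul_ge_of_le (x := l₀ - l₂) (κ := 0) h14 (by linarith)
    have f3 := mul_ge_of_le (x := l₂) (κ := 0) h13 (by linarith)
    linarith [le_abs_self s₀, le_abs_self s₁, le_abs_self s₂, abs_nonneg b₀, abs_nonneg b₁,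
      abs_nonneg b₂, abs_nonneg s₀, abs_nonneg s₁, abs_nonneg s₂]

theorem lp_ball_right (h : Adm δ s₀ s₁ s₂ b₀ b₁ b₂) (hn : |n' - n| ≤ 1) (hl2 : 0 ≤ l₂) (h10 : l₁ ≤ l₀)
    (h0 : l₀ ≤ m + 7) (hmn : m + l₀ ≤ n + l₁ + 8) (h21 : l₂ ≤ l₁) (hσ : σ ≤ 3 * m + 11) :
    δ / 8 * σ - errConst δ s₀ s₁ s₂ b₀ b₁ b₂ ≤
      expo s₀ s₁ s₂ b₀ b₁ b₂ m l₀ n l₁ n' l₂ - (3 / 2 * m + l₀ + l₂ - l₀ / 2) := by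
  obtain ⟨h1, h2, h3, h4, h5, h6, h7, h8, h9, h10, h11, h12, h13, h14, h15, h16, h17, h18, h19,
    h20, h21, h22, h23, h24, h25⟩ := h
  have e1 := mul_ge_neg_abs (c := s₂) hn
  have e2 := mul_ge_of_le (x := n - m - l₀ + l₁) (κ := 8) h7 (by linarith)
  have e3 := mul_ge_of_le (x := m - l₀) (κ := 7) h11 (by linarith)
  have e4 := mul_ge_of_le (x := l₀ - l₁) (κ := 0) h20 (by linarith)
  have e5 := mul_ge_of_le (x := l₁ - l₂) (κ := 0) h14 (by linarith)
  have e6 := mul_ge_of_le (x := l₂) (κ := 0) h13 (by linarith)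
  have e7 := mul_ge_of_le (x := 3 * m + 11 - σ) (κ := 0) h1.le (by linarith)
  have e8 := mul_ge_of_le (x := m + 7) (κ := 0) h1.le (by linarith)
  unfold expo errConst
  linarith [le_abs_self s₀, le_abs_self s₁, le_abs_self s₂, le_abs_self b₀, le_abs_self b₁,
    le_abs_self b₂, neg_abs_le b₀, neg_abs_le b₁, neg_abs_le b₂, neg_abs_le s₀, neg_abs_le s₁,
    neg_abs_le s₂]

theorem lp_annulus (h : Adm δ s₀ s₁ s₂ b₀ b₁ b₂) (hn : |n' - n| ≤ 1) (hm : m ≤ n) (hl2 : 0 ≤ l₂) (h10 : l₁ ≤ l₀)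
    (h0 : l₀ ≤ m + 7) (hmn : n + l₁ + 8 ≤ m + l₀) (h21 : l₂ ≤ l₁) (hσ : σ ≤ 3 * m + 11) :
    δ / 8 * σ - errConst δ s₀ s₁ s₂ b₀ b₁ b₂ ≤
      expo s₀ s₁ s₂ b₀ b₁ b₂ m l₀ n l₁ n' l₂ - (1 / 2 * m + n + l₁ + l₂ - l₀ / 2) := by
  obtain ⟨h1, h2, h3, h4, h5, h6, h7, h8, h9, h10, h11, h12, h13, h14, h15, h16, h17, h18, h19,
    h20, h21, h22, h23, h24, h25⟩ := h
  have e1 := mul_ge_neg_abs (c := s₂) hn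
  have e2 := mul_ge_of_le (x := l₀ - l₁ - n + m) (κ := 0) h17 (by linarith)
  have e3 := mul_ge_of_le (x := m - l₀) (κ := 7) h11 (by linarith)
  have e4 := mul_ge_of_le (x := n - m) (κ := 0) h20 (by linarith)
  have e5 := mul_ge_of_le (x := l₁ - l₂) (κ := 0) h14 (by linarith)
  have e6 := mul_ge_of_le (x := l₂) (κ := 0) h13 (by linarith)
  have e7 := mul_ge_of_le (x := 3 * m + 11 - σ) (κ := 0) h1.le (by linarith)
  have e8 := mul_ge_of_le (x := m + 7) (κ := 0) h1.le (by linarith)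
  unfold expo errConst
  linarith [le_abs_self s₀, le_abs_self s₁, le_abs_self s₂, le_abs_self b₀, le_abs_self b₁,
    le_abs_self b₂, neg_abs_le b₀, neg_abs_le b₁, neg_abs_le b₂, neg_abs_le s₀, neg_abs_le s₁,
    neg_abs_le s₂]

theorem lp_elliptic (h : Adm δ s₀ s₁ s₂ b₀ b₁ b₂) (hn : |n' - n| ≤ 1) (hm : m ≤ n) (hl2 : 0 ≤ l₂) (h0n : |l₀ - n| ≤ 3)
    (h1 : l₁ ≤ m + 3) (h21 : l₂ ≤ l₁) (hσ : σ ≤ 2 * m + 11) :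
    δ / 8 * σ - errConst δ s₀ s₁ s₂ b₀ b₁ b₂ ≤
      expo s₀ s₁ s₂ b₀ b₁ b₂ m l₀ n l₁ n' l₂ - (m + l₁ + l₂) := by
  obtain ⟨h1, h2, h3, h4, h5, h6, h7, h8, h9, h10, h11, h12, h13, h14, h15, h16, h17, h18, h19,
    h20, h21, h22, h23, h24, h25⟩ := h
  have e1 := mul_ge_neg_abs (c := s₂) hn
  have e2 := mul_ge_neg_abs (c := b₀) h0n
  have e3 := mul_ge_of_le (x := n - m) (κ := 0) h8 (by linarith)
  have e4 := mul_ge_of_le (x := m - l₁) (κ := 3) h17 (by linarith)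
  have e5 := mul_ge_of_le (x := l₁ - l₂) (κ := 0) h14 (by linarith)
  have e6 := mul_ge_of_le (x := l₂) (κ := 0) h13 (by linarith)
  have e7 := mul_ge_of_le (x := 2 * m + 11 - σ) (κ := 0) h1.le (by linarith)
  have e8 := mul_ge_of_le (x := m + 3) (κ := 0) h1.le (by linarith)
  unfold expo errConst
  linarith [le_abs_self s₀, le_abs_self s₁, le_abs_self s₂, le_abs_self b₀, le_abs_self b₁,
    le_abs_self b₂, neg_abs_le b₀, neg_abs_le b₁, neg_abs_le b₂, neg_abs_le s₀, neg_abs_le s₁,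
    neg_abs_le s₂]

theorem lp_trivial_left (h : Adm δ s₀ s₁ s₂ b₀ b₁ b₂) (hn : |n' - n| ≤ 1) (hm : m ≤ n) (hm0 : 0 ≤ m) (hl0 : 0 ≤ l₀)
    (hl21 : |l₂ - l₁| ≤ 3) (h1 : m ≤ l₁) (h01 : l₀ ≤ l₁ + 7) (hσ : σ ≤ m + l₀ + 11) :
    δ / 8 * σ - errConst δ s₀ s₁ s₂ b₀ b₁ b₂ ≤
      expo s₀ s₁ s₂ b₀ b₁ b₂ m l₀ n l₁ n' l₂ - (2 * m + l₀) := by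
  obtain ⟨h1, h2, h3, h4, h5, h6, h7, h8, h9, h10, h11, h12, h13, h14, h15, h16, h17, h18, h19,
    h20, h21, h22, h23, h24, h25⟩ := h
  have e1 := mul_ge_neg_abs (c := s₂) hn
  have e2 := mul_ge_neg_abs (c := b₂) hl21
  have e3 := mul_ge_of_le (x := n - m) (κ := 0) h7 (by linarith)
  have e7 := mul_ge_of_le (x := m + l₀ + 11 - σ) (κ := 0) h1.le (by linarith)
  have e8 := mul_ge_of_le (x := m) (κ := 0) h1.le (by linarith)
  have e9 := mul_ge_of_le (x := l₀) (κ := 0) h1.le (by linarith)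
  unfold expo errConst
  rcases le_total l₀ m with h | h
  · have f1 := mul_ge_of_le (x := l₁ - m) (κ := 0) h4 (by linarith)
    have f2 := mul_ge_of_le (x := m - l₀) (κ := 0) h16 (by linarith)
    have f4 := mul_ge_of_le (x := m - l₀) (κ := 0) h1.le (by linarith)
    have f3 := mul_ge_of_le (x := l₀) (κ := 0) h13 (by linarith)
    linarith [le_abs_self s₀, le_abs_self s₁, le_abs_self s₂, le_abs_self b₀, le_abs_self b₁,
      le_abs_self b₂, neg_abs_le b₀, neg_abs_le b₁, neg_abs_le b₂, neg_abs_le s₀, neg_abs_le s₁,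
      neg_abs_le s₂]
  · have f1 := mul_ge_of_le (x := l₁ - l₀) (κ := 7) h4 (by linarith)
    have f2 := mul_ge_of_le (x := l₀ - m) (κ := 0) h12 (by linarith)
    have f4 := mul_ge_of_le (x := l₀ - m) (κ := 0) h1.le (by linarith)
    have f3 := mul_ge_of_le (x := m) (κ := 0) h13 (by linarith)
    linarith [le_abs_self s₀, le_abs_self s₁, le_abs_self s₂, le_abs_self b₀, le_abs_self b₁,
      le_abs_self b₂, neg_abs_le b₀, neg_abs_le b₁, neg_abs_le b₂, neg_abs_le s₀, neg_abs_le s₁,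
      neg_abs_le s₂]

theorem lp_trivial_right (h : Adm δ s₀ s₁ s₂ b₀ b₁ b₂) (hn : |n' - n| ≤ 1) (hm : m ≤ n) (hm0 : 0 ≤ m) (hl2 : 0 ≤ l₂)
    (hl01 : |l₀ - l₁| ≤ 7) (h1 : m ≤ l₁) (h21 : l₂ ≤ l₁) (hσ : σ ≤ m + l₂ + 11) :
    δ / 8 * σ - errConst δ s₀ s₁ s₂ b₀ b₁ b₂ ≤
      expo s₀ s₁ s₂ b₀ b₁ b₂ m l₀ n l₁ n' l₂ - (2 * m + l₂) := by
  obtain ⟨h1, h2, h3, h4, h5, h6, h7, h8, h9, h10, h11, h12, h13, h14, h15, h16, h17, h18, h19,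
    h20, h21, h22, h23, h24, h25⟩ := h
  have e1 := mul_ge_neg_abs (c := s₂) hn
  have e2 := mul_ge_neg_abs (c := b₀) hl01
  have e3 := mul_ge_of_le (x := n - m) (κ := 0) h7 (by linarith)
  have e7 := mul_ge_of_le (x := m + l₂ + 11 - σ) (κ := 0) h1.le (by linarith)
  have e8 := mul_ge_of_le (x := m) (κ := 0) h1.le (by linarith)
  have e9 := mul_ge_of_le (x := l₂) (κ := 0) h1.le (by linarith)
  unfold expo errConst
  rcases le_total l₂ m with h | h
  · have f1 := mul_ge_of_le (x := l₁ - m) (κ := 0) h2 (by linarith)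
    have f2 := mul_ge_of_le (x := m - l₂) (κ := 0) h14 (by linarith)
    have f4 := mul_ge_of_le (x := m - l₂) (κ := 0) h1.le (by linarith)
    have f3 := mul_ge_of_le (x := l₂) (κ := 0) h13 (by linarith)
    linarith [le_abs_self s₀, le_abs_self s₁, le_abs_self s₂, le_abs_self b₀, le_abs_self b₁,
      le_abs_self b₂, neg_abs_le b₀, neg_abs_le b₁, neg_abs_le b₂, neg_abs_le s₀, neg_abs_le s₁,
      neg_abs_le s₂]
  · have f1 := mul_ge_of_le (x := l₁ - l₂) (κ := 0) h2 (by linarith)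
    have f2 := mul_ge_of_le (x := l₂ - m) (κ := 0) h12 (by linarith)
    have f4 := mul_ge_of_le (x := l₂ - m) (κ := 0) h1.le (by linarith)
    have f3 := mul_ge_of_le (x := m) (κ := 0) h13 (by linarith)
    linarith [le_abs_self s₀, le_abs_self s₁, le_abs_self s₂, le_abs_self b₀, le_abs_self b₁,
      le_abs_self b₂, neg_abs_le b₀, neg_abs_le b₁, neg_abs_le b₂, neg_abs_le s₀, neg_abs_le s₁,
      neg_abs_le s₂]

theorem lp_wide_neg (h : Adm δ s₀ s₁ s₂ b₀ b₁ b₂) (hn : |n' - n| ≤ 1) (hm0 : 0 ≤ m) (hl2 : 0 ≤ l₂) (hb : δ ≤ -2 * b₁)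
    (hl0 : |l₀ - n| ≤ 3) (h1 : m ≤ l₁) (h21 : l₂ ≤ l₁) (h1n : l₁ ≤ n) (hσ : σ ≤ m + l₂ + (n - l₁) + 11) :
    δ / 8 * σ - errConst δ s₀ s₁ s₂ b₀ b₁ b₂ ≤
      expo s₀ s₁ s₂ b₀ b₁ b₂ m l₀ n l₁ n' l₂ - (2 * m + l₂) := by
  obtain ⟨h1, h2, h3, h4, h5, h6, h7, h8, h9, h10, h11, h12, h13, h14, h15, h16, h17, h18, h19,
    h20, h21, h22, h23, h24, h25⟩ := h
  have e1 := mul_ge_neg_abs (c := s₂) hn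
  have e2 := mul_ge_neg_abs (c := b₀) hl0
  have e3 : δ ≤ 2 * (s₁ + s₂ + b₀) := by linarith
  have e4 : 0 ≤ s₁ + s₂ + b₀ + b₁ := by linarith
  have e5 : δ ≤ 2 * (s₁ + s₂) + 2 * (b₀ + b₁ + b₂) - 1 := by linarith
  have e6 := mul_ge_of_le (x := n - l₁) (κ := 0) e3 (by linarith)
  have e7 := mul_ge_of_le (x := m + l₂ + (n - l₁) + 11 - σ) (κ := 0) h1.le (by linarith)
  have e8 := mul_ge_of_le (x := m) (κ := 0) h1.le (by linarith)
  have e9 := mul_ge_of_le (x := l₂) (κ := 0) h1.le (by linarith)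
  have e10 := mul_ge_of_le (x := n - l₁) (κ := 0) h1.le (by linarith)
  unfold expo errConst
  rcases le_total l₂ m with h | h
  · have f1 := mul_ge_of_le (x := l₁ - m) (κ := 0) e4 (by linarith)
    have f2 := mul_ge_of_le (x := m - l₂) (κ := 0) h14 (by linarith)
    have f4 := mul_ge_of_le (x := m - l₂) (κ := 0) h1.le (by linarith)
    have f3 := mul_ge_of_le (x := l₂) (κ := 0) h13 (by linarith)
    linarith [le_abs_self s₀, le_abs_self s₁, le_abs_self s₂, le_abs_self b₀, le_abs_self b₁,
      le_abs_self b₂, neg_abs_le b₀, neg_abs_le b₁, neg_abs_le b₂, neg_abs_le s₀, neg_abs_le s₁,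
      neg_abs_le s₂]
  · have f1 := mul_ge_of_le (x := l₁ - l₂) (κ := 0) e4 (by linarith)
    have f2 := mul_ge_of_le (x := l₂ - m) (κ := 0) e5 (by linarith)
    have f4 := mul_ge_of_le (x := l₂ - m) (κ := 0) h1.le (by linarith)
    have f3 := mul_ge_of_le (x := m) (κ := 0) h13 (by linarith)
    linarith [le_abs_self s₀, le_abs_self s₁, le_abs_self s₂, le_abs_self b₀, le_abs_self b₁,
      le_abs_self b₂, neg_abs_le b₀, neg_abs_le b₁, neg_abs_le b₂, neg_abs_le s₀, neg_abs_le s₁,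
      neg_abs_le s₂]

theorem lp_wide_nonneg (h : Adm δ s₀ s₁ s₂ b₀ b₁ b₂) (hn : |n' - n| ≤ 1) (hm0 : 0 ≤ m) (hl2 : 0 ≤ l₂) (hl0 : |l₀ - n| ≤ 3)
    (hmn : m ≤ n) (h2n : l₂ ≤ n) (hσ : σ ≤ m + l₂ + 11) :
    δ / 8 * σ - errConst δ s₀ s₁ s₂ b₀ b₁ b₂ ≤
      expo s₀ s₁ s₂ b₀ b₁ b₂ m l₀ n (max l₂ m) n' l₂ - (2 * m + l₂) := by
  obtain ⟨h1, h2, h3, h4, h5, h6, h7, h8, h9, h10, h11, h12, h13, h14, h15, h16, h17, h18, h19,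
    h20, h21, h22, h23, h24, h25⟩ := h
  have e1 := mul_ge_neg_abs (c := s₂) hn
  have e2 := mul_ge_neg_abs (c := b₀) hl0
  have e5 : δ ≤ 2 * (s₁ + s₂) + 2 * (b₀ + b₁ + b₂) - 1 := by linarith
  have e7 := mul_ge_of_le (x := m + l₂ + 11 - σ) (κ := 0) h1.le (by linarith)
  have e8 := mul_ge_of_le (x := m) (κ := 0) h1.le (by linarith)
  have e9 := mul_ge_of_le (x := l₂) (κ := 0) h1.le (by linarith)
  unfold expo errConst
  rcases le_total l₂ m with h | h
  · rw [max_eq_right h]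
    have f1 := mul_ge_of_le (x := n - m) (κ := 0) h8 (by linarith)
    have f2 := mul_ge_of_le (x := m - l₂) (κ := 0) h14 (by linarith)
    have f4 := mul_ge_of_le (x := m - l₂) (κ := 0) h1.le (by linarith)
    have f3 := mul_ge_of_le (x := l₂) (κ := 0) h13 (by linarith)
    linarith [le_abs_self s₀, le_abs_self s₁, le_abs_self s₂, le_abs_self b₀, le_abs_self b₁,
      le_abs_self b₂, neg_abs_le b₀, neg_abs_le b₁, neg_abs_le b₂, neg_abs_le s₀, neg_abs_le s₁,
      neg_abs_le s₂]
  · rw [max_eq_left h]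
    have f1 := mul_ge_of_le (x := n - l₂) (κ := 0) h8 (by linarith)
    have f2 := mul_ge_of_le (x := l₂ - m) (κ := 0) e5 (by linarith)
    have f4 := mul_ge_of_le (x := l₂ - m) (κ := 0) h1.le (by linarith)
    have f3 := mul_ge_of_le (x := m) (κ := 0) h13 (by linarith)
    linarith [le_abs_self s₀, le_abs_self s₁, le_abs_self s₂, le_abs_self b₀, le_abs_self b₁,
      le_abs_self b₂, neg_abs_le b₀, neg_abs_le b₁, neg_abs_le b₂, neg_abs_le s₀, neg_abs_le s₁,
      neg_abs_le s₂]

theorem lp_small (h : Adm δ s₀ s₁ s₂ b₀ b₁ b₂) (hn : |n' - n| ≤ 1) (hn0 : n = 0) (hm : m = 0)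
    (hl0 : |l₀| ≤ 7) (hl1 : |l₁| ≤ 7) (hl2 : |l₂| ≤ 7) (hσ : σ ≤ 22) :
    δ / 8 * σ - errConst δ s₀ s₁ s₂ b₀ b₁ b₂ ≤
      expo s₀ s₁ s₂ b₀ b₁ b₂ m l₀ n l₁ n' l₂ - (2 * m + l₀) := by
  have e0 := h.pos
  have e1 := mul_ge_neg_abs (c := s₂) hn
  have e2 := mul_ge_neg_abs (c := b₀) hl0
  have e3 := mul_ge_neg_abs (c := b₁) hl1
  have e4 := mul_ge_neg_abs (c := b₂) hl2
  have e5 := mul_ge_of_le (x := 22 - σ) (κ := 0) e0.le (by linarith)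
  have e6 := le_abs_self l₀
  subst hn0 hm
  unfold expo errConst
  linarith [abs_nonneg s₀, abs_nonneg s₁, abs_nonneg s₂, abs_nonneg b₀, abs_nonneg b₁,
    abs_nonneg b₂]

end LP

theorem norm_snd_triangle {z x y : Freq} (h : z + x + y = 0) : ‖x.2‖ ≤ ‖z.2‖ + ‖y.2‖ := by
  have h2 : x.2 = -(z.2 + y.2) := by
    have := congrArg Prod.snd h
    simp only [Prod.snd_add, Prod.snd_zero] at this
    linear_combination this
  rw [h2, norm_neg]; exact norm_add_le _ _

theorem coneDist_le_two_mul {z x y : Freq} (h : z + x + y = 0) :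
    coneDist x ≤ coneDist y + coneDist z + 2 * ‖z.2‖ := by
  have h1 : z.1 + x.1 + y.1 = 0 := congrArg Prod.fst h
  have h2 := norm_snd_triangle h
  have h3 := norm_snd_triangle (z := z) (x := y) (y := x) (by rw [← h]; abel)
  unfold coneDist
  cases abs_cases x.1 <;> cases abs_cases y.1 <;> cases abs_cases z.1 <;>
    cases abs_cases (|x.1| - ‖x.2‖) <;> cases abs_cases (|y.1| - ‖y.2‖) <;>
    cases abs_cases (|z.1| - ‖z.2‖) <;> linarith

theorem coneDist_le_sum {z x y : Freq} (h : z + x + y = 0) :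
    coneDist z ≤ coneDist x + coneDist y + ‖x.2‖ + ‖y.2‖ := by
  have h1 : z.1 + x.1 + y.1 = 0 := congrArg Prod.fst h
  have h2 := norm_snd_triangle (z := x) (x := z) (y := y) (by rw [← h]; abel)
  have h3 := norm_nonneg z.2
  unfold coneDist
  cases abs_cases x.1 <;> cases abs_cases y.1 <;> cases abs_cases z.1 <;>
    cases abs_cases (|x.1| - ‖x.2‖) <;> cases abs_cases (|y.1| - ‖y.2‖) <;>
    cases abs_cases (|z.1| - ‖z.2‖) <;> linarith

theorem coneDist_dichotomy {z x y : Freq} (h : z + x + y = 0) :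
    coneDist z ≤ coneDist x + coneDist y + 2 * ‖z.2‖ ∨
      ‖x.2‖ ≤ coneDist z + coneDist x + coneDist y + ‖z.2‖ := by
  have h1 : z.1 + x.1 + y.1 = 0 := congrArg Prod.fst h
  have h2 := norm_snd_triangle h
  have h3 := norm_snd_triangle (z := z) (x := y) (y := x) (by rw [← h]; abel)
  have h4 := norm_nonneg y.2
  by_contra! hc
  obtain ⟨hc, hc'⟩ := hc
  revert hc hc'
  unfold coneDist
  cases abs_cases x.1 <;> cases abs_cases y.1 <;> cases abs_cases z.1 <;>
    cases abs_cases (|x.1| - ‖x.2‖) <;> cases abs_cases (|y.1| - ‖y.2‖) <;>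
    cases abs_cases (|z.1| - ‖z.2‖) <;> intro hc hc' <;> linarith

theorem two_pow_mono {a b : ℕ} (h : a ≤ b) : (2 : ℝ) ^ a ≤ 2 ^ b :=
  pow_le_pow_right₀ (by norm_num) h

theorem fr_le_succ {z x y : Freq} (h : z + x + y = 0) (h02 : fr z ≤ fr y) : fr x ≤ fr y + 1 := by
  by_contra! hc
  have h1 := two_pow_mono (show fr y + 2 ≤ fr x by omega)
  rw [pow_add] at h1
  linarith [fr_le x, lt_fr z, lt_fr y, norm_snd_triangle h, two_pow_mono h02]

theorem mo_le_of_low {z x y : Freq} (h : z + x + y = 0) :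
    mo x ≤ mo y + 3 ∨ mo x ≤ mo z + 3 ∨ mo x ≤ fr z + 3 := by
  by_contra! hc
  obtain ⟨h1, h2, h3⟩ := hc
  have e1 := two_pow_mono (show mo y + 4 ≤ mo x by omega)
  have e2 := two_pow_mono (show mo z + 4 ≤ mo x by omega)
  have e3 := two_pow_mono (show fr z + 4 ≤ mo x by omega)
  rw [pow_add] at e1 e2 e3
  have e4 : (0 : ℝ) < 2 ^ mo x := by positivity
  linarith [mo_le x, lt_mo y, lt_mo z, lt_fr z, coneDist_le_two_mul h]

theorem mo_le_of_sum {z x y : Freq} (h : z + x + y = 0) (h21 : mo y ≤ mo x)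
    (hf : fr y ≤ fr x + 1) : mo z ≤ mo x + 3 ∨ mo z ≤ fr x + 3 := by
  by_contra! hc
  obtain ⟨h1, h2⟩ := hc
  have e1 := two_pow_mono (show mo x + 4 ≤ mo z by omega)
  have e2 := two_pow_mono (show fr x + 4 ≤ mo z by omega)
  have e3 := two_pow_mono h21
  have e5 := two_pow_mono hf
  rw [pow_add] at e1 e2 e5
  have e4 : (0 : ℝ) < 2 ^ mo z := by positivity
  linarith [mo_le z, lt_mo x, lt_mo y, lt_fr x, lt_fr y, coneDist_le_sum h]

theorem fr_le_mo_of_lt {z x y : Freq} (h : z + x + y = 0) (h21 : mo y ≤ mo x) :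
    mo z ≤ mo x + 3 ∨ mo z ≤ fr z + 3 ∨ fr x ≤ mo z + 2 := by
  by_contra! hc
  obtain ⟨h1, h2, h3⟩ := hc
  have e1 := two_pow_mono (show mo x + 4 ≤ mo z by omega)
  have e2 := two_pow_mono (show fr z + 4 ≤ mo z by omega)
  have e3 := two_pow_mono h21
  have e5 := two_pow_mono (show mo z + 3 ≤ fr x by omega)
  rw [pow_add] at e1 e2 e5
  have e4 : (0 : ℝ) < 2 ^ mo z := by positivity
  rcases coneDist_dichotomy h with hd | hd <;>
    linarith [mo_le z, lt_mo z, lt_mo x, lt_mo y, fr_le x, lt_fr z]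

/-- The reciprocal of the square root of the wave-Sobolev weight. -/
def wt (s b : ℝ) (ζ : Freq) : ℝ≥0∞ :=
  ENNReal.ofReal ((1 + ‖ζ.2‖ ^ 2) ^ (-s / 2) * (1 + coneDist ζ) ^ (-b))

theorem measurable_wt (s b : ℝ) : Measurable (wt s b) := by
  have := measurable_coneDist
  unfold wt
  fun_prop

theorem rpow_le_two_rpow {t a h p : ℝ} (h1 : 2 ^ (a - h) ≤ t) (h2 : t ≤ 2 ^ (a + h)) :
    t ^ p ≤ 2 ^ (a * p + h * |p|) := by
  have h0 : 0 < t := lt_of_lt_of_le (by positivity) h1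
  rcases le_total 0 p with hp | hp
  · rw [abs_of_nonneg hp, ← add_mul, Real.rpow_mul (by norm_num)]
    exact Real.rpow_le_rpow h0.le h2 hp
  · rw [abs_of_nonpos hp, show a * p + h * -p = (a - h) * p by ring,
      Real.rpow_mul (by norm_num)]
    exact Real.rpow_le_rpow_of_nonpos (by positivity) h1 hp

theorem wt_le (s b : ℝ) (ζ : Freq) :
    wt s b ζ ≤ ENNReal.ofReal (2 ^ (|s| + |b| - s * fr ζ - b * mo ζ)) := by
  refine ENNReal.ofReal_le_ofReal ?_
  have h1 := fr_le ζ
  have h2 := lt_fr ζ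
  have h3 := mo_le ζ
  have h4 := lt_mo ζ
  have h5 := norm_nonneg ζ.2
  have h6 : (0 : ℝ) < 2 ^ fr ζ := by positivity
  have h7 : (0 : ℝ) < 2 ^ mo ζ := by positivity
  have e1 : (1 + ‖ζ.2‖ ^ 2) ^ (-s / 2) ≤ 2 ^ ((2 * fr ζ : ℝ) * (-s / 2) + 2 * |-s / 2|) := by
    apply rpow_le_two_rpow
    · rw [Real.rpow_sub (by norm_num), mul_comm, Real.rpow_mul (by norm_num)]
      simp only [Real.rpow_natCast, Real.rpow_ofNat]
      nlinarith [sq_nonneg (‖ζ.2‖ - 1)]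
    · rw [Real.rpow_add (by norm_num), mul_comm (2 : ℝ) (fr ζ : ℝ), Real.rpow_mul (by norm_num)]
      simp only [Real.rpow_natCast, Real.rpow_ofNat]
      nlinarith
  have e2 : (1 + coneDist ζ) ^ (-b) ≤ 2 ^ ((mo ζ : ℝ) * (-b) + 1 * |-b|) := by
    apply rpow_le_two_rpow
    · rw [Real.rpow_sub (by norm_num)]
      simp only [Real.rpow_natCast, Real.rpow_one]
      linarith
    · rw [Real.rpow_add (by norm_num)]
      simp only [Real.rpow_natCast, Real.rpow_one]
      linarith
  calc _ ≤ 2 ^ ((2 * fr ζ : ℝ) * (-s / 2) + 2 * |-s / 2|) *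
        2 ^ ((mo ζ : ℝ) * (-b) + 1 * |-b|) :=
        mul_le_mul e1 e2 (Real.rpow_nonneg (by linarith) _) (by positivity)
    _ = _ := by
        rw [← Real.rpow_add (by norm_num), abs_div, abs_neg, abs_neg,
          abs_of_pos (show (0 : ℝ) < 2 by norm_num)]
        ring_nf

/-- The weight of the trilinear form. -/
def ker (s₀ s₁ s₂ b₀ b₁ b₂ : ℝ) (z x y : Freq) : ℝ≥0∞ := wt s₀ b₀ z * wt s₁ b₁ x * wt s₂ b₂ y

theorem meas3_ker (s₀ s₁ s₂ b₀ b₁ b₂ : ℝ) : Meas3 (ker s₀ s₁ s₂ b₀ b₁ b₂) := by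
  have h0 := measurable_wt s₀ b₀
  have h1 := measurable_wt s₁ b₁
  have h2 := measurable_wt s₂ b₂
  unfold Meas3 ker
  fun_prop

/-- The loss in passing from weights to their dyadic values. -/
def wtLoss (s₀ s₁ s₂ b₀ b₁ b₂ : ℝ) : ℝ := |s₀| + |s₁| + |s₂| + |b₀| + |b₁| + |b₂|

theorem ker_le (s₀ s₁ s₂ b₀ b₁ b₂ : ℝ) (z x y : Freq) :
    ker s₀ s₁ s₂ b₀ b₁ b₂ z x y ≤ ENNReal.ofReal (2 ^ (wtLoss s₀ s₁ s₂ b₀ b₁ b₂ -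
      expo s₀ s₁ s₂ b₀ b₁ b₂ (fr z) (mo z) (fr x) (mo x) (fr y) (mo y) / 2)) := by
  refine (mul_le_mul' (mul_le_mul' (wt_le _ _ _) (wt_le _ _ _)) (wt_le _ _ _)).trans ?_
  rw [← ENNReal.ofReal_mul (by positivity), ← ENNReal.ofReal_mul (by positivity),
    ← Real.rpow_add (by norm_num), ← Real.rpow_add (by norm_num)]
  refine ENNReal.ofReal_le_ofReal (le_of_eq ?_)
  unfold expo wtLoss
  ring_nf

/-- Decaying exponential weight. -/
def geo (ε t : ℝ) : ℝ≥0∞ := ENNReal.ofReal (2 ^ (-(ε * t)))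

theorem geo_add (ε s t : ℝ) : geo ε (s + t) = geo ε s * geo ε t := by
  unfold geo
  rw [← ENNReal.ofReal_mul (by positivity), ← Real.rpow_add (by norm_num)]
  ring_nf

/-- The constant in the estimates for dyadic blocks. -/
def blockConst (δ s₀ s₁ s₂ b₀ b₁ b₂ : ℝ) : ℝ≥0∞ :=
  ENNReal.ofReal (55738368 * 145 ^ 2 *
    2 ^ (wtLoss s₀ s₁ s₂ b₀ b₁ b₂ + errConst δ s₀ s₁ s₂ b₀ b₁ b₂ / 2))

theorem triBound_block {R : Freq → Freq → Freq → Prop} {δ s₀ s₁ s₂ b₀ b₁ b₂ C e E σ : ℝ}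
    {f : Freq → Freq → Freq → ℝ≥0∞} {M : ℝ≥0∞}
    (T : TriBound (ind R) (ENNReal.ofReal (C * 2 ^ (e / 2)))) (hC : C ≤ 55738368 * 145 ^ 2)
    (hE : δ / 8 * σ - errConst δ s₀ s₁ s₂ b₀ b₁ b₂ ≤ E - e)
    (hf : ∀ z x y, z + x + y = 0 → f z x y ≤
      ENNReal.ofReal (2 ^ (wtLoss s₀ s₁ s₂ b₀ b₁ b₂ - E / 2)) * ind R z x y)
    (hM : geo (δ / 16) σ ≤ M) :
    TriBound f (blockConst δ s₀ s₁ s₂ b₀ b₁ b₂ * M) := by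
  refine (T.const_mul (c := ENNReal.ofReal (2 ^ (wtLoss s₀ s₁ s₂ b₀ b₁ b₂ - E / 2)))
    ENNReal.ofReal_ne_top).mono hf ?_
  refine le_trans ?_ (mul_le_mul_right hM _)
  unfold blockConst geo
  rw [← ENNReal.ofReal_mul (by positivity), ← ENNReal.ofReal_mul (by positivity)]
  refine ENNReal.ofReal_le_ofReal ?_
  calc 2 ^ (wtLoss s₀ s₁ s₂ b₀ b₁ b₂ - E / 2) * (C * 2 ^ (e / 2))
      = C * 2 ^ (wtLoss s₀ s₁ s₂ b₀ b₁ b₂ - (E - e) / 2) := by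
        rw [mul_left_comm, ← Real.rpow_add (by norm_num)]; ring_nf
    _ ≤ 55738368 * 145 ^ 2 * 2 ^ (wtLoss s₀ s₁ s₂ b₀ b₁ b₂ -
        (δ / 8 * σ - errConst δ s₀ s₁ s₂ b₀ b₁ b₂) / 2) := by
        refine mul_le_mul hC (Real.rpow_le_rpow_of_exponent_le (by norm_num) (by linarith))
          (by positivity) (by positivity)
    _ = _ := by
        rw [mul_assoc (55738368 * 145 ^ 2 : ℝ), ← Real.rpow_add (by norm_num)]; ring_nf

/-- Total decay of the dyadic estimates. -/
def decay (ε : ℝ) (n₀ l₀ n₁ l₁ n₂ l₂ : ℕ) : ℝ≥0∞ :=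
  geo ε (n₀ + |(n₁ - n₂ : ℝ)| + l₀ + |(l₁ - l₂ : ℝ)|) +
    geo ε (n₀ + |(n₁ - n₂ : ℝ)| + |(l₁ - l₂ : ℝ)| + |(l₀ - n₁ : ℝ)|) +
    geo ε (n₀ + |(n₁ - n₂ : ℝ)| + l₂ + |(l₀ - l₁ : ℝ)|)

theorem ker_blk_le (s₀ s₁ s₂ b₀ b₁ b₂ : ℝ) {n₀ l₀ n₁ l₁ n₂ l₂ : ℕ}
    {R : Freq → Freq → Freq → Prop} (hR : ∀ z x y, Blk n₀ l₀ n₁ l₁ n₂ l₂ z x y → R z x y)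
    (z x y : Freq) :
    ker s₀ s₁ s₂ b₀ b₁ b₂ z x y * ind (Blk n₀ l₀ n₁ l₁ n₂ l₂) z x y ≤
      ENNReal.ofReal (2 ^ (wtLoss s₀ s₁ s₂ b₀ b₁ b₂ -
        expo s₀ s₁ s₂ b₀ b₁ b₂ n₀ l₀ n₁ l₁ n₂ l₂ / 2)) * ind R z x y := by
  by_cases h : Blk n₀ l₀ n₁ l₁ n₂ l₂ z x y
  · rw [ind, if_pos h, ind, if_pos (hR _ _ _ h), mul_one, mul_one]
    obtain ⟨⟨⟨rfl, rfl⟩, rfl, rfl⟩, rfl, rfl⟩ := h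
    exact ker_le _ _ _ _ _ _ _ _ _
  · rw [ind, if_neg h, mul_zero]; exact zero_le

theorem pow_sum_le {n₀ l₀ l₁ l₂ : ℕ} (h0 : l₀ ≤ n₀ + 7) (h1 : l₁ ≤ n₀ + 3) (h2 : l₂ ≤ l₁) :
    (2 : ℝ) * 2 ^ n₀ + 2 * 2 ^ l₀ + 2 * 2 ^ l₁ + 2 * 2 ^ l₂ ≤ 145 * (2 * 2 ^ n₀) := by
  have e0 := two_pow_mono h0
  have e1 := two_pow_mono h1
  have e2 := two_pow_mono h2
  rw [pow_add] at e0 e1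
  have : (0 : ℝ) < 2 ^ n₀ := by positivity
  linarith

theorem triBound_ker_blk {δ s₀ s₁ s₂ b₀ b₁ b₂ : ℝ} (h : Adm δ s₀ s₁ s₂ b₀ b₁ b₂)
    {n₀ l₀ n₁ l₁ n₂ l₂ : ℕ} (h01 : n₀ ≤ n₁) (h02 : n₀ ≤ n₂) (h21 : l₂ ≤ l₁)
    (c1 : n₁ ≤ n₂ + 1) (c1' : n₂ ≤ n₁ + 1) (c2 : l₁ ≤ l₂ + 3 ∨ l₁ ≤ l₀ + 3 ∨ l₁ ≤ n₀ + 3)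
    (c3 : l₀ ≤ l₁ + 3 ∨ l₀ ≤ n₁ + 3) (c4 : l₀ ≤ l₁ + 3 ∨ l₀ ≤ n₀ + 3 ∨ n₁ ≤ l₀ + 2)
    (hE : δ ≤ -2 * b₁ ∨ l₁ ≤ n₀ + 3 ∨ l₀ ≤ l₁ + 7) :
    TriBound (fun z x y => ker s₀ s₁ s₂ b₀ b₁ b₂ z x y * ind (Blk n₀ l₀ n₁ l₁ n₂ l₂) z x y)
      (blockConst δ s₀ s₁ s₂ b₀ b₁ b₂ * decay (δ / 16) n₀ l₀ n₁ l₁ n₂ l₂) := by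
  have r01 : (n₀ : ℝ) ≤ n₁ := by exact_mod_cast h01
  have r21 : (l₂ : ℝ) ≤ l₁ := by exact_mod_cast h21
  have rc1 : (n₁ : ℝ) ≤ n₂ + 1 := by exact_mod_cast c1
  have rc1' : (n₂ : ℝ) ≤ n₁ + 1 := by exact_mod_cast c1'
  have p0 : (0 : ℝ) ≤ n₀ := Nat.cast_nonneg _
  have p1 : (0 : ℝ) ≤ l₀ := Nat.cast_nonneg _
  have p2 : (0 : ℝ) ≤ l₂ := Nat.cast_nonneg _
  have hn : |(n₂ - n₁ : ℝ)| ≤ 1 := by rw [abs_le]; constructor <;> linarith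
  have hn' : |(n₁ - n₂ : ℝ)| ≤ 1 := by rw [abs_sub_comm]; exact hn
  have hl : |(l₁ - l₂ : ℝ)| = l₁ - l₂ := abs_of_nonneg (by linarith)
  have hA : geo (δ / 16) (n₀ + |(n₁ - n₂ : ℝ)| + l₀ + |(l₁ - l₂ : ℝ)|) ≤
      decay (δ / 16) n₀ l₀ n₁ l₁ n₂ l₂ := le_self_add.trans le_self_add
  have hB : geo (δ / 16) (n₀ + |(n₁ - n₂ : ℝ)| + |(l₁ - l₂ : ℝ)| + |(l₀ - n₁ : ℝ)|) ≤
      decay (δ / 16) n₀ l₀ n₁ l₁ n₂ l₂ := le_add_self.trans le_self_add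
  have hC : geo (δ / 16) (n₀ + |(n₁ - n₂ : ℝ)| + l₂ + |(l₀ - l₁ : ℝ)|) ≤
      decay (δ / 16) n₀ l₀ n₁ l₁ n₂ l₂ := le_add_self
  have self := fun z x y (_ : z + x + y = 0) =>
    ker_blk_le s₀ s₁ s₂ b₀ b₁ b₂ (fun z x y (h : Blk n₀ l₀ n₁ l₁ n₂ l₂ z x y) => h) z x y
  have left := fun z x y (_ : z + x + y = 0) => ker_blk_le s₀ s₁ s₂ b₀ b₁ b₂
    (fun z x y (h : Blk n₀ l₀ n₁ l₁ n₂ l₂ z x y) => h.1.1) z x y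
  have right := fun z x y (_ : z + x + y = 0) => ker_blk_le s₀ s₁ s₂ b₀ b₁ b₂
    (fun z x y (h : Blk n₀ l₀ n₁ l₁ n₂ l₂ z x y) => And.intro h.1.1.1 h.2.2) z x y
  by_cases h1 : l₁ ≤ n₀ + 3
  · have r1 : (l₁ : ℝ) ≤ n₀ + 3 := by exact_mod_cast h1
    by_cases h0 : l₀ ≤ n₀ + 7
    · have r0 : (l₀ : ℝ) ≤ n₀ + 7 := by exact_mod_cast h0
      by_cases hn1 : n₁ = 0
      · obtain rfl : n₀ = 0 := by omega
        have z0 : (n₁ : ℝ) = 0 := by exact_mod_cast hn1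
        rw [Nat.cast_zero] at r0 r1
        refine triBound_block (triBound_trivial₀ 0 l₀) (by norm_num)
          (lp_small h hn z0 Nat.cast_zero ?_ ?_ ?_ ?_) left hA
        · rw [abs_of_nonneg p1]; linarith
        · rw [abs_of_nonneg (by linarith)]; linarith
        · rw [abs_of_nonneg p2]; linarith
        · rw [Nat.cast_zero, hl]; linarith
      have hn1' : 1 ≤ n₁ := by omega
      have hσ : n₀ + |(n₁ - n₂ : ℝ)| + l₀ + |(l₁ - l₂ : ℝ)| ≤ 3 * n₀ + 11 := by
        rw [hl]; linarith
      rcases le_total l₀ l₁ with h01l | h10l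
      · have r01l : (l₀ : ℝ) ≤ l₁ := by exact_mod_cast h01l
        exact triBound_block (triBound_ball hn1' h01 (Or.inr (Or.inl le_rfl))) (by norm_num)
          (lp_ball_left h hn r01 p2 p1 r1 r01l r21 hσ) self hA
      · have r10l : (l₁ : ℝ) ≤ l₀ := by exact_mod_cast h10l
        rcases le_total (n₀ + l₀) (n₁ + l₁ + 8) with hs | hs
        · have rs : (n₀ + l₀ : ℝ) ≤ n₁ + l₁ + 8 := by exact_mod_cast hs
          exact triBound_block (triBound_ball hn1' h01 (Or.inl le_rfl)) (by norm_num)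
            (lp_ball_right h hn p2 r10l r0 rs r21 hσ) self hA
        · have rs : (n₁ + l₁ + 8 : ℝ) ≤ n₀ + l₀ := by exact_mod_cast hs
          exact triBound_block (triBound_annulus (by norm_num) (by omega) h01 c1'
            (pow_sum_le h0 h1 h21)) (by norm_num) (lp_annulus h hn r01 p2 r10l r0 rs r21 hσ) self hA
    · have r2 : (l₀ : ℝ) ≤ n₁ + 3 := by exact_mod_cast (show l₀ ≤ n₁ + 3 by omega)
      have r3 : (n₁ : ℝ) ≤ l₀ + 2 := by exact_mod_cast (show n₁ ≤ l₀ + 2 by omega)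
      have h0n : |(l₀ - n₁ : ℝ)| ≤ 3 := by rw [abs_le]; constructor <;> linarith
      exact triBound_block (triBound_elliptic (by omega) (by omega) h1 h21) (by norm_num)
        (lp_elliptic h hn r01 p2 h0n r1 r21 (by rw [hl]; linarith)) self hB
  · have r1 : (n₀ : ℝ) ≤ l₁ := by exact_mod_cast (show n₀ ≤ l₁ by omega)
    by_cases h0 : l₀ ≤ l₁ + 7
    · have r0 : (l₀ : ℝ) ≤ l₁ + 7 := by exact_mod_cast h0
      by_cases h12 : l₁ ≤ l₂ + 3
      · have r12 : (l₁ : ℝ) ≤ l₂ + 3 := by exact_mod_cast h12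
        have hl' : |(l₂ - l₁ : ℝ)| ≤ 3 := by rw [abs_le]; constructor <;> linarith
        exact triBound_block (triBound_trivial₀ n₀ l₀) (by norm_num)
          (lp_trivial_left h hn r01 p0 p1 hl' r1 r0 (by rw [hl]; linarith)) left hA
      · have r10 : (l₁ : ℝ) ≤ l₀ + 3 := by exact_mod_cast (show l₁ ≤ l₀ + 3 by omega)
        have hl' : |(l₀ - l₁ : ℝ)| ≤ 7 := by rw [abs_le]; constructor <;> linarith
        exact triBound_block (triBound_trivial₂ n₀ l₂) (by norm_num)
          (lp_trivial_right h hn r01 p0 p2 hl' r1 r21 (by linarith)) right hC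
    · have hb : δ ≤ -2 * b₁ := by
        rcases hE with hE | hE | hE
        · exact hE
        · omega
        · omega
      have r2 : (l₀ : ℝ) ≤ n₁ + 3 := by exact_mod_cast (show l₀ ≤ n₁ + 3 by omega)
      have r3 : (n₁ : ℝ) ≤ l₀ + 2 := by exact_mod_cast (show n₁ ≤ l₀ + 2 by omega)
      have r4 : (l₁ : ℝ) ≤ n₁ := by exact_mod_cast (show l₁ ≤ n₁ by omega)
      have r5 : (l₁ : ℝ) ≤ l₀ := by exact_mod_cast (show l₁ ≤ l₀ by omega)
      have h0n : |(l₀ - n₁ : ℝ)| ≤ 3 := by rw [abs_le]; constructor <;> linarith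
      have hl' : |(l₀ - l₁ : ℝ)| = l₀ - l₁ := abs_of_nonneg (by linarith)
      exact triBound_block (triBound_trivial₂ n₀ l₂) (by norm_num)
        (lp_wide_neg h hn p0 p2 hb h0n r1 r21 r4 (by rw [hl']; linarith)) right hC

theorem triBound_ker_wide {δ s₀ s₁ s₂ b₀ b₁ b₂ : ℝ} (h : Adm δ s₀ s₁ s₂ b₀ b₁ b₂) (hb : 0 ≤ b₁)
    {n₀ l₀ n₁ n₂ l₂ : ℕ} (h01 : n₀ ≤ n₁) (c1 : n₁ ≤ n₂ + 1) (c1' : n₂ ≤ n₁ + 1)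
    (c3 : l₀ ≤ n₁ + 3) (c4 : n₁ ≤ l₀ + 2) (h2 : l₂ ≤ n₁) {f : Freq → Freq → Freq → ℝ≥0∞}
    (hf : ∀ z x y, z + x + y = 0 → f z x y ≠ 0 → f z x y ≤ ker s₀ s₁ s₂ b₀ b₁ b₂ z x y ∧
      Blk n₀ l₀ n₁ (mo x) n₂ l₂ z x y ∧ n₀ ≤ mo x ∧ l₂ ≤ mo x) :
    TriBound f (blockConst δ s₀ s₁ s₂ b₀ b₁ b₂ *
      geo (δ / 16) (n₀ + |(n₁ - n₂ : ℝ)| + l₂ + |(l₀ - n₁ : ℝ)|)) := by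
  have r01 : (n₀ : ℝ) ≤ n₁ := by exact_mod_cast h01
  have rc1 : (n₁ : ℝ) ≤ n₂ + 1 := by exact_mod_cast c1
  have rc1' : (n₂ : ℝ) ≤ n₁ + 1 := by exact_mod_cast c1'
  have rc2 : (l₂ : ℝ) ≤ n₁ := by exact_mod_cast h2
  have r3 : (l₀ : ℝ) ≤ n₁ + 3 := by exact_mod_cast c3
  have r4 : (n₁ : ℝ) ≤ l₀ + 2 := by exact_mod_cast c4
  have p0 : (0 : ℝ) ≤ n₀ := Nat.cast_nonneg _
  have p2 : (0 : ℝ) ≤ l₂ := Nat.cast_nonneg _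
  have hn : |(n₂ - n₁ : ℝ)| ≤ 1 := by rw [abs_le]; constructor <;> linarith
  have hn' : |(n₁ - n₂ : ℝ)| ≤ 1 := by rw [abs_sub_comm]; exact hn
  have h0n : |(l₀ - n₁ : ℝ)| ≤ 3 := by rw [abs_le]; constructor <;> linarith
  refine triBound_block (triBound_trivial₂ n₀ l₂) (by norm_num)
    (lp_wide_nonneg h hn p0 p2 h0n r01 rc2 (by linarith)) (fun z x y hs => ?_) le_rfl
  by_cases h0 : f z x y = 0
  · rw [h0]; exact zero_le
  obtain ⟨hk, ⟨⟨⟨rfl, rfl⟩, rfl, -⟩, rfl, rfl⟩, hm0, hm2⟩ := hf z x y hs h0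
  rw [ind, if_pos ⟨rfl, rfl⟩, mul_one]
  refine hk.trans ((ker_le _ _ _ _ _ _ _ _ _).trans (ENNReal.ofReal_le_ofReal ?_))
  refine Real.rpow_le_rpow_of_exponent_le (by norm_num) ?_
  have hmax : max (mo y : ℝ) (fr z) ≤ mo x := by
    exact max_le (by exact_mod_cast hm2) (by exact_mod_cast hm0)
  have := mul_le_mul_of_nonneg_left hmax hb
  unfold expo
  linarith

def geoSum (ε : ℝ) : ℝ≥0∞ := ∑' k : ℤ, geo ε |(k : ℝ)|

theorem geo_natCast (ε : ℝ) (n : ℕ) : geo ε n = ENNReal.ofReal (2 ^ (-ε)) ^ n := by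
  unfold geo
  rw [← ENNReal.ofReal_pow (by positivity), ← Real.rpow_mul_natCast (by norm_num), neg_mul]

theorem tsum_geo_ne_top {ε : ℝ} (hε : 0 < ε) : ∑' n : ℕ, geo ε n ≠ ∞ := by
  simp_rw [geo_natCast]
  rw [ENNReal.tsum_geometric, ENNReal.inv_ne_top, Ne, tsub_eq_zero_iff_le, not_le,
    ENNReal.ofReal_lt_one]
  exact Real.rpow_lt_one_of_one_lt_of_neg (by norm_num) (by linarith)

theorem geoSum_ne_top {ε : ℝ} (hε : 0 < ε) : geoSum ε ≠ ∞ := by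
  have h := HasSum.of_nat_of_neg_add_one (f := fun k : ℤ => geo ε |(k : ℝ)|)
    (ENNReal.summable.hasSum) (ENNReal.summable.hasSum)
  unfold geoSum
  rw [h.tsum_eq, ENNReal.add_ne_top]
  refine ⟨?_, ?_⟩
  · simpa using tsum_geo_ne_top hε
  · refine ne_top_of_le_ne_top (tsum_geo_ne_top hε) (ENNReal.tsum_le_tsum fun n => ?_)
    unfold geo
    refine ENNReal.ofReal_le_ofReal (Real.rpow_le_rpow_of_exponent_le (by norm_num) ?_)
    rw [abs_of_nonpos (by push_cast; linarith [Nat.cast_nonneg (α := ℝ) n])]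
    push_cast
    linarith

theorem one_le_geoSum (ε : ℝ) : 1 ≤ geoSum ε := by
  refine le_trans (le_of_eq ?_) (ENNReal.le_tsum (0 : ℤ))
  simp [geo]

theorem tsum_geo_sub_le (ε : ℝ) (b : ℕ) : ∑' n : ℕ, geo ε |(n - b : ℝ)| ≤ geoSum ε := by
  have := ENNReal.tsum_comp_le_tsum_of_injective (f := fun n : ℕ => (n - b : ℤ))
    (fun a c h => by simpa using h) (fun k : ℤ => geo ε |(k : ℝ)|)
  simpa [geoSum] using this

theorem tsum_geo_sub_le' (ε : ℝ) (b : ℕ) : ∑' n : ℕ, geo ε |(b - n : ℝ)| ≤ geoSum ε := by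
  simp_rw [abs_sub_comm (b : ℝ)]
  exact tsum_geo_sub_le ε b

theorem tsum_geo_le (ε : ℝ) : ∑' n : ℕ, geo ε n ≤ geoSum ε := by
  simpa using tsum_geo_sub_le ε 0

theorem tsum_mul_prod {α β : Type*} (f : α → ℝ≥0∞) (g : β → ℝ≥0∞) :
    ∑' p : α × β, f p.1 * g p.2 = (∑' a, f a) * ∑' b, g b := by
  rw [ENNReal.tsum_prod (f := fun a b => f a * g b)]
  simp_rw [ENNReal.tsum_mul_left, ENNReal.tsum_mul_right]

theorem tsum_four_le {f₁ f₂ f₃ f₄ : ℕ → ℝ≥0∞} {G : ℝ≥0∞} (h₁ : ∑' n, f₁ n ≤ G)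
    (h₂ : ∑' n, f₂ n ≤ G) (h₃ : ∑' n, f₃ n ≤ G) (h₄ : ∑' n, f₄ n ≤ G) :
    ∑' p : (ℕ × ℕ) × (ℕ × ℕ), (f₁ p.1.1 * f₂ p.1.2) * (f₃ p.2.1 * f₄ p.2.2) ≤ G ^ 4 := by
  rw [tsum_mul_prod (fun q : ℕ × ℕ => f₁ q.1 * f₂ q.2) (fun q : ℕ × ℕ => f₃ q.1 * f₄ q.2),
    tsum_mul_prod, tsum_mul_prod]
  calc _ ≤ (G * G) * (G * G) := mul_le_mul' (mul_le_mul' h₁ h₂) (mul_le_mul' h₃ h₄)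
    _ = _ := by ring

theorem tsum_two_le {f₁ f₂ : ℕ → ℝ≥0∞} {G : ℝ≥0∞} (hG : 1 ≤ G) (h₁ : ∑' n, f₁ n ≤ G)
    (h₂ : ∑' n, f₂ n ≤ G) : ∑' p : ℕ × ℕ, f₁ p.1 * f₂ p.2 ≤ G ^ 4 := by
  rw [tsum_mul_prod]
  calc _ ≤ G * G := mul_le_mul' h₁ h₂
    _ = G ^ 2 := by ring
    _ ≤ _ := pow_le_pow_right₀ hG (by norm_num)

theorem tsum_decay_outer_le (ε : ℝ) (b : ℕ × ℕ) :
    ∑' p : (ℕ × ℕ) × (ℕ × ℕ), decay ε p.1.1 p.1.2 b.1 b.2 p.2.1 p.2.2 ≤ 3 * geoSum ε ^ 4 := by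
  unfold decay
  rw [ENNReal.tsum_add, ENNReal.tsum_add]
  calc _ ≤ geoSum ε ^ 4 + geoSum ε ^ 4 + geoSum ε ^ 4 := by
        refine add_le_add (add_le_add ?_ ?_) ?_
        · refine le_trans (le_of_eq (tsum_congr fun p => ?_)) (tsum_four_le (tsum_geo_le ε)
            (tsum_geo_le ε) (tsum_geo_sub_le' ε b.1) (tsum_geo_sub_le' ε b.2))
          simp only [geo_add]; ring
        · refine le_trans (le_of_eq (tsum_congr fun p => ?_)) (tsum_four_le (tsum_geo_le ε)
            (tsum_geo_sub_le ε b.1) (tsum_geo_sub_le' ε b.1) (tsum_geo_sub_le' ε b.2))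
          simp only [geo_add]; ring
        · refine le_trans (le_of_eq (tsum_congr fun p => ?_)) (tsum_four_le (tsum_geo_le ε)
            (tsum_geo_sub_le ε b.2) (tsum_geo_sub_le' ε b.1) (tsum_geo_le ε))
          simp only [geo_add]; ring
    _ = _ := by ring

theorem geo_mono {ε s t : ℝ} (hε : 0 < ε) (h : s ≤ t) : geo ε t ≤ geo ε s := by
  unfold geo
  refine ENNReal.ofReal_le_ofReal (Real.rpow_le_rpow_of_exponent_le (by norm_num) ?_)
  have := mul_le_mul_of_nonneg_left h hε.le
  linarith

theorem tsum_decay_inner_le {ε : ℝ} (hε : 0 < ε) (a c : ℕ × ℕ) :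
    ∑' b : ℕ × ℕ, decay ε a.1 a.2 b.1 b.2 c.1 c.2 ≤ 3 * geoSum ε ^ 4 := by
  have p0 : (0 : ℝ) ≤ a.1 := Nat.cast_nonneg _
  have p1 : (0 : ℝ) ≤ a.2 := Nat.cast_nonneg _
  have p2 : (0 : ℝ) ≤ c.2 := Nat.cast_nonneg _
  unfold decay
  rw [ENNReal.tsum_add, ENNReal.tsum_add]
  calc _ ≤ geoSum ε ^ 4 + geoSum ε ^ 4 + geoSum ε ^ 4 := by
        refine add_le_add (add_le_add ?_ ?_) ?_
        · refine le_trans (ENNReal.tsum_le_tsum fun b => ?_) (tsum_two_le (one_le_geoSum ε)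
            (tsum_geo_sub_le ε c.1) (tsum_geo_sub_le ε c.2))
          rw [← geo_add]
          exact geo_mono hε (by linarith)
        · refine le_trans (ENNReal.tsum_le_tsum fun b => ?_) (tsum_two_le (one_le_geoSum ε)
            (tsum_geo_sub_le ε c.1) (tsum_geo_sub_le ε c.2))
          rw [← geo_add]
          exact geo_mono hε (by linarith [abs_nonneg (a.2 - b.1 : ℝ)])
        · refine le_trans (ENNReal.tsum_le_tsum fun b => ?_) (tsum_two_le (one_le_geoSum ε)
            (tsum_geo_sub_le ε c.1) (tsum_geo_sub_le' ε a.2))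
          rw [← geo_add]
          exact geo_mono hε (by linarith)
    _ = _ := by ring

/-- The frequency `z` is lowest, and `x` has larger modulation than `y`. -/
def Canonical (z x y : Freq) : Prop := (fr z ≤ fr x ∧ fr z ≤ fr y) ∧ mo y ≤ mo x

/-- The modulation of `x` lies strictly between the frequency and the modulation of `z`. -/
def Wide (z x _ : Freq) : Prop := fr z + 3 < mo x ∧ mo x + 7 < mo z

theorem measRel_canonical : MeasRel Canonical := by
  have h0 := measurable_fr
  have h1 := measurable_mo
  refine (MeasRel.and ?_ ?_).and ?_
  · exact measurableSet_le (f := fun p : Freq × Freq × Freq => fr p.1)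
      (g := fun p : Freq × Freq × Freq => fr p.2.1) (by fun_prop) (by fun_prop)
  · exact measurableSet_le (f := fun p : Freq × Freq × Freq => fr p.1)
      (g := fun p : Freq × Freq × Freq => fr p.2.2) (by fun_prop) (by fun_prop)
  · exact measurableSet_le (f := fun p : Freq × Freq × Freq => mo p.2.2)
      (g := fun p : Freq × Freq × Freq => mo p.2.1) (by fun_prop) (by fun_prop)

theorem measRel_wide : MeasRel Wide := by
  have h0 := measurable_fr
  have h1 := measurable_mo
  refine MeasRel.and ?_ ?_
  · exact measurableSet_lt (f := fun p : Freq × Freq × Freq => fr p.1 + 3)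
      (g := fun p : Freq × Freq × Freq => mo p.2.1) (by fun_prop) (by fun_prop)
  · exact measurableSet_lt (f := fun p : Freq × Freq × Freq => mo p.2.1 + 7)
      (g := fun p : Freq × Freq × Freq => mo p.1) (by fun_prop) (by fun_prop)

theorem measRel_not {P : Freq → Freq → Freq → Prop} (h : MeasRel P) :
    MeasRel fun z x y => ¬ P z x y := MeasurableSet.compl h

theorem measRel_const (p : Prop) : MeasRel fun _ _ _ => p := MeasurableSet.const p

theorem MeasRel.or {P Q : Freq → Freq → Freq → Prop} (hP : MeasRel P) (hQ : MeasRel Q) :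
    MeasRel fun z x y => P z x y ∨ Q z x y := MeasurableSet.union hP hQ

theorem ind_le_one (P : Freq → Freq → Freq → Prop) (z x y : Freq) : ind P z x y ≤ 1 := by
  unfold ind; split_ifs <;> simp

theorem ind_of {P : Freq → Freq → Freq → Prop} {z x y : Freq} (h : P z x y) : ind P z x y = 1 :=
  if_pos h

theorem of_ind_ne_zero {P : Freq → Freq → Freq → Prop} {z x y : Freq} (h : ind P z x y ≠ 0) :
    P z x y := by
  by_contra hc
  exact h (if_neg hc)

theorem triBound_narrow {δ s₀ s₁ s₂ b₀ b₁ b₂ : ℝ} (h : Adm δ s₀ s₁ s₂ b₀ b₁ b₂) :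
    TriBound (fun z x y => ker s₀ s₁ s₂ b₀ b₁ b₂ z x y *
      ind (fun z x y => Canonical z x y ∧ (δ ≤ -2 * b₁ ∨ ¬ Wide z x y)) z x y)
      (blockConst δ s₀ s₁ s₂ b₀ b₁ b₂ * (3 * geoSum (δ / 16) ^ 4)) := by
  classical
  have hε : 0 < δ / 16 := by linarith [h.pos]
  have hκ : Measurable fun ζ : Freq => (fr ζ, mo ζ) := measurable_fr.prodMk measurable_mo
  have hR : MeasRel (fun z x y => Canonical z x y ∧ (δ ≤ -2 * b₁ ∨ ¬ Wide z x y)) :=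
    measRel_canonical.and ((measRel_const _).or (measRel_not measRel_wide))
  refine triBound_of_blocks hκ hκ hκ ((meas3_ker _ _ _ _ _ _).mul hR.meas3)
    (fun a b c => blockConst δ s₀ s₁ s₂ b₀ b₁ b₂ * decay (δ / 16) a.1 a.2 b.1 b.2 c.1 c.2) _
    ?_ (fun b => ?_) (fun a c => ?_)
  · rintro ⟨n₀, l₀⟩ ⟨n₁, l₁⟩ ⟨n₂, l₂⟩
    by_cases hne : ∃ z x y : Freq, z + x + y = 0 ∧ Blk n₀ l₀ n₁ l₁ n₂ l₂ z x y ∧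
      Canonical z x y ∧ (δ ≤ -2 * b₁ ∨ ¬ Wide z x y)
    · obtain ⟨z, x, y, hs, ⟨⟨⟨rfl, rfl⟩, rfl, rfl⟩, rfl, rfl⟩, ⟨⟨hc1, hc2⟩, hc3⟩, hw⟩ := hne
      have hs' : z + y + x = 0 := by rw [← hs]; abel
      have d1 := fr_le_succ hs' hc1
      refine (triBound_ker_blk h hc1 hc2 hc3 (fr_le_succ hs hc2) d1
        (mo_le_of_low hs) (mo_le_of_sum hs hc3 d1) (fr_le_mo_of_lt hs hc3) ?_).mono ?_ le_rfl
      · rcases hw with hw | hw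
        · exact Or.inl hw
        · unfold Wide at hw; omega
      · intro z' x' y' _
        split_ifs with hif
        · simp only [Prod.mk.injEq] at hif
          rw [ind_of (P := Blk _ _ _ _ _ _) ⟨⟨hif.1, hif.2.1⟩, hif.2.2⟩]
          exact mul_le_mul_right (ind_le_one _ _ _ _) _
        · exact zero_le
    · refine triBound_zero (fun z x y hs => ?_) _
      split_ifs with hif
      · simp only [Prod.mk.injEq] at hif
        rw [ind, if_neg, mul_zero]
        exact fun hR => hne ⟨z, x, y, hs, ⟨⟨hif.1, hif.2.1⟩, hif.2.2⟩, hR⟩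
      · rfl
  · rw [ENNReal.tsum_mul_left]
    exact mul_le_mul_right (tsum_decay_outer_le _ b) _
  · rw [ENNReal.tsum_mul_left]
    exact mul_le_mul_right (tsum_decay_inner_le hε a c) _

theorem triBound_wide {δ s₀ s₁ s₂ b₀ b₁ b₂ : ℝ} (h : Adm δ s₀ s₁ s₂ b₀ b₁ b₂) (hb : 0 ≤ b₁) :
    TriBound (fun z x y => ker s₀ s₁ s₂ b₀ b₁ b₂ z x y *
      ind (fun z x y => Canonical z x y ∧ Wide z x y) z x y)
      (blockConst δ s₀ s₁ s₂ b₀ b₁ b₂ * geoSum (δ / 16) ^ 4) := by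
  classical
  have hε : 0 < δ / 16 := by linarith [h.pos]
  have hκ : Measurable fun ζ : Freq => (fr ζ, mo ζ) := measurable_fr.prodMk measurable_mo
  have hR : MeasRel (fun z x y => Canonical z x y ∧ Wide z x y) :=
    measRel_canonical.and measRel_wide
  refine triBound_of_blocks hκ measurable_fr hκ ((meas3_ker _ _ _ _ _ _).mul hR.meas3)
    (fun a b c => blockConst δ s₀ s₁ s₂ b₀ b₁ b₂ *
      geo (δ / 16) (a.1 + |(b - c.1 : ℝ)| + c.2 + |(a.2 - b : ℝ)|)) _
    ?_ (fun b => ?_) (fun a c => ?_)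
  · rintro ⟨n₀, l₀⟩ n₁ ⟨n₂, l₂⟩
    by_cases hne : ∃ z x y : Freq, z + x + y = 0 ∧ Blk n₀ l₀ n₁ (mo x) n₂ l₂ z x y ∧
      Canonical z x y ∧ Wide z x y
    · obtain ⟨z, x, y, hs, ⟨⟨⟨rfl, rfl⟩, rfl, -⟩, rfl, rfl⟩, ⟨⟨hc1, hc2⟩, hc3⟩, hw1, hw2⟩ := hne
      have hs' : z + y + x = 0 := by rw [← hs]; abel
      have d1 := fr_le_succ hs' hc1
      have d2 := mo_le_of_sum hs hc3 d1
      have d3 := fr_le_mo_of_lt hs hc3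
      refine triBound_ker_wide h hb hc1 (fr_le_succ hs hc2) d1 (by omega) (by omega) (by omega) ?_
      intro z' x' y' _ hne
      split_ifs at hne ⊢ with hif
      · simp only [Prod.mk.injEq] at hif
        have hI := of_ind_ne_zero (right_ne_zero_of_mul hne)
        obtain ⟨⟨⟨i1, i2⟩, i3⟩, i4, i5⟩ := hI
        refine ⟨mul_le_of_le_one_right' (ind_le_one _ _ _ _), ⟨⟨hif.1, hif.2.1, rfl⟩, hif.2.2⟩,
          ?_, ?_⟩
        · have := hif.1.1; omega
        · have := hif.2.2.2; omega
      · exact absurd rfl hne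
    · refine triBound_zero (fun z x y hs => ?_) _
      split_ifs with hif
      · simp only [Prod.mk.injEq] at hif
        rw [ind, if_neg, mul_zero]
        exact fun hR => hne ⟨z, x, y, hs, ⟨⟨hif.1, hif.2.1, rfl⟩, hif.2.2⟩, hR⟩
      · rfl
  · rw [ENNReal.tsum_mul_left]
    refine mul_le_mul_right (le_trans (le_of_eq (tsum_congr fun p => ?_)) (tsum_four_le
      (tsum_geo_le _) (tsum_geo_sub_le _ b) (tsum_geo_sub_le' _ b) (tsum_geo_le _))) _
    simp only [geo_add]; ring
  · rw [ENNReal.tsum_mul_left]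
    refine mul_le_mul_right (le_trans (ENNReal.tsum_le_tsum fun b => ?_)
      ((tsum_geo_sub_le (δ / 16) c.1).trans (le_self_pow₀ (one_le_geoSum _) (by norm_num)))) _
    refine geo_mono hε ?_
    linarith [Nat.cast_nonneg (α := ℝ) a.1, Nat.cast_nonneg (α := ℝ) c.2,
      abs_nonneg (a.2 - b : ℝ)]

theorem triBound_canonical {δ s₀ s₁ s₂ b₀ b₁ b₂ : ℝ} (h : Adm δ s₀ s₁ s₂ b₀ b₁ b₂) :
    TriBound (fun z x y => ker s₀ s₁ s₂ b₀ b₁ b₂ z x y * ind Canonical z x y)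
      (blockConst δ s₀ s₁ s₂ b₀ b₁ b₂ * (4 * geoSum (δ / 16) ^ 4)) := by
  have hN := triBound_narrow h
  rcases h.g1 with hb | hb
  · have hR : MeasRel (fun z x y => Canonical z x y ∧ (δ ≤ -2 * b₁ ∨ ¬ Wide z x y)) :=
      measRel_canonical.and ((measRel_const _).or (measRel_not measRel_wide))
    refine (hN.add (triBound_wide h hb) ((meas3_ker _ _ _ _ _ _).mul hR.meas3)).mono
      (fun z x y _ => ?_) (le_of_eq (by ring))
    rw [← mul_add]
    refine mul_le_mul_right ?_ _
    by_cases hc : Canonical z x y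
    · by_cases hw : Wide z x y
      · rw [ind_of hc, ind_of (P := fun z x y => Canonical z x y ∧ Wide z x y) ⟨hc, hw⟩]
        exact le_add_self
      · rw [ind_of hc, ind_of (P := fun z x y => Canonical z x y ∧ (δ ≤ -2 * b₁ ∨ ¬ Wide z x y))
          ⟨hc, Or.inr hw⟩]
        exact le_self_add
    · rw [ind, if_neg hc]; exact zero_le
  · refine hN.mono (fun z x y _ => mul_le_mul_right ?_ _) (by gcongr; norm_num)
    by_cases hc : Canonical z x y
    · rw [ind_of hc, ind_of (P := fun z x y => Canonical z x y ∧ (δ ≤ -2 * b₁ ∨ ¬ Wide z x y))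
        ⟨hc, Or.inl hb⟩]
    · rw [ind, if_neg hc]; exact zero_le

theorem blockConst_mul_ne_top {δ s₀ s₁ s₂ b₀ b₁ b₂ : ℝ} (hδ : 0 < δ) :
    blockConst δ s₀ s₁ s₂ b₀ b₁ b₂ * (4 * geoSum (δ / 16) ^ 4) ≠ ∞ :=
  ENNReal.mul_ne_top ENNReal.ofReal_ne_top (ENNReal.mul_ne_top (by norm_num)
    (ENNReal.pow_ne_top (geoSum_ne_top (by linarith))))

/-- The frequency `z` is lowest. -/
def Low (z x y : Freq) : Prop := fr z ≤ fr x ∧ fr z ≤ fr y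

theorem measRel_low : MeasRel Low := by
  have h0 := measurable_fr
  refine MeasRel.and ?_ ?_
  · exact measurableSet_le (f := fun p : Freq × Freq × Freq => fr p.1)
      (g := fun p : Freq × Freq × Freq => fr p.2.1) (by fun_prop) (by fun_prop)
  · exact measurableSet_le (f := fun p : Freq × Freq × Freq => fr p.1)
      (g := fun p : Freq × Freq × Freq => fr p.2.2) (by fun_prop) (by fun_prop)

theorem triBound_low {δ s₀ s₁ s₂ b₀ b₁ b₂ : ℝ} (h : Adm δ s₀ s₁ s₂ b₀ b₁ b₂) :
    ∃ K, K ≠ ∞ ∧ TriBound (fun z x y => ker s₀ s₁ s₂ b₀ b₁ b₂ z x y * ind Low z x y) K := by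
  refine ⟨_, ENNReal.add_ne_top.2 ⟨blockConst_mul_ne_top h.pos, blockConst_mul_ne_top h.pos⟩,
    ((triBound_canonical h).add (triBound_canonical h.swap12).swap12
      ((meas3_ker _ _ _ _ _ _).mul measRel_canonical.meas3)).mono (fun z x y _ => ?_) le_rfl⟩
  have hk : ker s₀ s₂ s₁ b₀ b₂ b₁ z y x = ker s₀ s₁ s₂ b₀ b₁ b₂ z x y := by unfold ker; ring
  rw [hk, ← mul_add]
  refine mul_le_mul_right ?_ _
  by_cases hl : Low z x y
  · rw [ind_of hl]
    rcases le_total (mo y) (mo x) with hm | hm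
    · rw [ind_of (P := Canonical) (z := z) (x := x) (y := y) ⟨hl, hm⟩]; exact le_self_add
    · rw [ind_of (P := Canonical) (z := z) (x := y) (y := x) ⟨hl.symm, hm⟩]; exact le_add_self
  · rw [ind, if_neg hl]; exact zero_le

theorem triBound_ker {δ s₀ s₁ s₂ b₀ b₁ b₂ : ℝ} (h : Adm δ s₀ s₁ s₂ b₀ b₁ b₂) :
    ∃ K, K ≠ ∞ ∧ TriBound (ker s₀ s₁ s₂ b₀ b₁ b₂) K := by
  have hm : ∀ s₀ s₁ s₂ b₀ b₁ b₂ : ℝ,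
      Meas3 fun z x y => ker s₀ s₁ s₂ b₀ b₁ b₂ z x y * ind Low z x y := fun _ _ _ _ _ _ =>
    (meas3_ker _ _ _ _ _ _).mul measRel_low.meas3
  obtain ⟨K₀, f₀, t₀⟩ := triBound_low h
  obtain ⟨K₁, f₁, t₁⟩ := triBound_low h.swap01
  obtain ⟨K₂, f₂, t₂⟩ := triBound_low h.swap12.swap01
  have t₁' := t₁.swap01 (hm _ _ _ _ _ _)
  have t₂' := (t₂.swap01 (hm _ _ _ _ _ _)).swap12
  have m₁ : Meas3 fun z x y => ker s₁ s₀ s₂ b₁ b₀ b₂ x z y * ind Low x z y :=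
    (hm s₁ s₀ s₂ b₁ b₀ b₂).comp (a := fun p : Freq × Freq × Freq => p.2.1) (by fun_prop)
      (b := fun p => p.1) (by fun_prop) (c := fun p => p.2.2) (by fun_prop)
  refine ⟨_, ENNReal.add_ne_top.2 ⟨ENNReal.add_ne_top.2 ⟨f₀, f₁⟩, f₂⟩,
    ((t₀.add t₁' (hm _ _ _ _ _ _)).add t₂' ((hm _ _ _ _ _ _).add m₁)).mono
      (fun z x y _ => ?_) le_rfl⟩
  have k₁ : ker s₁ s₀ s₂ b₁ b₀ b₂ x z y = ker s₀ s₁ s₂ b₀ b₁ b₂ z x y := by unfold ker; ring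
  have k₂ : ker s₂ s₀ s₁ b₂ b₀ b₁ y z x = ker s₀ s₁ s₂ b₀ b₁ b₂ z x y := by unfold ker; ring
  rw [k₁, k₂, ← mul_add, ← mul_add]
  refine le_mul_of_one_le_right' ?_
  rcases le_total (fr z) (fr x) with h1 | h1 <;> rcases le_total (fr z) (fr y) with h2 | h2 <;>
    rcases le_total (fr x) (fr y) with h3 | h3
  all_goals
    first
    | rw [ind_of (P := Low) (z := z) (x := x) (y := y) ⟨by omega, by omega⟩, add_assoc]
      exact le_self_add
    | rw [ind_of (P := Low) (z := x) (x := z) (y := y) ⟨by omega, by omega⟩]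
      exact le_add_self.trans le_self_add
    | rw [ind_of (P := Low) (z := y) (x := z) (y := x) ⟨by omega, by omega⟩]
      exact le_add_self

theorem exists_adm {s₀ s₁ s₂ b₀ b₁ b₂ : ℝ}
    (ha : b₀ + b₁ + b₂ > 1 / 2)
    (hb : b₀ + b₁ ≥ 0) (hc : b₀ + b₂ ≥ 0) (hd : b₁ + b₂ ≥ 0)
    (he : s₀ + s₁ + s₂ > 3 / 2 - (b₀ + b₁ + b₂))
    (hf : s₀ + s₁ + s₂ > 1 - min (b₀ + b₁) (min (b₀ + b₂) (b₁ + b₂)))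
    (hg : s₀ + s₁ + s₂ > 1 / 2 - min b₀ (min b₁ b₂))
    (hh : s₀ + s₁ + s₂ > 3 / 4)
    (hi : (s₀ + b₀) + 2 * s₁ + 2 * s₂ > 1)
    (hj : 2 * s₀ + (s₁ + b₁) + 2 * s₂ > 1)
    (hk : 2 * s₀ + 2 * s₁ + (s₂ + b₂) > 1)
    (hl : s₁ + s₂ ≥ max 0 (-b₀))
    (hm : s₀ + s₂ ≥ max 0 (-b₁))
    (hn : s₀ + s₁ ≥ max 0 (-b₂)) : ∃ δ, Adm δ s₀ s₁ s₂ b₀ b₁ b₂ := by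
  have ev : ∀ {c : ℝ}, 0 < c → ∀ᶠ δ : ℝ in nhdsWithin 0 (Set.Ioi 0), δ ≤ c := fun hc =>
    nhdsWithin_le_nhds (Filter.Eventually.mono (Iio_mem_nhds hc) fun _ h => le_of_lt h)
  have evb : ∀ b : ℝ, ∀ᶠ δ : ℝ in nhdsWithin 0 (Set.Ioi 0), 0 ≤ b ∨ δ ≤ -2 * b := fun b => by
    rcases le_or_gt 0 b with hb | hb
    · exact Filter.Eventually.of_forall fun _ => Or.inl hb
    · exact (ev (by linarith)).mono fun _ h => Or.inr h
  have hpos : ∀ᶠ δ : ℝ in nhdsWithin 0 (Set.Ioi 0), 0 < δ := self_mem_nhdsWithin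
  have f1 := min_le_left (b₀ + b₁) (min (b₀ + b₂) (b₁ + b₂))
  have f2 := min_le_right (b₀ + b₁) (min (b₀ + b₂) (b₁ + b₂))
  have f3 := min_le_left (b₀ + b₂) (b₁ + b₂)
  have f4 := min_le_right (b₀ + b₂) (b₁ + b₂)
  have g1 := min_le_left b₀ (min b₁ b₂)
  have g2 := min_le_right b₀ (min b₁ b₂)
  have g3 := min_le_left b₁ b₂
  have g4 := min_le_right b₁ b₂
  have l1 := le_max_left 0 (-b₀)
  have l2 := le_max_right 0 (-b₀)
  have l3 := le_max_left 0 (-b₁)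
  have l4 := le_max_right 0 (-b₁)
  have l5 := le_max_left 0 (-b₂)
  have l6 := le_max_right 0 (-b₂)
  have ev1 : ∀ᶠ δ : ℝ in nhdsWithin 0 (Set.Ioi 0), δ ≤ 2 * (s₀ + s₁ + s₂) - 3 / 2 ∧
      δ ≤ 2 * (b₀ + b₁ + b₂) - 1 ∧ δ ≤ 2 * (s₀ + s₁ + s₂) + 2 * (b₀ + b₁ + b₂) - 3 :=
    (ev (by linarith)).and ((ev (by linarith)).and (ev (by linarith)))
  have ev2 : ∀ᶠ δ : ℝ in nhdsWithin 0 (Set.Ioi 0), δ ≤ 2 * (s₀ + s₁ + s₂) + 2 * (b₀ + b₁) - 2 ∧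
      δ ≤ 2 * (s₀ + s₁ + s₂) + 2 * (b₀ + b₂) - 2 ∧
      δ ≤ 2 * (s₀ + s₁ + s₂) + 2 * (b₁ + b₂) - 2 :=
    (ev (by linarith)).and ((ev (by linarith)).and (ev (by linarith)))
  have ev3 : ∀ᶠ δ : ℝ in nhdsWithin 0 (Set.Ioi 0), δ ≤ 2 * (s₀ + s₁ + s₂) + 2 * b₀ - 1 ∧
      δ ≤ 2 * (s₀ + s₁ + s₂) + 2 * b₁ - 1 ∧ δ ≤ 2 * (s₀ + s₁ + s₂) + 2 * b₂ - 1 :=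
    (ev (by linarith)).and ((ev (by linarith)).and (ev (by linarith)))
  have ev4 : ∀ᶠ δ : ℝ in nhdsWithin 0 (Set.Ioi 0), δ ≤ 2 * s₀ + 4 * s₁ + 4 * s₂ + 2 * b₀ - 2 ∧
      δ ≤ 4 * s₀ + 2 * s₁ + 4 * s₂ + 2 * b₁ - 2 ∧ δ ≤ 4 * s₀ + 4 * s₁ + 2 * s₂ + 2 * b₂ - 2 :=
    (ev (by linarith)).and ((ev (by linarith)).and (ev (by linarith)))
  obtain ⟨δ, h0, ⟨h1, h2, h3⟩, ⟨h4, h5, h6⟩, ⟨h7, h8, h9⟩, ⟨h10, h11, h12⟩, h13, h14, h15⟩ :=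
    (hpos.and (ev1.and (ev2.and (ev3.and (ev4.and
      ((evb b₀).and ((evb b₁).and (evb b₂)))))))).exists
  exact ⟨δ, by constructor <;> first | assumption | linarith⟩

theorem wt_mul_wt_neg (s b : ℝ) (z : Freq) : wt s b z * wt (-s) (-b) z = 1 := by
  have h1 : (0 : ℝ) < 1 + ‖z.2‖ ^ 2 := by positivity
  have h2 : (0 : ℝ) < 1 + coneDist z := by have := coneDist_nonneg z; linarith
  unfold wt
  rw [← ENNReal.ofReal_mul (by positivity), ← ENNReal.ofReal_one]
  congr 1
  rw [mul_mul_mul_comm, ← rpow_add h1, ← rpow_add h2]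
  simp [neg_div]

theorem wt_neg_freq (s b : ℝ) (z : Freq) : wt s b (-z) = wt s b z := by
  simp [wt, coneDist]

/-- Dualization: a bound for the trilinear form controls weighted convolutions in `L²`. -/
theorem l2n_wt_mul_le {s₀ s₁ s₂ b₀ b₁ b₂ : ℝ} {K : ℝ≥0∞}
    (T : TriBound (ker s₀ s₁ s₂ b₀ b₁ b₂) K) {H U V : Freq → ℝ≥0∞} (hH : Measurable H)
    (hU : Measurable U) (hV : Measurable V) (hle : ∀ z, H z ≤ ∫⁻ x, U x * V (z - x))
    (hfin : l2n volume (fun z => wt s₀ b₀ z * H z) ≠ ∞) :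
    l2n volume (fun z => wt s₀ b₀ z * H z) ≤
      K * (l2n volume (fun z => wt (-s₁) (-b₁) z * U z) *
        l2n volume (fun z => wt (-s₂) (-b₂) z * V z)) := by
  set A := l2n volume (fun z => wt s₀ b₀ z * H z) with hA
  rcases eq_or_ne A 0 with h0 | h0
  · rw [h0]; exact zero_le
  have mF : Measurable fun z => wt s₀ b₀ z * H z := (measurable_wt s₀ b₀).mul hH
  have key := T (fun z => wt s₀ b₀ (-z) * H (-z)) (fun z => wt (-s₁) (-b₁) z * U z)
    (fun z => wt (-s₂) (-b₂) z * V z) (mF.comp measurable_neg)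
    ((measurable_wt _ _).mul hU) ((measurable_wt _ _).mul hV)
  have hl : l2n volume (fun z => wt s₀ b₀ (-z) * H (-z)) = A := by
    rw [hA]; unfold l2n
    congr 1
    exact lintegral_neg_eq_self (μ := (volume : Measure Freq))
      (fun z => (wt s₀ b₀ z * H z) ^ 2)
  have hsq : A ^ 2 ≤ tri (fun z x y => ker s₀ s₁ s₂ b₀ b₁ b₂ z x y *
      ((wt s₀ b₀ (-z) * H (-z)) * (wt (-s₁) (-b₁) x * U x) * (wt (-s₂) (-b₂) y * V y))) := by
    rw [hA, l2n_sq, ← lintegral_neg_eq_self (μ := (volume : Measure Freq))]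
    refine lintegral_mono fun z => ?_
    calc (wt s₀ b₀ (-z) * H (-z)) ^ 2
        ≤ (wt s₀ b₀ (-z) * H (-z)) * (wt s₀ b₀ (-z) * ∫⁻ x, U x * V (-z - x)) := by
          rw [sq]; gcongr; exact hle _
      _ = ∫⁻ x, (wt s₀ b₀ (-z) * H (-z)) * (wt s₀ b₀ (-z) * (U x * V (-z - x))) := by
          have m1 : Measurable fun x => U x * V (-z - x) :=
            hU.mul (hV.comp (measurable_const.sub measurable_id))
          rw [← lintegral_const_mul _ m1, ← lintegral_const_mul _ (m1.const_mul _)]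
      _ = _ := by
          refine lintegral_congr fun x => ?_
          have e : -z - x = -(z + x) := by abel
          rw [e]
          have h1 := wt_mul_wt_neg s₁ b₁ x
          have h2 := wt_mul_wt_neg s₂ b₂ (-(z + x))
          unfold ker
          beta_reduce
          rw [← wt_neg_freq s₀ b₀ z]
          calc _ = wt s₀ b₀ (-z) * H (-z) * (wt s₀ b₀ (-z) *
                (((wt s₁ b₁ x * wt (-s₁) (-b₁) x) * U x) *
                ((wt s₂ b₂ (-(z + x)) * wt (-s₂) (-b₂) (-(z + x))) * V (-(z + x))))) := by
                rw [h1, h2, one_mul, one_mul]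
            _ = _ := by ring
  rw [hl] at key
  have h3 := hsq.trans key
  have h4 : A * A ≤ A * (K * (l2n volume (fun z => wt (-s₁) (-b₁) z * U z) *
      l2n volume (fun z => wt (-s₂) (-b₂) z * V z))) := by
    calc A * A = A ^ 2 := (sq A).symm
      _ ≤ _ := h3
      _ = _ := by ring
  exact (ENNReal.mul_le_mul_iff_right h0 hfin).1 h4

theorem fourier_fourier_apply (u : SchwartzMap SpaceTime ℂ) (x : SpaceTime) :
    𝓕 (𝓕 u) x = u (-x) := by
  have h : 𝓕⁻ (𝓕 u) (-x) = u (-x) := by simp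
  rw [← h, SchwartzMap.fourierInv_coe, Real.fourierInv_eq_fourier_neg, neg_neg]
  rfl

/-- The Fourier transform turns products of Schwartz functions into convolutions. -/
theorem fourier_mul_eq_convolution (u v : SchwartzMap SpaceTime ℂ) :
    𝓕 (fun x => u x * v x) =
      SchwartzMap.convolution (ContinuousLinearMap.mul ℂ ℂ) (𝓕 u) (𝓕 v) := by
  set h := SchwartzMap.convolution (ContinuousLinearMap.mul ℂ ℂ) (𝓕 u) (𝓕 v) with hh
  have h1 : (fun x => u x * v x) = (𝓕⁻ h : SchwartzMap SpaceTime ℂ) := by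
    funext x
    rw [SchwartzMap.fourierInv_coe, Real.fourierInv_eq_fourier_neg, ← SchwartzMap.fourier_coe, hh,
      SchwartzMap.fourier_convolution, SchwartzMap.pairing_apply_apply]
    simp [fourier_fourier_apply]
  rw [h1, ← SchwartzMap.fourier_coe]
  simp

theorem enorm_fourier_mul_le (u v : SchwartzMap SpaceTime ℂ) (ζ : SpaceTime) :
    ‖𝓕 (fun x => u x * v x) ζ‖ₑ ≤ ∫⁻ η, ‖𝓕 u η‖ₑ * ‖𝓕 v (ζ - η)‖ₑ := by
  rw [fourier_mul_eq_convolution, SchwartzMap.convolution_apply, convolution_def]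
  refine (enorm_integral_le_lintegral_enorm _).trans_eq ?_
  simp [enorm_mul]

/-- Space-time frequencies as pairs. -/
def freqEquiv : SpaceTime ≃ᵐ Freq :=
  (MeasurableEquiv.toLp 2 (Fin 3 → ℝ)).symm.trans
    ((MeasurableEquiv.piFinSuccAbove (fun _ => ℝ) 0).trans
      ((MeasurableEquiv.refl ℝ).prodCongr Complex.measurableEquivPi.symm))

theorem freqEquiv_apply (ζ : SpaceTime) : freqEquiv ζ = (ζ 0, ⟨ζ 1, ζ 2⟩) := by
  simp only [freqEquiv, MeasurableEquiv.trans_apply]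
  exact Prod.ext rfl ((Complex.measurableEquivPi_symm_apply _).trans (Complex.mk_eq_add_mul_I _ _).symm)

theorem measurePreserving_freqEquiv : MeasurePreserving freqEquiv := by
  refine (EuclideanSpace.volume_preserving_symm_measurableEquiv_toLp (Fin 3)).trans ?_
  refine (volume_preserving_piFinSuccAbove (fun _ : Fin 3 => ℝ) 0).trans ?_
  exact (MeasurePreserving.id volume).prod Complex.volume_preserving_equiv_pi.symm

theorem freqEquiv_sub (ζ η : SpaceTime) : freqEquiv (ζ - η) = freqEquiv ζ - freqEquiv η := by
  simp only [freqEquiv_apply]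
  refine Prod.ext rfl (Complex.ext rfl rfl)

theorem norm_freqEquiv_snd (ζ : SpaceTime) : ‖(freqEquiv ζ).2‖ = spFreq ζ := by
  rw [freqEquiv_apply, Complex.norm_def, Complex.normSq_mk, spFreq, sq, sq]

theorem coneDist_freqEquiv (ζ : SpaceTime) : coneDist (freqEquiv ζ) = |(|ζ 0| - spFreq ζ)| := by
  rw [coneDist, norm_freqEquiv_snd, freqEquiv_apply]

theorem freqEquiv_symm_sub (z x : Freq) :
    freqEquiv.symm (z - x) = freqEquiv.symm z - freqEquiv.symm x := by
  apply freqEquiv.injective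
  simp [freqEquiv_sub]

/-- The weighted `L²` norm of a Fourier transform in the coordinates of `Freq`. -/
theorem waveNorm_eq_l2n (s b : ℝ) (g : SchwartzMap SpaceTime ℂ) (f : SpaceTime → ℂ)
    (hf : 𝓕 f = g) : waveNorm s b f =
      (l2n volume fun z => wt (-s) (-b) z * ‖g (freqEquiv.symm z)‖ₑ).toReal := by
  unfold waveNorm l2n
  rw [← ENNReal.toReal_rpow]
  congr 1
  have mg : Measurable g := g.continuous.measurable
  rw [hf, ← measurePreserving_freqEquiv.lintegral_comp_emb freqEquiv.measurableEmbedding,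
    integral_eq_lintegral_of_nonneg_ae]
  · congr 1
    refine lintegral_congr fun ζ => ?_
    simp only [MeasurableEquiv.symm_apply_apply]
    unfold wt
    rw [norm_freqEquiv_snd, coneDist_freqEquiv, ← ofReal_norm,
      ← ENNReal.ofReal_mul (by positivity), ← ENNReal.ofReal_pow (by positivity)]
    congr 1
    have h1 : (0 : ℝ) ≤ 1 + spFreq ζ ^ 2 := by positivity
    have h2 : (0 : ℝ) ≤ 1 + |(|ζ 0| - spFreq ζ)| := by positivity
    rw [mul_pow, mul_pow, ← rpow_mul_natCast h1, ← rpow_mul_natCast h2]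
    congr 3
    · push_cast; ring
    · push_cast; ring
  · exact Filter.Eventually.of_forall fun ζ => by positivity
  · have h1 : Measurable spFreq := by unfold spFreq; fun_prop
    simp only [← Real.norm_eq_abs]
    exact (by fun_prop : Measurable _).aestronglyMeasurable

theorem rpow_le_pow_of_abs_le {x y a : ℝ} {n : ℕ} (hx : 1 ≤ x) (hxy : x ≤ y) (ha : |a| ≤ n) :
    x ^ a ≤ y ^ n := by
  rw [← rpow_natCast]
  calc x ^ a ≤ x ^ (n : ℝ) := rpow_le_rpow_of_exponent_le hx ((le_abs_self a).trans ha)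
    _ ≤ y ^ (n : ℝ) := rpow_le_rpow (by linarith) hxy (by positivity)

theorem spFreq_le_norm (ζ : SpaceTime) : spFreq ζ ≤ ‖ζ‖ := by
  rw [spFreq, EuclideanSpace.norm_eq, Fin.sum_univ_three]
  simp only [Real.norm_eq_abs, sq_abs]
  exact Real.sqrt_le_sqrt (by nlinarith [sq_nonneg (ζ 0)])

theorem coneDist_freqEquiv_le (ζ : SpaceTime) : coneDist (freqEquiv ζ) ≤ ‖ζ‖ := by
  have h0 : |ζ 0| ≤ ‖ζ‖ := by simpa using PiLp.norm_apply_le ζ 0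
  have h1 := spFreq_le_norm ζ
  have h2 : 0 ≤ spFreq ζ := Real.sqrt_nonneg _
  rw [coneDist_freqEquiv, abs_le]
  constructor <;> linarith [abs_nonneg (ζ 0)]

theorem exists_wt_freqEquiv_le (s b : ℝ) :
    ∃ n : ℕ, ∀ ζ, wt s b (freqEquiv ζ) ≤ ENNReal.ofReal ((1 + ‖ζ‖) ^ n) := by
  obtain ⟨m, hm⟩ := exists_nat_ge |(-s / 2)|
  obtain ⟨k, hk⟩ := exists_nat_ge |(-b)|
  refine ⟨2 * m + k, fun ζ => ENNReal.ofReal_le_ofReal ?_⟩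
  have h1 := spFreq_le_norm ζ
  have h2 : 0 ≤ spFreq ζ := Real.sqrt_nonneg _
  have h3 := coneDist_nonneg (freqEquiv ζ)
  have h4 := coneDist_freqEquiv_le ζ
  rw [norm_freqEquiv_snd, pow_add, pow_mul]
  exact mul_le_mul (rpow_le_pow_of_abs_le (by nlinarith) (by nlinarith) hm)
    (rpow_le_pow_of_abs_le (by linarith) (by linarith) hk) (by positivity) (by positivity)

theorem l2n_schwartz_ne_top (s b : ℝ) (g : SchwartzMap SpaceTime ℂ) :
    l2n volume (fun z => wt s b z * ‖g (freqEquiv.symm z)‖ₑ) ≠ ∞ := by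
  obtain ⟨n, hn⟩ := exists_wt_freqEquiv_le s b
  obtain ⟨M, hM⟩ : ∃ M : ℝ, ∀ ζ, ‖g ζ‖ ≤ M :=
    ⟨SchwartzMap.seminorm ℝ 0 0 g, fun ζ => SchwartzMap.norm_le_seminorm ℝ g ζ⟩
  refine ENNReal.rpow_ne_top_of_nonneg (by norm_num) ?_
  rw [← measurePreserving_freqEquiv.lintegral_comp_emb freqEquiv.measurableEmbedding]
  have hgint : Integrable fun ζ => 2 ^ (2 * n - 1) * M * (‖ζ‖ ^ 0 * ‖g ζ‖ + ‖ζ‖ ^ (2 * n) * ‖g ζ‖) :=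
    ((g.integrable_pow_mul volume 0).add (g.integrable_pow_mul volume (2 * n))).const_mul _
  refine ne_top_of_le_ne_top hgint.lintegral_lt_top.ne (lintegral_mono fun ζ => ?_)
  simp only [MeasurableEquiv.symm_apply_apply]
  calc (wt s b (freqEquiv ζ) * ‖g ζ‖ₑ) ^ 2
      ≤ (ENNReal.ofReal ((1 + ‖ζ‖) ^ n) * ENNReal.ofReal ‖g ζ‖) ^ 2 := by
        rw [ofReal_norm]; gcongr; exact hn ζ
    _ = ENNReal.ofReal ((1 + ‖ζ‖) ^ (2 * n) * (‖g ζ‖ * ‖g ζ‖)) := by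
        rw [← ENNReal.ofReal_mul (by positivity), ← ENNReal.ofReal_pow (by positivity)]
        congr 1; ring
    _ ≤ _ := ENNReal.ofReal_le_ofReal ?_
  have h1 := add_pow_le zero_le_one (norm_nonneg ζ) (2 * n)
  have h2 : (0 : ℝ) ≤ M := (norm_nonneg _).trans (hM ζ)
  calc (1 + ‖ζ‖) ^ (2 * n) * (‖g ζ‖ * ‖g ζ‖)
      ≤ (2 ^ (2 * n - 1) * (1 ^ (2 * n) + ‖ζ‖ ^ (2 * n))) * (M * ‖g ζ‖) := by
        gcongr; exact hM ζ
    _ = _ := by ring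

/-- The product estimate of D'Ancona, Foschi, and Selberg in dimension 2+1. -/
theorem dafs_product_estimate (s₀ s₁ s₂ b₀ b₁ b₂ : ℝ)
    (ha : b₀ + b₁ + b₂ > 1/2)
    (hb : b₀ + b₁ ≥ 0) (hc : b₀ + b₂ ≥ 0) (hd : b₁ + b₂ ≥ 0)
    (he : s₀ + s₁ + s₂ > 3/2 - (b₀ + b₁ + b₂))
    (hf : s₀ + s₁ + s₂ > 1 - min (b₀ + b₁) (min (b₀ + b₂) (b₁ + b₂)))
    (hg : s₀ + s₁ + s₂ > 1/2 - min b₀ (min b₁ b₂))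
    (hh : s₀ + s₁ + s₂ > 3/4)
    (hi : (s₀ + b₀) + 2 * s₁ + 2 * s₂ > 1)
    (hj : 2 * s₀ + (s₁ + b₁) + 2 * s₂ > 1)
    (hk : 2 * s₀ + 2 * s₁ + (s₂ + b₂) > 1)
    (hl : s₁ + s₂ ≥ max 0 (-b₀))
    (hm : s₀ + s₂ ≥ max 0 (-b₁))
    (hn : s₀ + s₁ ≥ max 0 (-b₂)) :
    ∃ C > 0, ∀ u v : SchwartzMap SpaceTime ℂ,
      waveNorm (-s₀) (-b₀) (fun x => u x * v x) ≤
        C * waveNorm s₁ b₁ (fun x => u x) * waveNorm s₂ b₂ (fun x => v x) := by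
  obtain ⟨δ, h⟩ := exists_adm ha hb hc hd he hf hg hh hi hj hk hl hm hn
  obtain ⟨K, hK, T⟩ := triBound_ker h
  refine ⟨K.toReal + 1, by positivity, fun u v => ?_⟩
  set w := SchwartzMap.convolution (ContinuousLinearMap.mul ℂ ℂ) (𝓕 u) (𝓕 v) with hw
  have hw' : 𝓕 (fun x => u x * v x) = w := fourier_mul_eq_convolution u v
  rw [waveNorm_eq_l2n _ _ w _ hw', waveNorm_eq_l2n s₁ b₁ (𝓕 u) _ (SchwartzMap.fourier_coe u).symm,
    waveNorm_eq_l2n s₂ b₂ (𝓕 v) _ (SchwartzMap.fourier_coe v).symm]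
  have meas (g : SchwartzMap SpaceTime ℂ) : Measurable fun z => ‖g (freqEquiv.symm z)‖ₑ :=
    (g.continuous.measurable.comp freqEquiv.symm.measurable).enorm
  have hconv : ∀ z : Freq, ‖w (freqEquiv.symm z)‖ₑ ≤
      ∫⁻ x : Freq, ‖𝓕 u (freqEquiv.symm x)‖ₑ * ‖𝓕 v (freqEquiv.symm (z - x))‖ₑ := by
    intro z
    rw [← hw', ← measurePreserving_freqEquiv.lintegral_comp_emb freqEquiv.measurableEmbedding]
    refine (enorm_fourier_mul_le u v _).trans_eq (lintegral_congr fun η => ?_)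
    simp [freqEquiv_symm_sub]
  have hfin := l2n_schwartz_ne_top s₀ b₀ w
  rw [neg_neg, neg_neg]
  have main := l2n_wt_mul_le T (meas w) (meas (𝓕 u)) (meas (𝓕 v)) hconv hfin
  have main' := ENNReal.toReal_mono (ENNReal.mul_ne_top hK (ENNReal.mul_ne_top
    (l2n_schwartz_ne_top (-s₁) (-b₁) (𝓕 u)) (l2n_schwartz_ne_top (-s₂) (-b₂) (𝓕 v)))) main
  rw [ENNReal.toReal_mul, ENNReal.toReal_mul] at main'
  refine main'.trans ?_
  rw [mul_assoc]
  gcongr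
  linarith

end
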